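/- arXiv:math/0512003 — 3 statements merged into one kernel-verified Lean document; each statement's English description precedes it below -/
import Mathlib

section
/- Every measurable function f : 𝕋 → ℂ can be represented as a sum of harmonics with positive spectrum converging in measure: there exist complex coefficients (c_k)_{k>0} such that the partial sums S_N(t) = ∑_{0<k≤N} c_k e^{ikt} converge to f in Lebesgue measure on 𝕋. -/
open MeasureTheory Filter Topology Real

instance : Fact (0 < 2 * π) := ⟨by positivity⟩

/-- The partial sum `S_N(t) = ∑_{0 < k ≤ N} c_k e^{ikt}` of a series with positive
spectrum on the circle `𝕋 = ℝ/2πℤ`. -/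
noncomputable def analyticPartialSum (c : ℕ → ℂ) (N : ℕ) (t : AddCircle (2 * π)) : ℂ :=
  ∑ k ∈ Finset.Icc 1 N, c k * fourier (k : ℤ) t



namespace Menshov

/-- The circle. -/
abbrev Circ := AddCircle (2 * π)

/-- Normalised Haar measure. -/
noncomputable abbrev hm : Measure Circ := AddCircle.haarAddCircle

/-- Evaluation of a trigonometric polynomial. -/
noncomputable def E : (ℤ →₀ ℂ) →ₗ[ℂ] (Circ → ℂ) :=
  Finsupp.linearCombination ℂ (fun k : ℤ => (⇑(fourier k : C(Circ, ℂ)) : Circ → ℂ))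

/-- Partial sums of a trigonometric polynomial. -/
noncomputable def S (m : ℤ) : (ℤ →₀ ℂ) →ₗ[ℂ] (ℤ →₀ ℂ) where
  toFun P := P.filter (· ≤ m)
  map_add' _ _ := Finsupp.filter_add
  map_smul' _ _ := Finsupp.filter_smul

/-- Frequency shift. -/
noncomputable def sh (n : ℤ) : (ℤ →₀ ℂ) →ₗ[ℂ] (ℤ →₀ ℂ) :=
  Finsupp.lmapDomain ℂ ℂ (· + n)

lemma E_single (k : ℤ) (c : ℂ) (x : Circ) : E (Finsupp.single k c) x = c * fourier k x := by
  simp [E]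

lemma E_eq_sum (P : ℤ →₀ ℂ) (x : Circ) : E P x = ∑ k ∈ P.support, P k * fourier k x := by
  simp [E, Finsupp.linearCombination_apply, Finsupp.sum]

lemma S_apply (m : ℤ) (P : ℤ →₀ ℂ) (k : ℤ) : S m P k = if k ≤ m then P k else 0 := by
  simp [S, Finsupp.filter_apply]

lemma sh_apply (n : ℤ) (P : ℤ →₀ ℂ) (k : ℤ) : sh n P k = P (k - n) := by
  have := Finsupp.mapDomain_apply (f := fun x : ℤ => x + n) (add_left_injective n) P (k - n)
  simpa [sh] using this

lemma norm_fourier_apply (k : ℤ) (x : Circ) : ‖(fourier k : C(Circ, ℂ)) x‖ = 1 := by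
  rw [fourier_apply]
  exact Circle.norm_coe _

lemma E_sh (n : ℤ) (P : ℤ →₀ ℂ) (x : Circ) : E (sh n P) x = fourier n x * E P x := by
  induction P using Finsupp.induction_linear with
  | zero => simp
  | add f g hf hg => simp [hf, hg, mul_add]
  | single a b =>
    have : sh n (Finsupp.single a b) = Finsupp.single (a + n) b := by
      simp [sh, Finsupp.mapDomain_single]
    rw [this, E_single, E_single, fourier_add]; ring

lemma S_sh (m n : ℤ) (P : ℤ →₀ ℂ) : S m (sh n P) = sh n (S (m - n) P) := by
  ext k
  simp only [S_apply, sh_apply]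
  congr 1
  simp

lemma S_of_le {m : ℤ} {P : ℤ →₀ ℂ} (h : ∀ k, P k ≠ 0 → k ≤ m) : S m P = P := by
  ext k
  rw [S_apply]
  split_ifs with h1
  · rfl
  · by_contra h2
    exact h1 (h k (fun h3 => h2 h3.symm))

lemma S_of_lt {m : ℤ} {P : ℤ →₀ ℂ} (h : ∀ k, P k ≠ 0 → m < k) : S m P = 0 := by
  ext k
  rw [S_apply]
  split_ifs with h1
  · by_contra h2
    exact absurd (h k h2) (by simpa using h1)
  · rfl

lemma continuous_E (P : ℤ →₀ ℂ) : Continuous (E P) := by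
  have : E P = fun x => ∑ k ∈ P.support, P k * (fourier k : C(Circ, ℂ)) x := by
    ext x; exact E_eq_sum P x
  rw [this]
  fun_prop

/-- Partial sums of a concatenation of blocks. -/
lemma S_blocks (B : ℕ → ℤ →₀ ℂ) (M : ℕ → ℤ) (hM : Monotone M)
    (h1 : ∀ i k, B i k ≠ 0 → M i < k) (h2 : ∀ i k, B i k ≠ 0 → k ≤ M (i + 1))
    (L : ℕ) (m : ℤ) :
    (∃ j < L, M j < m ∧ m ≤ M (j + 1) ∧ S m (∑ i ∈ Finset.range L, B i) =
      ∑ i ∈ Finset.range j, B i + S m (B j)) ∨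
    (m ≤ M 0 ∧ S m (∑ i ∈ Finset.range L, B i) = 0) ∨
    (M L < m ∧ S m (∑ i ∈ Finset.range L, B i) = ∑ i ∈ Finset.range L, B i) := by
  induction L with
  | zero =>
    rcases le_or_gt m (M 0) with h | h
    · right; left; simp [h]
    · right; right; simp [h]
  | succ L ih =>
    have hz : m ≤ M L → S m (B L) = 0 := fun h => S_of_lt fun k hk => lt_of_le_of_lt h (h1 L k hk)
    rw [Finset.sum_range_succ, map_add]
    rcases ih with ⟨j, hj, hj1, hj2, hj3⟩ | ⟨h, h'⟩ | ⟨h, h'⟩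
    · left
      refine ⟨j, by omega, hj1, hj2, ?_⟩
      rw [hj3, hz (hj2.trans (hM (by omega))), add_zero]
    · right; left
      refine ⟨h, ?_⟩
      rw [h', hz (h.trans (hM (by omega))), add_zero]
    · rcases le_or_gt m (M (L + 1)) with h3 | h3
      · left
        exact ⟨L, by omega, h, h3, by rw [h']⟩
      · right; right
        refine ⟨h3, ?_⟩
        rw [h', S_of_le (P := B L)]
        intro k hk
        exact (h2 L k hk).trans h3.le

/-- Sequential choice of blocks. -/
lemma exists_blocks (Q : ℕ → (ℤ →₀ ℂ) → (ℤ →₀ ℂ) → Prop)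
    (hQ : ∀ i R (M : ℤ), ∃ P : ℤ →₀ ℂ, (∀ k, P k ≠ 0 → M < k) ∧ Q i R P) (M₀ : ℤ) :
    ∃ (B : ℕ → ℤ →₀ ℂ) (M : ℕ → ℤ), StrictMono M ∧ M 0 = M₀ ∧
      (∀ i k, B i k ≠ 0 → M i < k) ∧ (∀ i k, B i k ≠ 0 → k ≤ M (i + 1)) ∧
      ∀ i, Q i (∑ j ∈ Finset.range i, B j) (B i) := by
  choose F hF1 hF2 using hQ
  have hb : ∀ (P : ℤ →₀ ℂ) (M : ℤ), ∃ M' : ℤ, M < M' ∧ ∀ k, P k ≠ 0 → k ≤ M' := by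
    intro P M
    refine ⟨|M| + 1 + ∑ k ∈ P.support, |k|, ?_, ?_⟩
    · have : 0 ≤ ∑ k ∈ P.support, |k| := Finset.sum_nonneg fun _ _ => abs_nonneg _
      have := le_abs_self M
      omega
    · intro k hk
      have h1 : |k| ≤ ∑ k ∈ P.support, |k| :=
        Finset.single_le_sum (f := fun k : ℤ => |k|) (fun _ _ => abs_nonneg _)
          (Finsupp.mem_support_iff.2 hk)
      have := le_abs_self k
      have := abs_nonneg M
      omega
  choose G hG1 hG2 using hb
  let st : ℕ → (ℤ →₀ ℂ) × ℤ := fun n => Nat.rec (0, M₀)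
    (fun i s => (s.1 + F i s.1 s.2, G (F i s.1 s.2) s.2)) n
  have hst : ∀ i, st (i + 1) =
    ((st i).1 + F i (st i).1 (st i).2, G (F i (st i).1 (st i).2) (st i).2) := fun i => rfl
  have hsum : ∀ i, ∑ j ∈ Finset.range i, F j (st j).1 (st j).2 = (st i).1 := by
    intro i
    induction i with
    | zero => rfl
    | succ i ih => rw [Finset.sum_range_succ, ih, hst]
  refine ⟨fun i => F i (st i).1 (st i).2, fun i => (st i).2, ?_, rfl, ?_, ?_, ?_⟩
  · refine strictMono_nat_of_lt_succ fun i => ?_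
    rw [hst]
    exact hG1 _ _
  · intro i k hk
    exact hF1 _ _ _ k hk
  · intro i k hk
    change k ≤ (st (i + 1)).2
    rw [hst]
    exact hG2 _ _ k hk
  · intro i
    rw [hsum]
    exact hF2 _ _ _



/-- The `L²` class of a trigonometric polynomial. -/
noncomputable def Phi : (ℤ →₀ ℂ) →ₗ[ℂ] Lp ℂ 2 hm :=
  Finsupp.linearCombination ℂ (fun k : ℤ => fourierLp (T := 2 * π) 2 k)

lemma Phi_ae (P : ℤ →₀ ℂ) : Phi P =ᵐ[hm] E P := by
  induction P using Finsupp.induction_linear with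
  | zero => simpa using Lp.coeFn_zero ℂ 2 hm
  | add f g hf hg =>
    rw [map_add, map_add]
    exact (Lp.coeFn_add _ _).trans (hf.add hg)
  | single a b =>
    have h1 : Phi (Finsupp.single a b) = b • fourierLp (T := 2 * π) 2 a := by simp [Phi]
    rw [h1]
    filter_upwards [Lp.coeFn_smul b (fourierLp (T := 2 * π) 2 a), coeFn_fourierLp (T := 2 * π) 2 a]
      with x hx1 hx2
    rw [hx1, E_single, Pi.smul_apply, hx2, smul_eq_mul]

lemma Phi_norm_sq (P : ℤ →₀ ℂ) : ‖Phi P‖ ^ 2 = ∑ k ∈ P.support, ‖P k‖ ^ 2 := by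
  have h := (orthonormal_fourier (T := 2 * π)).inner_finsupp_eq_sum_left P P
  have h2 : (inner ℂ (Phi P) (Phi P) : ℂ) = ((‖Phi P‖ ^ 2 : ℝ) : ℂ) := by
    rw [inner_self_eq_norm_sq_to_K]; norm_cast
  have h3 : ((‖Phi P‖ ^ 2 : ℝ) : ℂ) = ((∑ k ∈ P.support, ‖P k‖ ^ 2 : ℝ) : ℂ) := by
    rw [← h2]
    refine h.trans ?_
    rw [Finsupp.sum]
    push_cast
    refine Finset.sum_congr rfl fun k _ => ?_
    exact Complex.conj_mul' _
  exact_mod_cast h3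

lemma Phi_S_le (P : ℤ →₀ ℂ) (m : ℤ) : ‖Phi (S m P)‖ ^ 2 ≤ ‖Phi P‖ ^ 2 := by
  rw [Phi_norm_sq, Phi_norm_sq]
  have hs : (S m P).support ⊆ P.support := by
    intro k hk
    rw [Finsupp.mem_support_iff, S_apply] at hk
    rw [Finsupp.mem_support_iff]
    split_ifs at hk with h
    · exact hk
    · exact absurd rfl hk
  calc ∑ k ∈ (S m P).support, ‖S m P k‖ ^ 2 ≤ ∑ k ∈ P.support, ‖S m P k‖ ^ 2 :=
        Finset.sum_le_sum_of_subset_of_nonneg hs fun _ _ _ => by positivity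
    _ ≤ _ := by
        refine Finset.sum_le_sum fun k _ => ?_
        rw [S_apply]
        split_ifs
        · exact le_rfl
        · simp

lemma cheb (F : Lp ℂ 2 hm) (g : Circ → ℂ) (hg : F =ᵐ[hm] g) {δ : ℝ} (hδ : 0 < δ) :
    hm.real {x | δ ≤ ‖g x‖} ≤ ‖F‖ ^ 2 / δ ^ 2 := by
  have h1 := Lp.meas_ge_le_mul_pow_enorm F (by norm_num) (by norm_num)
    (ε := ENNReal.ofReal δ) (by simpa using hδ)
  have h2 : hm {x | δ ≤ ‖g x‖} = hm {x | ENNReal.ofReal δ ≤ (‖F x‖₊ : ENNReal)} := by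
    apply measure_congr
    filter_upwards [hg] with x hx
    apply propext
    change δ ≤ ‖g x‖ ↔ ENNReal.ofReal δ ≤ (‖F x‖₊ : ENNReal)
    rw [hx, ← enorm_eq_nnnorm, ← ofReal_norm, ENNReal.ofReal_le_ofReal_iff (norm_nonneg _)]
  rw [← h2] at h1
  refine ENNReal.toReal_le_of_le_ofReal (by positivity) (h1.trans (le_of_eq ?_))
  rw [← ENNReal.ofReal_inv_of_pos hδ]
  simp only [ENNReal.toReal_ofNat, ENNReal.rpow_ofNat]
  rw [← ENNReal.ofReal_pow (by positivity), ← ENNReal.ofReal_pow (by positivity),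
    ← ENNReal.ofReal_mul (by positivity)]
  congr 1
  field_simp

lemma L2approx (g : Circ → ℂ) (hg : Measurable g) (A : ℝ) (hA : ∀ x, ‖g x‖ ≤ A)
    (s : Set Circ) (hs : MeasurableSet s) (hgs : ∀ x ∉ s, g x = 0) (t : ℝ) (ht : 0 < t) :
    ∃ P : ℤ →₀ ℂ, (∀ δ > 0, hm.real {x | δ ≤ ‖E P x - g x‖} ≤ t / δ ^ 2) ∧
      ∀ m, ∀ δ > 0, hm.real {x | δ ≤ ‖E (S m P) x‖} ≤ (2 * A ^ 2 * hm.real s + 2 * t) / δ ^ 2 := by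
  have hA0 : 0 ≤ A := (norm_nonneg _).trans (hA 0)
  have hmem : MemLp g 2 hm := MemLp.of_bound hg.aestronglyMeasurable A (ae_of_all _ hA)
  set G : Lp ℂ 2 hm := hmem.toLp g with hG
  have hGae : G =ᵐ[hm] g := hmem.coeFn_toLp
  have hGn : ‖G‖ ^ 2 ≤ A ^ 2 * hm.real s := by
    have h1 : ‖G‖ ^ 2 = ∫ x, ‖G x‖ ^ 2 ∂hm := by
      have h := L2.inner_def (𝕜 := ℂ) G G
      rw [inner_self_eq_norm_sq_to_K] at h
      have h' : (((‖G‖ ^ 2 : ℝ)) : ℂ) = ((∫ x, ‖G x‖ ^ 2 ∂hm : ℝ) : ℂ) := by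
        rw [← integral_complex_ofReal]
        push_cast
        refine h.trans ?_
        refine integral_congr_ae (ae_of_all _ fun x => ?_)
        simp [inner_self_eq_norm_sq_to_K]
      exact_mod_cast h'
    rw [h1]
    have h2 : ∫ x, ‖G x‖ ^ 2 ∂hm ≤ ∫ x, s.indicator (fun _ => A ^ 2) x ∂hm := by
      refine integral_mono_of_nonneg (ae_of_all _ fun x => by positivity) ?_ ?_
      · exact (integrable_const _).indicator hs
      · filter_upwards [hGae] with x hx
        rw [hx]
        by_cases hxs : x ∈ s
        · rw [Set.indicator_of_mem hxs]
          exact pow_le_pow_left₀ (norm_nonneg _) (hA x) 2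
        · rw [Set.indicator_of_notMem hxs, hgs x hxs]; simp
    refine h2.trans (le_of_eq ?_)
    rw [integral_indicator hs]
    simp [mul_comm]
  obtain ⟨T, hT⟩ : ∃ T : Finset ℤ, ‖∑ i ∈ T, fourierCoeff G i • fourierLp (T := 2 * π) 2 i - G‖ ^ 2
      < t := by
    have h := hasSum_fourier_series_L2 (T := 2 * π) G
    have h2 : Tendsto (fun T : Finset ℤ => ‖∑ i ∈ T, fourierCoeff G i • fourierLp (T := 2 * π) 2 i
        - G‖ ^ 2) atTop (𝓝 (‖G - G‖ ^ 2)) := ((h.sub_const G).norm.pow 2)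
    simp only [sub_self, norm_zero] at h2
    exact (h2.eventually_lt_const (by simpa using ht)).exists
  set P : ℤ →₀ ℂ := ∑ i ∈ T, Finsupp.single i (fourierCoeff G i) with hP
  have hPP : Phi P = ∑ i ∈ T, fourierCoeff G i • fourierLp (T := 2 * π) 2 i := by
    rw [hP, map_sum]
    simp [Phi]
  rw [← hPP] at hT
  refine ⟨P, ?_, ?_⟩
  · intro δ hδ
    have h := cheb (Phi P - G) (fun x => E P x - g x)
      ((Lp.coeFn_sub _ _).trans ((Phi_ae P).sub hGae)) hδ
    exact h.trans (by gcongr)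
  · intro m δ hδ
    refine (cheb (Phi (S m P)) (E (S m P)) (Phi_ae _) hδ).trans ?_
    gcongr
    refine (Phi_S_le P m).trans ?_
    have h1 : ‖Phi P‖ ≤ ‖Phi P - G‖ + ‖G‖ := by
      simpa using norm_add_le (Phi P - G) G
    have h2 : ‖Phi P‖ ^ 2 ≤ (‖Phi P - G‖ + ‖G‖) ^ 2 := by gcongr
    nlinarith [sq_nonneg (‖Phi P - G‖ - ‖G‖)]

/-- Division into arcs. -/
lemma arcs (K : ℕ) (hK : 0 < K) : ∃ ι : Circ → ℕ, Measurable ι ∧ (∀ x, ι x < K) ∧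
    ∀ n : ℕ, K ∣ n → 0 < n → ∀ B : Set Circ, MeasurableSet B → ∀ i < K,
      hm.real {x | ι x = i ∧ n • x ∈ B} = hm.real B / K := by
  have hp : (0 : ℝ) < 2 * π := by positivity
  have hK' : (0 : ℝ) < K := by exact_mod_cast hK
  let r : Circ → ℝ := fun x => (AddCircle.equivIco (2 * π) 0 x : ℝ)
  have hr0 : ∀ x, 0 ≤ r x := fun x => (AddCircle.equivIco (2 * π) 0 x).2.1
  have hr1 : ∀ x, r x < 2 * π := fun x => by
    simpa using (AddCircle.equivIco (2 * π) 0 x).2.2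
  have hrm : Measurable r :=
    measurable_subtype_coe.comp (AddCircle.measurableEquivIco (2 * π) 0).measurable
  have hrx : ∀ x, ((r x : ℝ) : Circ) = x := fun x => AddCircle.coe_equivIco
  have hru : ∀ y : ℝ, 0 ≤ y → y < 2 * π → r (y : Circ) = y := by
    intro y h1 h2
    have := AddCircle.equivIco_coe_of_mem (p := 2 * π) (a := 0) (y := y) ⟨h1, by simpa using h2⟩
    simp [r, this]
  let ι : Circ → ℕ := fun x => ⌊r x / (2 * π) * K⌋₊
  have hι : ∀ x i, ι x = i ↔ (i : ℝ) ≤ r x / (2 * π) * K ∧ r x / (2 * π) * K < i + 1 := by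
    intro x i
    exact Nat.floor_eq_iff (by have := hr0 x; positivity)
  have hιm : Measurable ι := Nat.measurable_floor.comp ((hrm.div_const _).mul_const _)
  have hιK : ∀ x, ι x < K := by
    intro x
    have h1 := ((hι x _).1 rfl).1
    have h2 : r x / (2 * π) * K < K := by
      have : r x / (2 * π) < 1 := (div_lt_one hp).2 (hr1 x)
      nlinarith
    exact_mod_cast h1.trans_lt h2
  refine ⟨ι, hιm, hιK, ?_⟩
  intro n hn hn0 B hB
  have hshift : ∀ i < K, ∀ x, ι x = 0 ↔ ι (x + ((2 * π * i / K : ℝ) : Circ)) = i := by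
    intro i hi x
    have hi' : (i : ℝ) + 1 ≤ K := by exact_mod_cast hi
    rw [hι, hι]
    constructor
    · rintro ⟨-, h⟩
      have h2 : r x < 2 * π / K := by
        rw [lt_div_iff₀ hK']
        rw [div_mul_eq_mul_div, div_lt_iff₀ hp] at h
        simpa using h
      have h3 : r (x + ((2 * π * i / K : ℝ) : Circ)) = r x + 2 * π * i / K := by
        conv_lhs => rw [← hrx x, ← AddCircle.coe_add]
        apply hru
        · have := hr0 x; positivity
        · calc r x + 2 * π * i / K < 2 * π / K + 2 * π * i / K := by linarith
            _ = 2 * π * (i + 1) / K := by ring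
            _ ≤ 2 * π := by rw [div_le_iff₀ hK']; gcongr
      rw [h3]
      have h4 : (r x + 2 * π * i / K) / (2 * π) * K = r x / (2 * π) * K + i := by field_simp
      rw [h4]
      have := hr0 x
      constructor
      · have : 0 ≤ r x / (2 * π) * K := by positivity
        linarith
      · push_cast at h; linarith
    · rintro ⟨h, h'⟩
      set y := x + ((2 * π * i / K : ℝ) : Circ) with hy
      have hxy : x = ((r y - 2 * π * i / K : ℝ) : Circ) := by
        rw [AddCircle.coe_sub, hrx, hy]; simp
      have h5 : 2 * π * i / K ≤ r y := by
        rw [div_le_iff₀ hK']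
        rw [div_mul_eq_mul_div, le_div_iff₀ hp] at h
        linarith
      have h3 : r x = r y - 2 * π * i / K := by
        conv_lhs => rw [hxy]
        apply hru
        · linarith
        · have : 0 ≤ 2 * π * i / K := by positivity
          have := hr1 y
          linarith
      rw [h3]
      have h4 : (r y - 2 * π * i / K) / (2 * π) * K = r y / (2 * π) * K - i := by field_simp
      rw [h4]
      push_cast
      constructor <;> linarith
  have heq : ∀ i < K, hm.real {x | ι x = i ∧ n • x ∈ B} = hm.real {x | ι x = 0 ∧ n • x ∈ B} := by
    intro i hi
    have hn2 : n • ((2 * π * i / K : ℝ) : Circ) = 0 := by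
      obtain ⟨q, rfl⟩ := hn
      rw [← AddCircle.coe_nsmul, AddCircle.coe_eq_zero_iff]
      refine ⟨(q * i : ℕ), ?_⟩
      simp only [nsmul_eq_mul, zsmul_eq_mul]
      push_cast
      field_simp
    have h := measure_preimage_add_right hm ((2 * π * i / K : ℝ) : Circ) {x | ι x = i ∧ n • x ∈ B}
    rw [measureReal_def, ← h, measureReal_def]
    congr 2
    ext x
    simp only [Set.mem_preimage, Set.mem_ofPred_eq]
    rw [smul_add, hn2, add_zero, hshift i hi x]
  have hsum : hm.real B = ∑ i ∈ Finset.range K, hm.real {x | ι x = i ∧ n • x ∈ B} := by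
    have hmp : MeasurePreserving (fun x : Circ => (n : ℤ) • x) hm hm :=
      Measure.measurePreserving_zsmul hm (by exact_mod_cast hn0.ne')
    have h1 := hmp.measureReal_preimage hB.nullMeasurableSet
    rw [← h1, ← measureReal_biUnion_finset]
    · congr 1
      ext x
      simp only [Set.mem_preimage, natCast_zsmul, Set.mem_iUnion, Finset.mem_range,
        Set.mem_ofPred_eq, exists_prop]
      constructor
      · intro h
        exact ⟨ι x, hιK x, rfl, h⟩
      · rintro ⟨_, _, _, h⟩
        exact h
    · intro i _ j _ hij
      rw [Function.onFun, Set.disjoint_left]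
      rintro x ⟨h1, _⟩ ⟨h2, _⟩
      exact hij (h1.symm.trans h2)
    · intro i _
      refine (hιm (measurableSet_singleton i)).inter ?_
      have : Measurable fun x : Circ => n • x := by fun_prop
      exact this hB
  intro i hi
  rw [Finset.sum_congr rfl (fun i hi => heq i (Finset.mem_range.1 hi)), ← heq i hi] at hsum
  rw [hsum]
  simp
  field_simp



lemma approx_in_measure (F : ℕ → Circ → ℂ) (G : Circ → ℂ) (hF : ∀ n, Measurable (F n))
    (h : ∀ᵐ x ∂hm, Tendsto (fun n => F n x) atTop (𝓝 (G x))) (ε : ℝ) (hε : 0 < ε) :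
    ∃ n, hm.real {x | ε ≤ ‖F n x - G x‖} ≤ ε := by
  have h1 := tendstoInMeasure_of_tendsto_ae (fun n => (hF n).aestronglyMeasurable) h
  rw [tendstoInMeasure_iff_measureReal_norm] at h1
  obtain ⟨n, hn⟩ := ((h1 ε hε).eventually_lt_const hε).exists
  exact ⟨n, hn.le⟩

lemma re_lem (z : ℂ) (hz : ‖z‖ = 1) (h1 : z ≠ 1) : (z / (1 - z)).re = -1 / 2 := by
  have h2 : Complex.normSq z = 1 := by rw [Complex.normSq_eq_norm_sq, hz]; norm_num
  have h3 : Complex.normSq (1 - z) ≠ 0 := by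
    rw [Ne, Complex.normSq_eq_zero, sub_eq_zero]; exact fun h => h1 h.symm
  have h4 : Complex.normSq (1 - z) = 2 - 2 * z.re := by
    rw [Complex.normSq_apply] at h2 ⊢
    simp only [Complex.sub_re, Complex.one_re, Complex.sub_im, Complex.one_im]
    linarith
  rw [h4] at h3
  rw [Complex.div_re, h4]
  simp only [Complex.sub_re, Complex.one_re, Complex.sub_im, Complex.one_im]
  rw [Complex.normSq_apply] at h2
  rw [← add_div, div_eq_div_iff h3 (by norm_num)]
  linarith

/-- An analytic polynomial vanishing at the origin and close to one in measure. -/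
lemma exists_p (ε : ℝ) (hε : 0 < ε) : ∃ (L : ℕ) (a : ℕ → ℂ),
    hm.real {x | ε ≤ ‖∑ l ∈ Finset.range L, a l * fourier ((l : ℤ) + 1) x - 1‖} ≤ ε := by
  obtain ⟨lam, hlam0, hlam⟩ : ∃ lam : ℝ, 0 < lam ∧ Real.exp (-lam / 2) < ε / 3 := by
    have h : Tendsto (fun l : ℝ => Real.exp (-l / 2)) atTop (𝓝 0) := by
      refine Real.tendsto_exp_atBot.comp ?_
      exact (tendsto_neg_atTop_atBot).atBot_div_const (by norm_num)
    obtain ⟨l, h1, h2⟩ := ((h.eventually_lt_const (show 0 < ε / 3 by positivity)).and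
      (eventually_gt_atTop 0)).exists
    exact ⟨l, h2, h1⟩
  let g : ℝ → ℂ → ℂ := fun r z => Complex.exp (lam * (r * z / (1 - r * z)))
  have hz : ∀ x : Circ, ‖(fourier 1 : C(Circ, ℂ)) x‖ = 1 := fun x => norm_fourier_apply 1 x
  have hz1 : ∀ᵐ x : Circ ∂hm, (fourier 1 : C(Circ, ℂ)) x ≠ 1 := by
    have h0 : hm {(0 : Circ)} = 0 := by
      have h1 := AddCircle.volume_closedBall (T := 2 * π) (x := 0) 0
      rw [Metric.closedBall_zero, AddCircle.volume_eq_smul_haarAddCircle] at h1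
      have h2 : min (2 * π) (2 * 0) = 0 := by
        rw [mul_zero]; exact min_eq_right (by positivity)
      rw [h2, Measure.smul_apply, ENNReal.ofReal_zero, smul_eq_mul, mul_eq_zero] at h1
      rcases h1 with h1 | h1
      · rw [ENNReal.ofReal_eq_zero] at h1
        have := Real.pi_pos
        linarith
      · exact h1
    rw [ae_iff]
    refine measure_mono_null ?_ h0
    intro x hx
    simp only [ne_eq, not_not] at hx
    have hx' : (fourier 1 : C(Circ, ℂ)) x = 1 := hx
    rw [fourier_one] at hx'
    have h2 : x.toCircle = (0 : Circ).toCircle := by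
      rw [AddCircle.toCircle_zero]
      exact Subtype.ext hx'
    exact AddCircle.injective_toCircle (by positivity) h2
  let r : ℕ → ℝ := fun n => 1 - 1 / ((n : ℝ) + 2)
  have hr0 : ∀ n, 0 < r n ∧ r n < 1 := by
    intro n
    have : (0 : ℝ) ≤ n := by positivity
    refine ⟨?_, ?_⟩
    · have : 1 / ((n : ℝ) + 2) < 1 := by rw [div_lt_one (by positivity)]; linarith
      simp only [r]; linarith
    · have : 0 < 1 / ((n : ℝ) + 2) := by positivity
      simp only [r]; linarith
  have hrt : Tendsto r atTop (𝓝 1) := by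
    have : Tendsto (fun n : ℕ => 1 / ((n : ℝ) + 2)) atTop (𝓝 0) := by
      simp only [one_div]
      exact tendsto_inv_atTop_zero.comp
        (tendsto_atTop_add_const_right _ _ tendsto_natCast_atTop_atTop)
    simpa [r] using tendsto_const_nhds.sub this (a := (1 : ℝ))
  obtain ⟨n, hn⟩ := approx_in_measure (fun n x => g (r n) (fourier 1 x))
    (fun x => g 1 (fourier 1 x)) (by intro n; simp only [g]; fun_prop) (by
      filter_upwards [hz1] with x hx
      have hc : ContinuousAt (fun s : ℝ => g s (fourier 1 x)) 1 := by
        simp only [g]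
        refine ContinuousAt.cexp (continuousAt_const.mul (ContinuousAt.div ?_ ?_ ?_))
        · fun_prop
        · fun_prop
        · simp only [Complex.ofReal_one, one_mul]
          rw [Ne, sub_eq_zero]; exact fun h => hx h.symm
      exact hc.tendsto.comp hrt) (ε / 3) (by positivity)
  obtain ⟨hrn0, hrn1⟩ := hr0 n
  set ρ := r n
  have hne : ∀ z ∈ Metric.ball (0 : ℂ) (1 / ρ), 1 - (ρ : ℂ) * z ≠ 0 := by
    intro z hz h
    rw [sub_eq_zero] at h
    have h2 : ‖(ρ : ℂ) * z‖ < 1 := by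
      rw [norm_mul, Complex.norm_real, Real.norm_of_nonneg hrn0.le]
      rw [mem_ball_zero_iff, lt_div_iff₀ hrn0] at hz
      linarith
    rw [← h] at h2
    simp at h2
  have hdiff : DifferentiableOn ℂ (g ρ) (Metric.ball 0 (1 / ρ)) := by
    intro z hz
    have := hne z hz
    apply DifferentiableAt.differentiableWithinAt
    simp only [g]
    refine DifferentiableAt.cexp (DifferentiableAt.const_mul (DifferentiableAt.fun_div ?_ ?_ ?_) _)
    · fun_prop
    · fun_prop
    · exact this
  let b : ℕ → ℂ := fun k => (k.factorial : ℂ)⁻¹ * iteratedDeriv k (g ρ) 0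
  have hb : ∀ x : Circ, HasSum (fun k : ℕ => b k * fourier (k : ℤ) x) (g ρ (fourier 1 x)) := by
    intro x
    have h := Complex.hasSum_taylorSeries_on_ball hdiff (z := fourier 1 x) (by
      rw [mem_ball_zero_iff, hz x, lt_div_iff₀ hrn0]; linarith)
    refine (congrArg (fun F : ℕ → ℂ => HasSum F (g ρ (fourier 1 x))) (funext fun k => ?_)).mp h
    symm
    have h3 : (fourier (k : ℤ) : C(Circ, ℂ)) x = ((fourier 1 : C(Circ, ℂ)) x) ^ k := by
      rw [fourier_apply, fourier_apply, one_zsmul, natCast_zsmul, AddCircle.toCircle_nsmul]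
      rfl
    rw [h3]
    simp only [b, sub_zero, smul_eq_mul]
    ring
  have hb0 : b 0 = 1 := by simp [b, g]
  obtain ⟨N, hN⟩ := approx_in_measure
    (fun N x => ∑ k ∈ Finset.range (N + 1), b k * (fourier (k : ℤ) : C(Circ, ℂ)) x)
    (fun x => g ρ (fourier 1 x)) (by intro n; fun_prop)
    (ae_of_all _ fun x => (hb x).tendsto_sum_nat.comp (tendsto_add_atTop_nat 1)) (ε / 3)
    (by positivity)
  refine ⟨N, fun l => - b (l + 1), ?_⟩
  have hsub : {x : Circ | ε ≤ ‖∑ l ∈ Finset.range N, -b (l + 1) * fourier ((l : ℤ) + 1) x - 1‖} ≤ᵐ[hm]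
      ({x | ε / 3 ≤ ‖g ρ (fourier 1 x) - g 1 (fourier 1 x)‖} ∪
      {x | ε / 3 ≤ ‖∑ k ∈ Finset.range (N + 1), b k * (fourier (k : ℤ) : C(Circ, ℂ)) x -
        g ρ (fourier 1 x)‖} : Set Circ) := by
    filter_upwards [hz1] with x hx
    intro (hxx : ε ≤ ‖∑ l ∈ Finset.range N, -b (l + 1) * fourier ((l : ℤ) + 1) x - 1‖)
    change ε / 3 ≤ ‖_‖ ∨ ε / 3 ≤ ‖_‖
    by_contra! hcon
    obtain ⟨hc1, hc2⟩ := hcon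
    have h1 : ∑ l ∈ Finset.range N, -b (l + 1) * (fourier ((l : ℤ) + 1) : C(Circ, ℂ)) x - 1 =
        - ∑ k ∈ Finset.range (N + 1), b k * (fourier (k : ℤ) : C(Circ, ℂ)) x := by
      rw [Finset.sum_range_succ', hb0]
      simp [Finset.sum_neg_distrib]
      ring
    rw [h1, norm_neg] at hxx
    have h2 : ‖g 1 (fourier 1 x)‖ < ε / 3 := by
      have h3 := re_lem _ (hz x) hx
      simp only [g, Complex.norm_exp, Complex.ofReal_one, one_mul, Complex.re_ofReal_mul, h3]
      convert hlam using 2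
      ring
    have h4 := norm_add₃_le
      (a := ∑ k ∈ Finset.range (N + 1), b k * (fourier (k : ℤ) : C(Circ, ℂ)) x - g ρ (fourier 1 x))
      (b := g ρ (fourier 1 x) - g 1 (fourier 1 x)) (c := g 1 (fourier 1 x))
    simp only [sub_add_sub_cancel, sub_add_cancel] at h4
    linarith
  have h5 := (ENNReal.toReal_mono (measure_ne_top _ _) (measure_mono_ae hsub)).trans
    (measureReal_union_le _ _)
  refine h5.trans ?_
  linarith



lemma one_arc (A β : ℝ) (hβ : 0 < β) (hA : 0 ≤ A) : ∃ K : ℕ, 0 < K ∧ 1 / (K : ℝ) ≤ β ∧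
    ∃ ι : Circ → ℕ, Measurable ι ∧ (∀ x, ι x < K) ∧ (∀ i < K, hm.real {x | ι x = i} = 1 / K) ∧
    ∀ f : Circ → ℂ, Measurable f → (∀ x, ‖f x‖ ≤ A) → ∀ i < K, ∀ M : ℤ,
    ∃ P : ℤ →₀ ℂ, (∀ k, P k ≠ 0 → M < k) ∧
      hm.real {x | (if ι x = i then β else 0) + β / K <
        ‖E P x - (if ι x = i then f x else 0)‖} ≤ 2 * β / K ∧
      ∀ m, hm.real {x | ι x ≠ i ∧ β < ‖E (S m P) x‖} ≤ β := by
  obtain ⟨L, a, ha⟩ := exists_p (β / (A + 1)) (by positivity)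
  set p : Circ → ℂ := fun x => ∑ l ∈ Finset.range L, a l * fourier ((l : ℤ) + 1) x with hp
  set C : ℝ := 1 + ∑ l ∈ Finset.range L, ‖a l‖ with hC
  have hC1 : 1 ≤ C := by
    have : 0 ≤ ∑ l ∈ Finset.range L, ‖a l‖ := Finset.sum_nonneg fun _ _ => norm_nonneg _
    linarith
  have hC0 : 0 < C := by linarith
  -- choice of K
  obtain ⟨K, hK⟩ := exists_nat_gt (max (1 / β) (2 * A ^ 2 / (β / 4 * (β / (2 * C)) ^ 2)))
  have hK1 : 1 / β < K := (le_max_left _ _).trans_lt hK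
  have hK2 : 2 * A ^ 2 / (β / 4 * (β / (2 * C)) ^ 2) < K := (le_max_right _ _).trans_lt hK
  have hK0 : (0 : ℝ) < K := lt_trans (by positivity) hK1
  have hK0' : 0 < K := by exact_mod_cast hK0
  have hKβ : 1 / (K : ℝ) ≤ β := by
    rw [div_lt_iff₀ hβ] at hK1
    rw [div_le_iff₀ hK0]; linarith
  have hKA : 2 * A ^ 2 * (1 / K) ≤ β / 4 * (β / (2 * C)) ^ 2 := by
    rw [div_lt_iff₀ (by positivity)] at hK2
    rw [mul_one_div, div_le_iff₀ hK0]
    linarith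
  obtain ⟨ι, hιm, hιK, hιB⟩ := arcs K hK0'
  have hι1 : ∀ i < K, hm.real {x | ι x = i} = 1 / K := by
    intro i hi
    have := hιB K dvd_rfl hK0' Set.univ MeasurableSet.univ i hi
    simpa using this
  refine ⟨K, hK0', hKβ, ι, hιm, hιK, hι1, ?_⟩
  intro f hf hfA i hi M
  set g : Circ → ℂ := fun x => if ι x = i then f x else 0 with hg
  have hsm : MeasurableSet {x | ι x = i} := hιm (measurableSet_singleton i)
  have hgm : Measurable g := Measurable.ite hsm hf measurable_const
  have hgA : ∀ x, ‖g x‖ ≤ A := by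
    intro x
    simp only [hg]
    split_ifs
    · exact hfA x
    · simpa using hA
  set t : ℝ := min (β / 8 * (β / (2 * C)) ^ 2) (β / K * (β / K / C) ^ 2) with ht
  have ht0 : 0 < t := lt_min (by positivity) (by positivity)
  have ht1 : t ≤ β / 8 * (β / (2 * C)) ^ 2 := min_le_left _ _
  have ht2 : t ≤ β / K * (β / K / C) ^ 2 := min_le_right _ _
  obtain ⟨φ, hφ1, hφ2⟩ := L2approx g hgm A hgA {x | ι x = i} hsm
    (fun x hx => by simp only [hg]; exact if_neg hx) t ht0
  rw [hι1 i hi] at hφ2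
  obtain ⟨d, hd⟩ : ∃ d : ℕ, ∀ k, φ k ≠ 0 → |k| ≤ d := by
    refine ⟨∑ k ∈ φ.support, k.natAbs, fun k hk => ?_⟩
    have h1 : k.natAbs ≤ ∑ k ∈ φ.support, k.natAbs :=
      Finset.single_le_sum (f := fun k : ℤ => k.natAbs) (fun _ _ => Nat.zero_le _)
          (Finsupp.mem_support_iff.2 hk)
    rw [Int.abs_eq_natAbs]
    exact_mod_cast h1
  set n : ℕ := K * (2 * d + 2 + M.natAbs) with hn
  have hn0 : 0 < n := by positivity
  have hn1 : 2 * d + 2 + M.natAbs ≤ n := Nat.le_mul_of_pos_left _ hK0'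
  let B : ℕ → ℤ →₀ ℂ := fun l => a l • sh (n * ((l : ℤ) + 1)) φ
  have hBk : ∀ l k, B l k ≠ 0 → |k - n * ((l : ℤ) + 1)| ≤ d := by
    intro l k hk
    apply hd
    intro h
    apply hk
    simp [B, sh_apply, h]
  let Ms : ℕ → ℤ := fun l => n * ((l : ℤ) + 1) - d - 1
  have hMs : Monotone Ms := by
    refine monotone_nat_of_le_succ fun l => ?_
    simp only [Ms]
    push_cast
    nlinarith
  have hB1 : ∀ l k, B l k ≠ 0 → Ms l < k := by
    intro l k hk
    have := (abs_le.1 (hBk l k hk)).1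
    simp only [Ms]
    linarith
  have hB2 : ∀ l k, B l k ≠ 0 → k ≤ Ms (l + 1) := by
    intro l k hk
    have := (abs_le.1 (hBk l k hk)).2
    simp only [Ms]
    have h2 : (n : ℤ) * (((l + 1 : ℕ) : ℤ) + 1) = n * ((l : ℤ) + 1) + n := by push_cast; ring
    rw [h2]
    omega
  set P : ℤ →₀ ℂ := ∑ l ∈ Finset.range L, B l with hP
  have hEB : ∀ l x, E (B l) x = a l * fourier (n * ((l : ℤ) + 1)) x * E φ x := by
    intro l x
    simp only [B, map_smul, Pi.smul_apply, smul_eq_mul, E_sh]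
    ring
  have hEsum : ∀ j x, E (∑ l ∈ Finset.range j, B l) x =
      (∑ l ∈ Finset.range j, a l * fourier (n * ((l : ℤ) + 1)) x) * E φ x := by
    intro j x
    rw [map_sum, Finset.sum_apply, Finset.sum_mul]
    exact Finset.sum_congr rfl fun l _ => hEB l x
  have hq : ∀ j ≤ L, ∀ x : Circ, ‖∑ l ∈ Finset.range j, a l * fourier (n * ((l : ℤ) + 1)) x‖ ≤ C := by
    intro j hj x
    calc _ ≤ ∑ l ∈ Finset.range j, ‖a l * fourier (n * ((l : ℤ) + 1)) x‖ := norm_sum_le _ _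
      _ = ∑ l ∈ Finset.range j, ‖a l‖ := by
          refine Finset.sum_congr rfl fun l _ => ?_
          rw [norm_mul, norm_fourier_apply, mul_one]
      _ ≤ ∑ l ∈ Finset.range L, ‖a l‖ :=
          Finset.sum_le_sum_of_subset_of_nonneg (Finset.range_mono hj) fun _ _ _ => norm_nonneg _
      _ ≤ C := by linarith
  have hpn : ∀ x : Circ, ∑ l ∈ Finset.range L, a l * fourier (n * ((l : ℤ) + 1)) x = p (n • x) := by
    intro x
    refine Finset.sum_congr rfl fun l _ => ?_
    congr 1
    have h1 : ((n : ℤ) * ((l : ℤ) + 1)) • x = ((l : ℤ) + 1) • (n • x) := by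
      rw [← natCast_zsmul x n, smul_smul, mul_comm (n : ℤ)]
    rw [fourier_apply, fourier_apply, h1]
  refine ⟨P, ?_, ?_, ?_⟩
  · intro k hk
    have : ∃ l ∈ Finset.range L, B l k ≠ 0 := by
      apply Finset.exists_ne_zero_of_sum_ne_zero
      rwa [hP, Finsupp.finsetSum_apply] at hk
    obtain ⟨l, _, hl⟩ := this
    have h1 := (hMs (Nat.zero_le l)).trans_lt (hB1 l k hl)
    simp only [Ms] at h1
    push_cast at h1
    omega
  · have hBm : MeasurableSet {y : Circ | β / (A + 1) ≤ ‖p y - 1‖} := by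
      apply measurableSet_le measurable_const
      have : Continuous p := by simp only [hp]; fun_prop
      fun_prop
    have h1 := hιB n (Dvd.intro _ rfl) hn0 _ hBm i hi
    have h2 : hm.real {x | ι x = i ∧ n • x ∈ {y : Circ | β / (A + 1) ≤ ‖p y - 1‖}} ≤ β / K := by
      rw [h1]
      gcongr
      refine ha.trans ?_
      rw [div_le_iff₀ (by positivity)]
      nlinarith
    have h3 : hm.real {x | β / K / C ≤ ‖E φ x - g x‖} ≤ β / K := by
      refine (hφ1 _ (by positivity)).trans ?_
      rw [div_le_iff₀ (by positivity)]
      exact ht2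
    have hsub : {x | (if ι x = i then β else 0) + β / K <
        ‖E P x - (if ι x = i then f x else 0)‖} ⊆
        {x | ι x = i ∧ n • x ∈ {y : Circ | β / (A + 1) ≤ ‖p y - 1‖}} ∪
        {x | β / K / C ≤ ‖E φ x - g x‖} := by
      intro x (hx : (if ι x = i then β else 0) + β / K < ‖E P x - g x‖)
      change (ι x = i ∧ β / (A + 1) ≤ ‖p (n • x) - 1‖) ∨ β / K / C ≤ ‖E φ x - g x‖
      by_contra! hcon
      obtain ⟨hc1, hc2⟩ := hcon
      have h4 : E P x - g x = g x * (p (n • x) - 1) + p (n • x) * (E φ x - g x) := by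
        rw [hP, hEsum, hpn]; ring
      have h5 : ‖p (n • x)‖ ≤ C := by rw [← hpn]; exact hq L le_rfl x
      have h6 : ‖p (n • x) * (E φ x - g x)‖ ≤ β / K := by
        rw [norm_mul]
        rw [lt_div_iff₀ hC0] at hc2
        calc _ ≤ C * ‖E φ x - g x‖ := by gcongr
          _ ≤ _ := by linarith
      have h7 : ‖g x * (p (n • x) - 1)‖ ≤ if ι x = i then β else 0 := by
        rw [norm_mul]
        split_ifs with hxi
        · have h8 := hc1 hxi
          calc ‖g x‖ * ‖p (n • x) - 1‖ ≤ A * (β / (A + 1)) := by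
                gcongr
                exact hgA x
            _ ≤ β := by
                rw [← mul_div_assoc, div_le_iff₀ (by positivity)]
                nlinarith
        · simp [hg, hxi]
      have h9 := norm_add_le (g x * (p (n • x) - 1)) (p (n • x) * (E φ x - g x))
      rw [h4] at hx
      linarith
    refine (measureReal_mono hsub).trans ((measureReal_union_le _ _).trans ?_)
    have : 2 * β / K = β / K + β / K := by ring
    linarith
  · intro m
    obtain ⟨m', hm'⟩ : ∃ m', ∀ x, ‖E (S m P) x‖ ≤ C * ‖E φ x‖ + C * ‖E (S m' φ) x‖ := by
      rcases S_blocks B Ms hMs hB1 hB2 L m with ⟨j, hj, -, -, h⟩ | ⟨-, h⟩ | ⟨-, h⟩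
      · refine ⟨m - n * ((j : ℤ) + 1), fun x => ?_⟩
        have h1 : E (S m (B j)) x = a j * fourier (n * ((j : ℤ) + 1)) x *
            E (S (m - n * ((j : ℤ) + 1)) φ) x := by
          simp only [B, map_smul, Pi.smul_apply, smul_eq_mul, S_sh, E_sh]
          ring
        rw [hP, h, map_add, Pi.add_apply, hEsum, h1]
        refine (norm_add_le _ _).trans ?_
        have h2 : ‖a j‖ ≤ C := by
          have := Finset.single_le_sum (f := fun l => ‖a l‖) (fun _ _ => norm_nonneg _)
            (Finset.mem_range.2 hj)
          linarith
        rw [norm_mul, norm_mul, norm_mul, norm_fourier_apply, mul_one]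
        gcongr
        exact hq j hj.le x
      · refine ⟨0, fun x => ?_⟩
        rw [hP, h]
        simp only [map_zero, Pi.zero_apply, norm_zero]
        positivity
      · refine ⟨0, fun x => ?_⟩
        rw [hP, h, hEsum, norm_mul]
        have : 0 ≤ C * ‖E (S 0 φ) x‖ := by positivity
        have h2 := hq L le_rfl x
        have : ‖∑ l ∈ Finset.range L, a l * (fourier (n * ((l : ℤ) + 1)) : C(Circ, ℂ)) x‖ * ‖E φ x‖ ≤
          C * ‖E φ x‖ := by gcongr
        linarith
    have h1 : hm.real {x | β / (2 * C) ≤ ‖E φ x - g x‖} ≤ β / 2 := by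
      refine (hφ1 _ (by positivity)).trans ?_
      rw [div_le_iff₀ (by positivity)]
      have : 0 < (β / (2 * C)) ^ 2 := by positivity
      nlinarith
    have h2 : hm.real {x | β / (2 * C) ≤ ‖E (S m' φ) x‖} ≤ β / 2 := by
      refine (hφ2 m' _ (by positivity)).trans ?_
      rw [div_le_iff₀ (by positivity)]
      linarith
    have hsub : {x | ι x ≠ i ∧ β < ‖E (S m P) x‖} ⊆ {x | β / (2 * C) ≤ ‖E φ x - g x‖} ∪
        {x | β / (2 * C) ≤ ‖E (S m' φ) x‖} := by
      rintro x ⟨hx1, hx2⟩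
      change β / (2 * C) ≤ ‖E φ x - g x‖ ∨ β / (2 * C) ≤ ‖E (S m' φ) x‖
      by_contra! hcon
      obtain ⟨hc1, hc2⟩ := hcon
      have hgx : g x = 0 := by simp only [hg]; exact if_neg hx1
      rw [hgx, sub_zero, lt_div_iff₀ (by positivity)] at hc1
      rw [lt_div_iff₀ (by positivity)] at hc2
      have := hm' x
      linarith
    refine (measureReal_mono hsub).trans ((measureReal_union_le _ _).trans ?_)
    linarith



lemma main_bdd (f : Circ → ℂ) (hf : Measurable f) (A : ℝ) (hA : 0 ≤ A) (hfA : ∀ x, ‖f x‖ ≤ A)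
    (η : ℝ) (hη : 0 < η) (M₀ : ℤ) :
    ∃ P : ℤ →₀ ℂ, (∀ k, P k ≠ 0 → M₀ < k) ∧ hm.real {x | η < ‖E P x - f x‖} ≤ η ∧
      ∀ m, hm.real {x | ‖f x‖ + η < ‖E (S m P) x‖} ≤ η := by
  obtain ⟨K, hK, hKβ, ι, hιm, hιK, hι1, hmain⟩ := one_arc A (η / 4) (by positivity) hA
  set β := η / 4 with hβ
  have hβ0 : 0 < β := by positivity
  have hK0 : (0 : ℝ) < K := by exact_mod_cast hK
  obtain ⟨B, M, hM, hM0, hB1, hB2, hBQ⟩ := exists_blocks (fun i _ P => i < K →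
      (hm.real {x | (if ι x = i then β else 0) + β / K <
        ‖E P x - (if ι x = i then f x else 0)‖} ≤ 2 * β / K ∧
      ∀ m, hm.real {x | ι x ≠ i ∧ β < ‖E (S m P) x‖} ≤ β)) (by
    intro i R M
    by_cases hi : i < K
    · obtain ⟨P, h1, h2, h3⟩ := hmain f hf hfA i hi M
      exact ⟨P, h1, fun _ => ⟨h2, h3⟩⟩
    · exact ⟨0, by simp, fun h => absurd h hi⟩) M₀
  set bad : ℕ → Set Circ := fun i => {x | (if ι x = i then β else 0) + β / K <
        ‖E (B i) x - (if ι x = i then f x else 0)‖} with hbad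
  set Bad : Set Circ := ⋃ i ∈ Finset.range K, bad i with hBad
  have hBadm : hm.real Bad ≤ 2 * β := by
    calc hm.real Bad ≤ ∑ i ∈ Finset.range K, hm.real (bad i) := measureReal_biUnion_finset_le _ _
      _ ≤ ∑ i ∈ Finset.range K, 2 * β / K :=
          Finset.sum_le_sum fun i hi => (hBQ i (Finset.mem_range.1 hi)).1
      _ = 2 * β := by
          rw [Finset.sum_const, Finset.card_range, nsmul_eq_mul]
          field_simp
  have hgood : ∀ x ∉ Bad, ∀ j ≤ K,
      ‖E (∑ i ∈ Finset.range j, B i) x - (if ι x < j then f x else 0)‖ ≤ 2 * β := by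
    intro x hx j hj
    have h1 : (if ι x < j then f x else 0) =
        ∑ i ∈ Finset.range j, (if ι x = i then f x else 0) := by
      rw [Finset.sum_ite_eq]
      simp
    rw [h1, map_sum, Finset.sum_apply, ← Finset.sum_sub_distrib]
    calc _ ≤ ∑ i ∈ Finset.range j, ‖E (B i) x - (if ι x = i then f x else 0)‖ := norm_sum_le _ _
      _ ≤ ∑ i ∈ Finset.range j, ((if ι x = i then β else 0) + β / K) := by
          refine Finset.sum_le_sum fun i hi => ?_
          by_contra! hcon
          apply hx
          have hiK : i ∈ Finset.range K :=
            Finset.mem_range.2 ((Finset.mem_range.1 hi).trans_le hj)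
          exact Set.mem_biUnion (t := bad) hiK hcon
      _ ≤ β + β := by
          rw [Finset.sum_add_distrib]
          gcongr
          · rw [Finset.sum_ite_eq]
            split_ifs <;> linarith
          · rw [Finset.sum_const, Finset.card_range, nsmul_eq_mul, ← mul_div_assoc,
              div_le_iff₀ hK0]
            have : (j : ℝ) ≤ K := by exact_mod_cast hj
            nlinarith
      _ = 2 * β := by ring
  have hfj : ∀ x j, ‖(if ι x < j then f x else 0)‖ ≤ ‖f x‖ := by
    intro x j
    split_ifs
    · exact le_rfl
    · simp
  refine ⟨∑ i ∈ Finset.range K, B i, ?_, ?_, ?_⟩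
  · intro k hk
    rw [Finsupp.finsetSum_apply] at hk
    obtain ⟨i, _, hi⟩ := Finset.exists_ne_zero_of_sum_ne_zero hk
    rw [← hM0]
    exact (hM.monotone (Nat.zero_le i)).trans_lt (hB1 i k hi)
  · have hsub : {x | η < ‖E (∑ i ∈ Finset.range K, B i) x - f x‖} ⊆ Bad := by
      intro x (hx : η < ‖_‖)
      by_contra hxb
      have := hgood x hxb K le_rfl
      rw [if_pos (hιK x)] at this
      linarith
    refine (measureReal_mono hsub (measure_ne_top _ _)).trans ?_
    linarith
  · intro m
    rcases S_blocks B M hM.monotone hB1 hB2 K m with ⟨j, hj, -, -, h⟩ | ⟨-, h⟩ | ⟨-, h⟩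
    · have hsub : {x | ‖f x‖ + η < ‖E (S m (∑ i ∈ Finset.range K, B i)) x‖} ⊆
          Bad ∪ ({x | ι x = j} ∪ {x | ι x ≠ j ∧ β < ‖E (S m (B j)) x‖}) := by
        intro x (hx : ‖f x‖ + η < ‖_‖)
        by_contra hxb
        rw [Set.mem_union, Set.mem_union, not_or, not_or] at hxb
        obtain ⟨hx1, hx2, hx3⟩ := hxb
        have h1 := hgood x hx1 j hj.le
        have h2 : ‖E (S m (B j)) x‖ ≤ β := by
          by_contra! hcon
          exact hx3 ⟨hx2, hcon⟩
        rw [h, map_add, Pi.add_apply] at hx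
        have h3 := norm_add_le (E (∑ i ∈ Finset.range j, B i) x) (E (S m (B j)) x)
        have h4 := norm_le_norm_add_norm_sub' (E (∑ i ∈ Finset.range j, B i) x)
          (if ι x < j then f x else 0)
        have h5 := hfj x j
        linarith
      refine (measureReal_mono hsub (measure_ne_top _ _)).trans ((measureReal_union_le _ _).trans ?_)
      have h6 := measureReal_union_le (μ := hm) {x | ι x = j}
        {x | ι x ≠ j ∧ β < ‖E (S m (B j)) x‖}
      have h7 := hι1 j hj
      have h8 := (hBQ j hj).2 m
      linarith
    · rw [h]
      have : {x | ‖f x‖ + η < ‖E (0 : ℤ →₀ ℂ) x‖} = ∅ := by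
        ext x
        simp only [map_zero, Pi.zero_apply, norm_zero, Set.mem_empty_iff_false, iff_false]
        intro (hx : ‖f x‖ + η < 0)
        have := norm_nonneg (f x)
        linarith
      rw [this]
      simpa using hη.le
    · rw [h]
      have hsub : {x | ‖f x‖ + η < ‖E (∑ i ∈ Finset.range K, B i) x‖} ⊆ Bad := by
        intro x (hx : ‖f x‖ + η < ‖_‖)
        by_contra hxb
        have h1 := hgood x hxb K le_rfl
        have h4 := norm_le_norm_add_norm_sub' (E (∑ i ∈ Finset.range K, B i) x)
          (if ι x < K then f x else 0)
        have h5 := hfj x K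
        linarith
      refine (measureReal_mono hsub (measure_ne_top _ _)).trans ?_
      linarith

lemma main_lemma (f : Circ → ℂ) (hf : Measurable f) (η : ℝ) (hη : 0 < η) (M₀ : ℤ) :
    ∃ P : ℤ →₀ ℂ, (∀ k, P k ≠ 0 → M₀ < k) ∧ hm.real {x | η < ‖E P x - f x‖} ≤ η ∧
      ∀ m, hm.real {x | ‖f x‖ + η < ‖E (S m P) x‖} ≤ η := by
  have hFm : ∀ n : ℕ, Measurable fun x => if ‖f x‖ ≤ n then f x else 0 := fun n =>
    Measurable.ite (measurableSet_le hf.norm measurable_const) hf measurable_const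
  obtain ⟨n, hn⟩ := approx_in_measure (fun (n : ℕ) x => if ‖f x‖ ≤ n then f x else 0) f hFm
    (ae_of_all _ fun x => by
      obtain ⟨N, hN⟩ := exists_nat_ge ‖f x‖
      refine tendsto_const_nhds.congr' ?_
      filter_upwards [eventually_ge_atTop N] with n hn
      have : (N : ℝ) ≤ n := by exact_mod_cast hn
      rw [if_pos (hN.trans this)]) (η / 2) (by positivity)
  obtain ⟨P, h1, h2, h3⟩ := main_bdd _ (hFm n) n (by positivity) (fun x => by
    split_ifs with h
    · exact h
    · simp) (η / 2) (by positivity) M₀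
  refine ⟨P, h1, ?_, fun m => ?_⟩
  · have hsub : {x | η < ‖E P x - f x‖} ⊆
        {x | η / 2 < ‖E P x - (if ‖f x‖ ≤ n then f x else 0)‖} ∪
        {x | η / 2 ≤ ‖(if ‖f x‖ ≤ n then f x else 0) - f x‖} := by
      intro x (hx : η < ‖_‖)
      change η / 2 < ‖_‖ ∨ η / 2 ≤ ‖_‖
      by_contra! hcon
      have := norm_sub_le_norm_sub_add_norm_sub (E P x) (if ‖f x‖ ≤ n then f x else 0) (f x)
      linarith [hcon.1, hcon.2]
    refine (measureReal_mono hsub (measure_ne_top _ _)).trans ((measureReal_union_le _ _).trans ?_)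
    linarith
  · refine (measureReal_mono ?_).trans ((h3 m).trans (by linarith))
    intro x (hx : ‖f x‖ + η < _)
    change ‖(if ‖f x‖ ≤ n then f x else 0)‖ + η / 2 < _
    have : ‖(if ‖f x‖ ≤ n then f x else 0)‖ ≤ ‖f x‖ := by
      split_ifs
      · exact le_rfl
      · simp
    linarith

theorem main (f : Circ → ℂ) (hf : Measurable f) :
    ∃ c : ℕ → ℂ, TendstoInMeasure hm (fun N => analyticPartialSum c N) atTop f := by
  obtain ⟨B, M, hM, hM0, hB1, hB2, hBQ⟩ := exists_blocks (fun i R P =>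
      hm.real {x | (1 / 2 : ℝ) ^ i < ‖E P x - (f x - E R x)‖} ≤ (1 / 2 : ℝ) ^ i ∧
      ∀ m, hm.real {x | ‖f x - E R x‖ + (1 / 2 : ℝ) ^ i < ‖E (S m P) x‖} ≤ (1 / 2 : ℝ) ^ i) (by
    intro i R M
    exact main_lemma (fun x => f x - E R x) (hf.sub (continuous_E R).measurable) _ (by positivity) M) 0
  have hMi : ∀ i : ℕ, (i : ℤ) ≤ M i := by
    intro i
    induction i with
    | zero => simp [hM0]
    | succ i ih =>
      have := hM (Nat.lt_succ_self i)
      push_cast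
      simp only [Nat.succ_eq_add_one] at this
      omega
  let c : ℕ → ℂ := fun k => ∑ i ∈ Finset.range (k + 1), B i (k : ℤ)
  have hc : ∀ N x, analyticPartialSum c N x =
      E (S N (∑ i ∈ Finset.range (N + 1), B i)) x := by
    intro N x
    have h1 : S N (∑ i ∈ Finset.range (N + 1), B i) =
        ∑ k ∈ Finset.Icc 1 N, Finsupp.single (k : ℤ) (c k) := by
      ext z
      rw [S_apply, Finsupp.finsetSum_apply, Finsupp.finsetSum_apply]
      simp only [Finsupp.single_apply]
      rcases le_or_gt z 0 with hz | hz
      · have hz0 : ∀ i, B i z = 0 := by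
          intro i
          by_contra h
          have h1 := hB1 i z h
          have h2 := hMi i
          omega
        rw [Finset.sum_eq_zero (fun i _ => hz0 i), ite_self]
        symm
        refine Finset.sum_eq_zero fun k hk => if_neg ?_
        rw [Finset.mem_Icc] at hk
        omega
      · obtain ⟨j, rfl⟩ := Int.eq_ofNat_of_zero_le hz.le
        have hj : 1 ≤ j := by omega
        simp only [Nat.cast_inj, Nat.cast_le]
        rw [Finset.sum_ite_eq']
        simp only [Finset.mem_Icc, hj, true_and]
        split_ifs with hjN
        · symm
          refine Finset.sum_subset (Finset.range_mono (by omega)) fun i _ hi => ?_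
          by_contra h
          have h1 := hB1 i j h
          have h2 := hMi i
          rw [Finset.mem_range] at hi
          omega
        · rfl
    rw [h1, map_sum, Finset.sum_apply, analyticPartialSum]
    exact Finset.sum_congr rfl fun k _ => (E_single _ _ _).symm
  refine ⟨c, ?_⟩
  rw [tendstoInMeasure_iff_measureReal_norm]
  intro ε hε
  rw [Metric.tendsto_atTop]
  intro δ hδ
  obtain ⟨J, hJ⟩ := exists_pow_lt_of_lt_one (show 0 < min ε δ / 3 by positivity)
    (show (1 / 2 : ℝ) < 1 by norm_num)
  have hJε : 3 * (1 / 2 : ℝ) ^ J < ε := by linarith [min_le_left ε δ]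
  have hJδ : 3 * (1 / 2 : ℝ) ^ J < δ := by linarith [min_le_right ε δ]
  refine ⟨(M (J + 1)).toNat + 1, fun N hN => ?_⟩
  rw [Real.dist_eq, sub_zero, abs_of_nonneg measureReal_nonneg]
  have hNJ : M (J + 1) < N := by omega
  rcases S_blocks B M hM.monotone hB1 hB2 (N + 1) N with ⟨j, hj, hj1, hj2, h⟩ | ⟨h, -⟩ | ⟨h, -⟩
  · have hjJ : J + 1 ≤ j := by
      by_contra! hcon
      have := hM.monotone (show j + 1 ≤ J + 1 by omega)
      omega
    obtain ⟨i, rfl⟩ : ∃ i, j = i + 1 := ⟨j - 1, by omega⟩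
    have hpow : (1 / 2 : ℝ) ^ i ≤ (1 / 2 : ℝ) ^ J :=
      pow_le_pow_of_le_one (by norm_num) (by norm_num) (by omega)
    have hpow' : (1 / 2 : ℝ) ^ (i + 1) ≤ (1 / 2 : ℝ) ^ J :=
      pow_le_pow_of_le_one (by norm_num) (by norm_num) (by omega)
    have hpos : 0 < (1 / 2 : ℝ) ^ J := by positivity
    have hsub : {x | ε ≤ ‖analyticPartialSum c N x - f x‖} ⊆
        {x | (1 / 2 : ℝ) ^ i < ‖E (B i) x - (f x - E (∑ l ∈ Finset.range i, B l) x)‖} ∪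
        {x | ‖f x - E (∑ l ∈ Finset.range (i + 1), B l) x‖ + (1 / 2 : ℝ) ^ (i + 1) <
          ‖E (S N (B (i + 1))) x‖} := by
      intro x (hx : ε ≤ ‖_‖)
      change (1 / 2 : ℝ) ^ i < ‖E (B i) x - (f x - E (∑ l ∈ Finset.range i, B l) x)‖ ∨ ‖f x - E (∑ l ∈ Finset.range (i + 1), B l) x‖ + (1 / 2 : ℝ) ^ (i + 1) < ‖E (S N (B (i + 1))) x‖
      by_contra! hcon
      obtain ⟨hc1, hc2⟩ := hcon
      have h1 : E (B i) x - (f x - E (∑ l ∈ Finset.range i, B l) x) =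
          E (∑ l ∈ Finset.range (i + 1), B l) x - f x := by
        rw [Finset.sum_range_succ, map_add, Pi.add_apply]; ring
      rw [h1] at hc1
      rw [norm_sub_rev] at hc2
      rw [hc, h, map_add, Pi.add_apply, add_sub_right_comm] at hx
      have h3 := norm_add_le (E (∑ l ∈ Finset.range (i + 1), B l) x - f x) (E (S N (B (i + 1))) x)
      linarith
    refine lt_of_le_of_lt (measureReal_mono hsub) (lt_of_le_of_lt (measureReal_union_le _ _) ?_)
    have h1 := (hBQ i).1
    have h2 := (hBQ (i + 1)).2 N
    linarith
  · have := hM.monotone (Nat.zero_le (J + 1))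
    omega
  · have := hMi (N + 1)
    push_cast at this
    omega

end Menshov


/-- **Theorem 3**: every measurable `f : 𝕋 → ℂ` can be represented as a sum
`f(t) = ∑_{k>0} c_k e^{ikt}` of harmonics with positive spectrum converging in
measure. -/
theorem analytic_menshov_in_measure (f : AddCircle (2 * π) → ℂ) (hf : Measurable f) :
    ∃ c : ℕ → ℂ,
      TendstoInMeasure volume (fun N => analyticPartialSum c N) atTop f := by
  obtain ⟨c, hc⟩ := Menshov.main f hf
  refine ⟨c, fun ε hε => ?_⟩
  have h := ENNReal.Tendsto.const_mul (a := ENNReal.ofReal (2 * π)) (hc ε hε)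
    (Or.inr ENNReal.ofReal_ne_top)
  rw [mul_zero] at h
  rw [AddCircle.volume_eq_smul_haarAddCircle]
  exact h
end

section
/- Given any measurable function f : 𝕋 → ℂ, one can define complex coefficients (c_k)_{k>0} and compact sets K_n ⊆ 𝕋 with m(𝕋 \ K_n) → 0 as n → ∞, such that for every n the partial sums S_N(t) = ∑_{0<k≤N} c_k e^{ikt} converge to f in the norm of L²(K_n), i.e., ∫_{K_n} |S_N(t) − f(t)|² dt → 0 as N → ∞. -/
open MeasureTheory Filter Topology Real

abbrev Circ := AddCircle (2 * π)

noncomputable abbrev hμ : Measure Circ := AddCircle.haarAddCircle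

lemma aps_add (c d : ℕ → ℂ) (N : ℕ) :
    analyticPartialSum (c + d) N = analyticPartialSum c N + analyticPartialSum d N := by
  ext t
  simp [analyticPartialSum, add_mul, Finset.sum_add_distrib]

lemma aps_smul (a : ℂ) (c : ℕ → ℂ) (N : ℕ) :
    analyticPartialSum (a • c) N = a • analyticPartialSum c N := by
  ext t
  simp [analyticPartialSum, Finset.mul_sum, mul_assoc]

lemma aps_of_ge {c : ℕ → ℂ} {m N : ℕ} (hm : ∀ k, m < k → c k = 0) (hN : m ≤ N) :
    analyticPartialSum c N = analyticPartialSum c m := by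
  ext t
  unfold analyticPartialSum
  symm
  apply Finset.sum_subset (Finset.Icc_subset_Icc_right hN)
  intro k hk hk'
  rw [hm k, zero_mul]
  simp at hk hk'
  exact hk' hk.1

lemma aps_of_le {c : ℕ → ℂ} {n N : ℕ} (hn : ∀ k, k ≤ n → c k = 0) (hN : N ≤ n) :
    analyticPartialSum c N = 0 := by
  ext t
  unfold analyticPartialSum
  apply Finset.sum_eq_zero
  intro k hk
  simp at hk
  rw [hn k (by omega), zero_mul]

lemma aps_cont (c : ℕ → ℂ) (N : ℕ) : Continuous (analyticPartialSum c N) := by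
  unfold analyticPartialSum
  fun_prop

def VV (n : ℕ) : Submodule ℂ (Circ → ℂ) :=
  Submodule.span ℂ {g | ∃ k : ℕ, n < k ∧ g = fun t => fourier (k : ℤ) t}

lemma VV_rep {n : ℕ} {P : Circ → ℂ} (hP : P ∈ VV n) :
    ∃ (c : ℕ → ℂ) (m : ℕ), n ≤ m ∧ (∀ k, k ≤ n → c k = 0) ∧ (∀ k, m < k → c k = 0) ∧
      P = analyticPartialSum c m := by
  unfold VV at hP
  induction hP using Submodule.span_induction with
  | mem x hx =>
    obtain ⟨k, hk, rfl⟩ := hx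
    refine ⟨Pi.single k 1, k, hk.le, ?_, ?_, ?_⟩
    · intro j hj
      rw [Pi.single_eq_of_ne (by omega)]
    · intro j hj
      rw [Pi.single_eq_of_ne (by omega)]
    · ext t
      unfold analyticPartialSum
      rw [Finset.sum_eq_single k]
      · simp
      · intro j _ hj
        rw [Pi.single_eq_of_ne hj, zero_mul]
      · intro h
        simp at h
        omega
  | zero => exact ⟨0, n, le_rfl, by simp, by simp, by ext; simp [analyticPartialSum]⟩
  | add x y _ _ hx hy =>
    obtain ⟨c, m, h1, h2, h3, rfl⟩ := hx
    obtain ⟨c', m', h1', h2', h3', rfl⟩ := hy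
    refine ⟨c + c', max m m', by omega, ?_, ?_, ?_⟩
    · intro k hk
      simp [h2 k hk, h2' k hk]
    · intro k hk
      simp [h3 k (by omega), h3' k (by omega)]
    · rw [aps_add, aps_of_ge h3 (le_max_left _ _), aps_of_ge h3' (le_max_right _ _)]
  | smul a x _ hx =>
    obtain ⟨c, m, h1, h2, h3, rfl⟩ := hx
    refine ⟨a • c, m, h1, ?_, ?_, ?_⟩
    · intro k hk
      simp [h2 k hk]
    · intro k hk
      simp [h3 k hk]
    · rw [aps_smul]

lemma geom_sq (z : ℂ) (hz : ‖z‖ = 1) (n : ℕ) :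
    ‖∑ k ∈ Finset.range n, z ^ k‖ ^ 2
      = n + 2 * (∑ j ∈ Finset.range n, ∑ k ∈ Finset.range j, z ^ (j - k)).re := by
  induction n with
  | zero => simp
  | succ n ih =>
    rw [Finset.sum_range_succ, Finset.sum_range_succ _ n, ← Complex.normSq_eq_norm_sq,
      Complex.normSq_add, Complex.normSq_eq_norm_sq, ih, Complex.normSq_eq_norm_sq, norm_pow, hz]
    have : ((∑ k ∈ Finset.range n, z ^ k) * (starRingEnd ℂ) (z ^ n)).re
        = (∑ k ∈ Finset.range n, z ^ (n - k)).re := by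
      rw [Finset.sum_mul, Complex.re_sum, Complex.re_sum]
      apply Finset.sum_congr rfl
      intro k hk
      rw [← Complex.conj_re]
      congr 1
      have hk : k < n := by simpa using hk
      rw [map_mul, Complex.conj_conj]
      have h1 : (starRingEnd ℂ) (z ^ k) * z ^ k = 1 := by
        rw [mul_comm, Complex.mul_conj, Complex.normSq_eq_norm_sq, norm_pow, hz]; simp
      calc _ = (starRingEnd ℂ) (z ^ k) * z ^ k * z ^ (n - k) := by
            rw [mul_assoc, ← pow_add]; congr 2; omega
        _ = _ := by rw [h1, one_mul]
    rw [this, Complex.add_re]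
    push_cast
    ring

lemma geom_bound (z : ℂ) (hz : ‖z‖ = 1) (n : ℕ) (h : 8 ≤ n * ‖1 - z‖ ^ 2) :
    (∑ j ∈ Finset.range n, ∑ k ∈ Finset.range j, z ^ (j - k)).re ≤ - (n / 4) := by
  have h1 := geom_sq z hz n
  have h2 : ‖∑ k ∈ Finset.range n, z ^ k‖ * ‖1 - z‖ ≤ 2 := by
    rw [← norm_mul, geom_sum_mul_neg]
    calc _ ≤ ‖(1:ℂ)‖ + ‖z ^ n‖ := norm_sub_le _ _
      _ = 2 := by rw [norm_pow, hz]; norm_num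
  have h3 : ‖∑ k ∈ Finset.range n, z ^ k‖ ^ 2 * ‖1 - z‖ ^ 2 ≤ 4 := by
    rw [← mul_pow]
    calc _ ≤ (2:ℝ) ^ 2 := by gcongr
      _ = 4 := by norm_num
  have h4 : ‖∑ k ∈ Finset.range n, z ^ k‖ ^ 2 ≤ n / 2 := by
    by_contra hc
    push Not at hc
    have hp : 0 < ‖1 - z‖ ^ 2 := by
      by_contra hh
      have : ‖1 - z‖ ^ 2 = 0 := le_antisymm (not_lt.mp hh) (by positivity)
      rw [this] at h
      norm_num at h
    nlinarith
  linarith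

lemma hmu_le_volume_zero {s : Set Circ} (h : volume s = 0) : hμ s = 0 := by
  rw [AddCircle.volume_eq_smul_haarAddCircle, Measure.smul_apply, smul_eq_mul, mul_eq_zero] at h
  rcases h with h | h
  · rw [ENNReal.ofReal_eq_zero] at h
    linarith [Real.pi_pos]
  · exact h

lemma hmu_zero : hμ ({0} : Set Circ) = 0 := by
  apply hmu_le_volume_zero
  rw [← Metric.closedBall_zero, AddCircle.volume_closedBall]
  rw [ENNReal.ofReal_eq_zero]
  simp

lemma exists_F (η : ℝ) (hη : 0 < η) : ∃ F : Polynomial ℂ, F.eval 0 = 1 ∧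
    hμ {t | η < ‖F.eval (fourier 1 t)‖} ≤ ENNReal.ofReal η := by
  have hlim : Tendsto (fun n : ℕ => hμ {t : Circ | (n : ℝ) * ‖1 - (fourier 1 t : ℂ)‖ ^ 2 < 8}) atTop
      (𝓝 (hμ (⋂ n : ℕ, {t : Circ | (n : ℝ) * ‖1 - (fourier 1 t : ℂ)‖ ^ 2 < 8}))) := by
    apply tendsto_measure_iInter_atTop
    · intro n
      apply MeasurableSet.nullMeasurableSet
      apply measurableSet_lt
      · apply Continuous.measurable
        fun_prop
      · fun_prop
    · intro a b hab t ht
      simp only [Set.mem_ofPred_eq] at ht ⊢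
      refine lt_of_le_of_lt ?_ ht
      gcongr
    · exact ⟨0, measure_ne_top _ _⟩
  have hzero : hμ (⋂ n : ℕ, {t : Circ | (n : ℝ) * ‖1 - (fourier 1 t : ℂ)‖ ^ 2 < 8}) = 0 := by
    have hsub : (⋂ n : ℕ, {t : Circ | (n : ℝ) * ‖1 - (fourier 1 t : ℂ)‖ ^ 2 < 8}) ⊆ {0} := by
      intro t ht
      simp only [Set.mem_iInter, Set.mem_ofPred_eq] at ht
      by_contra h0
      have hne : (fourier 1 t : ℂ) ≠ 1 := by
        rw [fourier_one]
        intro h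
        apply h0
        have : t.toCircle = (0 : Circ).toCircle := by
          ext; rw [h]; simp
        exact AddCircle.injective_toCircle (by positivity) this
      have hp : 0 < ‖1 - (fourier 1 t : ℂ)‖ ^ 2 := by
        have : 0 < ‖1 - (fourier 1 t : ℂ)‖ := norm_pos_iff.mpr (sub_ne_zero.mpr hne.symm)
        positivity
      obtain ⟨n, hn⟩ := exists_nat_gt (8 / ‖1 - (fourier 1 t : ℂ)‖ ^ 2)
      rw [div_lt_iff₀ hp] at hn
      linarith [ht n]
    exact measure_mono_null hsub hmu_zero
  rw [hzero] at hlim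
  have hev := hlim.eventually (gt_mem_nhds (ENNReal.ofReal_pos.mpr hη))
  obtain ⟨n, hn, hn1⟩ := (hev.and (eventually_ge_atTop 1)).exists
  let D : Polynomial ℂ := ∑ j ∈ Finset.range n, ∑ k ∈ Finset.range j, Polynomial.X ^ (j - k)
  let s : ℝ := 1 / (4 * n ^ 4)
  have hn1' : (1:ℝ) ≤ n := by exact_mod_cast hn1
  have hs0 : 0 < s := by positivity
  have hs1 : s * n ^ 4 = 1 / 4 := by
    simp only [s]; field_simp
  have hs2 : s < 1 := by
    have : (1:ℝ) ≤ (n:ℝ) ^ 4 := one_le_pow₀ hn1'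
    nlinarith
  let ρ : ℝ := Real.sqrt (1 - s / 4)
  have hρ : ρ < 1 := by
    rw [Real.sqrt_lt' one_pos]; linarith
  obtain ⟨k, hk⟩ := exists_pow_lt_of_lt_one hη hρ
  refine ⟨(1 + Polynomial.C (s : ℂ) * D) ^ k, ?_, ?_⟩
  · have : D.eval 0 = 0 := by
      simp only [D, Polynomial.eval_finsetSum, Polynomial.eval_pow, Polynomial.eval_X]
      apply Finset.sum_eq_zero
      intro j _
      apply Finset.sum_eq_zero
      intro k hk
      simp at hk
      exact zero_pow (by omega)
    simp [this]
  · refine le_trans (measure_mono ?_) hn.le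
    intro t ht
    simp only [Set.mem_ofPred_eq] at ht ⊢
    by_contra hc
    push Not at hc
    set z : ℂ := fourier 1 t with hzdef
    have hz : ‖z‖ = 1 := by rw [hzdef, fourier_one]; exact Circle.norm_coe _
    have hre := geom_bound z hz n hc
    have hDe : D.eval z = ∑ j ∈ Finset.range n, ∑ k ∈ Finset.range j, z ^ (j - k) := by
      simp [D, Polynomial.eval_finsetSum]
    rw [← hDe] at hre
    have hDn : ‖D.eval z‖ ≤ n ^ 2 := by
      rw [hDe]
      calc _ ≤ ∑ j ∈ Finset.range n, (n:ℝ) := by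
            apply norm_sum_le_of_le
            intro j hj
            calc _ ≤ ∑ k ∈ Finset.range j, (1:ℝ) := by
                  apply norm_sum_le_of_le
                  intro k _
                  rw [norm_pow, hz, one_pow]
              _ ≤ n := by
                  simp at hj ⊢
                  exact hj.le
        _ = n ^ 2 := by simp; ring
    have hsq : ‖1 + (s:ℂ) * D.eval z‖ ^ 2 ≤ 1 - s / 4 := by
      have hN : ‖D.eval z‖ ^ 2 ≤ n ^ 4 := by
        calc _ ≤ ((n:ℝ) ^ 2) ^ 2 := by gcongr
          _ = n ^ 4 := by ring
      rw [← Complex.normSq_eq_norm_sq] at hN ⊢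
      rw [Complex.normSq_apply] at hN ⊢
      simp only [Complex.add_re, Complex.one_re, Complex.mul_re, Complex.ofReal_re,
        Complex.ofReal_im, zero_mul, sub_zero, Complex.add_im, Complex.one_im, Complex.mul_im,
        add_zero, zero_add]
      generalize (D.eval z).re = x at *
      generalize (D.eval z).im = y at *
      have h1 : s * (s * (x * x + y * y)) ≤ s * (1 / 4) := by
        rw [← hs1]; gcongr
      have h2 : s * x ≤ s * (-(1/4)) := by
        apply mul_le_mul_of_nonneg_left _ hs0.le
        linarith
      nlinarith
    have hle : ‖1 + (s:ℂ) * D.eval z‖ ≤ ρ := Real.le_sqrt_of_sq_le hsq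
    have : ‖((1 + Polynomial.C (s : ℂ) * D) ^ k).eval z‖ ≤ ρ ^ k := by
      simp only [Polynomial.eval_pow, Polynomial.eval_add, Polynomial.eval_one,
        Polynomial.eval_mul, Polynomial.eval_C, norm_pow]
      gcongr
    linarith

lemma eLpNorm_trig {ι : Type*} (s : Finset ι) (a : ι → ℂ) (e : ι → ℤ) :
    eLpNorm (fun t : Circ => ∑ k ∈ s, a k * fourier (e k) t) 2 hμ
      = ‖∑ k ∈ s, a k • (fourierLp 2 (e k) : Lp ℂ 2 hμ)‖ₑ := by
  have : (∑ k ∈ s, a k • (fourierLp 2 (e k) : Lp ℂ 2 hμ))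
      = ContinuousMap.toLp (E := ℂ) 2 hμ ℂ (∑ k ∈ s, a k • fourier (e k)) := by
    simp [map_sum]
  rw [this, Lp.enorm_def, eLpNorm_congr_ae (ContinuousMap.coeFn_toLp hμ _)]
  congr 1
  ext t
  simp

lemma aps_mono (c : ℕ → ℂ) {l m : ℕ} (h : l ≤ m) :
    eLpNorm (analyticPartialSum c l) 2 hμ ≤ eLpNorm (analyticPartialSum c m) 2 hμ := by
  have horth : Orthonormal ℂ (fun k : ℕ => (fourierLp 2 (k : ℤ) : Lp ℂ 2 hμ)) :=
    orthonormal_fourier.comp (fun k : ℕ => (k : ℤ)) Nat.cast_injective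
  have hn : ∀ N : ℕ, ‖∑ k ∈ Finset.Icc 1 N, c k • (fourierLp 2 (k : ℤ) : Lp ℂ 2 hμ)‖ ^ 2
      = ∑ k ∈ Finset.Icc 1 N, ‖c k‖ ^ 2 := by
    intro N
    have h1 := horth.inner_sum c c (Finset.Icc 1 N)
    rw [inner_self_eq_norm_sq_to_K] at h1
    have h2 : ∑ i ∈ Finset.Icc 1 N, (starRingEnd ℂ) (c i) * c i
        = ((∑ k ∈ Finset.Icc 1 N, ‖c k‖ ^ 2 : ℝ) : ℂ) := by
      push_cast
      apply Finset.sum_congr rfl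
      intro k _
      rw [mul_comm, Complex.mul_conj, Complex.normSq_eq_norm_sq]
      push_cast
      rfl
    rw [h2] at h1
    apply Complex.ofReal_injective
    rw [Complex.ofReal_pow]
    exact h1
  unfold analyticPartialSum
  rw [eLpNorm_trig, eLpNorm_trig, enorm_le_iff_norm_le]
  apply le_of_sq_le_sq _ (norm_nonneg _)
  rw [hn, hn]
  apply Finset.sum_le_sum_of_subset_of_nonneg (Finset.Icc_subset_Icc_right h)
  intros
  positivity

lemma trig_approx (G : Circ → ℂ) (hG : MemLp G 2 hμ) (ε : ℝ) (hε : 0 < ε) :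
    ∃ (s : Finset ℤ) (a : ℤ → ℂ),
      eLpNorm (fun t => ∑ k ∈ s, a k * fourier k t - G t) 2 hμ ≤ ENNReal.ofReal ε := by
  have h := hasSum_fourier_series_L2 (hG.toLp G)
  have h2 := (Metric.tendsto_nhds.mp h ε hε)
  obtain ⟨s, hs⟩ := h2.exists
  refine ⟨s, fourierCoeff (hG.toLp G), ?_⟩
  set a := fourierCoeff (hG.toLp G)
  have : (∑ k ∈ s, a k • (fourierLp 2 k : Lp ℂ 2 hμ))
      = ContinuousMap.toLp (E := ℂ) 2 hμ ℂ (∑ k ∈ s, a k • fourier k) := by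
    simp [map_sum]
  rw [this, dist_eq_norm] at hs
  have h3 : eLpNorm (fun t => ∑ k ∈ s, a k * fourier k t - G t) 2 hμ
      = ‖ContinuousMap.toLp (E := ℂ) 2 hμ ℂ (∑ k ∈ s, a k • fourier k) - hG.toLp G‖ₑ := by
    rw [Lp.enorm_def]
    apply eLpNorm_congr_ae
    filter_upwards [Lp.coeFn_sub (ContinuousMap.toLp (E := ℂ) 2 hμ ℂ (∑ k ∈ s, a k • fourier k))
      (hG.toLp G), hG.coeFn_toLp, ContinuousMap.coeFn_toLp (𝕜 := ℂ) (p := 2) hμ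
        (∑ k ∈ s, a k • fourier k)] with t h1 h2 h3
    rw [h1, Pi.sub_apply, h2, h3]
    simp
  rw [h3, ← ofReal_norm]
  exact ENNReal.ofReal_le_ofReal hs.le

lemma exists_shift (A B : Set Circ) (hA : MeasurableSet A) (hB : MeasurableSet B) (N : ℕ) :
    ∃ θ : Circ, hμ (A ∩ {t | N • t + θ ∈ B}) ≤ hμ A * hμ B := by
  have hmeas : MeasurableSet {p : Circ × Circ | p.2 ∈ A ∧ N • p.2 + p.1 ∈ B} := by
    apply MeasurableSet.inter
    · exact measurable_snd hA
    · have : Continuous (fun p : Circ × Circ => N • p.2 + p.1) := by fun_prop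
      exact this.measurable hB
  have hm2 : Measurable (fun p : Circ × Circ =>
      ({p : Circ × Circ | p.2 ∈ A ∧ N • p.2 + p.1 ∈ B}).indicator (1 : Circ × Circ → ENNReal) p) :=
    measurable_one.indicator hmeas
  have hf : ∀ θ : Circ, hμ (A ∩ {t | N • t + θ ∈ B}) = ∫⁻ t,
      ({p : Circ × Circ | p.2 ∈ A ∧ N • p.2 + p.1 ∈ B}).indicator (1 : Circ × Circ → ENNReal) (θ, t)
        ∂hμ := by
    intro θ
    have hms : MeasurableSet (A ∩ {t | N • t + θ ∈ B}) :=
      hmeas.preimage (measurable_prodMk_left (x := θ))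
    rw [← lintegral_indicator_one hms]
    rfl
  have hint : ∫⁻ θ, hμ (A ∩ {t | N • t + θ ∈ B}) ∂hμ = hμ A * hμ B := by
    simp_rw [hf]
    rw [lintegral_lintegral_swap hm2.aemeasurable]
    have : ∀ t, ∫⁻ θ, ({p : Circ × Circ | p.2 ∈ A ∧ N • p.2 + p.1 ∈ B}).indicator
        (1 : Circ × Circ → ENNReal) (θ, t) ∂hμ = A.indicator (fun _ => hμ B) t := by
      intro t
      by_cases ht : t ∈ A
      · rw [Set.indicator_of_mem ht]
        rw [← measure_preimage_add hμ (N • t) B, ← lintegral_indicator_one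
          (hB.preimage (measurable_const_add _))]
        apply lintegral_congr
        intro θ
        by_cases hh : N • t + θ ∈ B
        · rw [Set.indicator_of_mem, Set.indicator_of_mem]
          · rfl
          · exact hh
          · exact ⟨ht, hh⟩
        · rw [Set.indicator_of_notMem, Set.indicator_of_notMem]
          · exact hh
          · exact fun h => hh h.2
      · rw [Set.indicator_of_notMem ht]
        apply lintegral_eq_zero_of_ae_eq_zero
        filter_upwards with θ
        exact Set.indicator_of_notMem (fun h => ht h.1) _
    simp_rw [this]
    rw [lintegral_indicator hA, setLIntegral_const, mul_comm]
  rw [← hint]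
  apply exists_le_lintegral
  simp_rw [hf]
  exact hm2.lintegral_prod_right'.aemeasurable

lemma mem_VV (h : Polynomial ℂ) (h0 : h.eval 0 = 0) (s : Finset ℤ) (a : ℤ → ℂ) (n N : ℕ)
    (w : ℂ) (hN : ∀ k ∈ s, n < k + N) :
    (fun t : Circ => (∑ k ∈ s, a k * fourier k t) * h.eval (fourier (N : ℤ) t * w)) ∈ VV n := by
  have hpow : ∀ (j : ℕ) (t : Circ), (fourier (N : ℤ) t : ℂ) ^ j = fourier ((N * j : ℕ) : ℤ) t := by
    intro j t
    induction j with
    | zero => simp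
    | succ j ih =>
      rw [pow_succ, ih, ← fourier_add]
      congr 2
  have : (fun t : Circ => (∑ k ∈ s, a k * fourier k t) * h.eval (fourier (N : ℤ) t * w))
      = ∑ k ∈ s, ∑ j ∈ h.support, (a k * h.coeff j * w ^ j) •
        (fun t : Circ => (fourier (k + (N * j : ℕ)) t : ℂ)) := by
    ext t
    simp only [Finset.sum_apply, Pi.smul_apply, smul_eq_mul]
    rw [Polynomial.eval_eq_sum, Polynomial.sum, Finset.sum_mul]
    apply Finset.sum_congr rfl
    intro k _
    rw [Finset.mul_sum]
    apply Finset.sum_congr rfl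
    intro j _
    rw [mul_pow, hpow, fourier_add]
    ring
  rw [this]
  apply Submodule.sum_mem
  intro k hk
  apply Submodule.sum_mem
  intro j hj
  apply Submodule.smul_mem
  apply Submodule.subset_span
  have hj0 : j ≠ 0 := by
    rintro rfl
    rw [Polynomial.mem_support_iff, Polynomial.coeff_zero_eq_eval_zero] at hj
    exact hj h0
  have h1 : (N : ℤ) ≤ (N * j : ℕ) := by
    exact_mod_cast Nat.le_mul_of_pos_right N (Nat.pos_of_ne_zero hj0)
  have h2 := hN k hk
  refine ⟨(k + (N * j : ℕ)).toNat, by omega, ?_⟩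
  have : (((k + (N * j : ℕ)).toNat : ℕ) : ℤ) = k + (N * j : ℕ) := by omega
  rw [this]

lemma piece (F : Polynomial ℂ) (hF0 : F.eval 0 = 1) (M : ℝ) (hM0 : 0 < M)
    (hM : ∀ z : ℂ, ‖z‖ = 1 → ‖1 - F.eval z‖ ≤ M) (η : ℝ)
    (hB : hμ {t | η < ‖F.eval (fourier 1 t)‖} ≤ ENNReal.ofReal η)
    (G : Circ → ℂ) (hG : MemLp G 2 hμ) (hGm : Measurable G) (A : Set Circ) (hA : MeasurableSet A)
    (hGA : ∀ t, t ∉ A → G t = 0) (ε : ℝ) (hε : 0 < ε) (n : ℕ) :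
    ∃ P ∈ VV n, ∃ X : Set Circ, MeasurableSet X ∧
      hμ X ≤ ENNReal.ofReal η * hμ A + ENNReal.ofReal ε ∧
      (∀ t, t ∉ X → ‖P t - G t‖ ≤ η * ‖G t‖ + ε) ∧
      eLpNorm P 2 hμ ≤ ENNReal.ofReal M * eLpNorm G 2 hμ + ENNReal.ofReal ε := by
  set r : ℝ := ε / M with hr
  have hr0 : 0 < r := by positivity
  set δ : ℝ := r * min 1 ε with hδ
  have hδ0 : 0 < δ := by positivity
  obtain ⟨s, a, hsa⟩ := trig_approx G hG δ hδ0
  obtain ⟨N, hN⟩ : ∃ N : ℕ, ∀ k ∈ s, (n : ℤ) < k + N := by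
    refine ⟨n + 1 + ∑ k ∈ s, k.natAbs, ?_⟩
    intro k hk
    have := Finset.single_le_sum (f := fun k : ℤ => k.natAbs) (fun _ _ => Nat.zero_le _) hk
    omega
  set B : Set Circ := {t | η < ‖F.eval (fourier 1 t)‖} with hBdef
  have hFc : Continuous (fun t : Circ => F.eval (fourier 1 t : ℂ)) :=
    F.continuous.comp (fourier 1).continuous
  have hBm : MeasurableSet B := measurableSet_lt measurable_const hFc.norm.measurable
  obtain ⟨θ, hθ⟩ := exists_shift A B hA hBm N
  set φ : Circ → ℂ := fun t => ∑ k ∈ s, a k * fourier k t with hφ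
  have hφc : Continuous φ := by fun_prop
  have hz : ∀ t : Circ, (fourier (N : ℤ) t * fourier 1 θ : ℂ) = fourier 1 (N • t + θ) := by
    intro t
    simp only [fourier_apply, one_zsmul, natCast_zsmul, AddCircle.toCircle_add, Circle.coe_mul]
  have hzn : ∀ t : Circ, ‖(fourier 1 t : ℂ)‖ = 1 := by
    intro t
    rw [fourier_one]
    exact Circle.norm_coe _
  refine ⟨fun t => φ t * (1 - F).eval (fourier (N : ℤ) t * fourier 1 θ),
    mem_VV (1 - F) (by simp [hF0]) s a n N (fourier 1 θ) hN,
    (A ∩ {t | N • t + θ ∈ B}) ∪ {t | ENNReal.ofReal r ≤ ‖φ t - G t‖ₑ}, ?_, ?_, ?_, ?_⟩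
  · apply MeasurableSet.union
    · apply hA.inter
      have : Continuous (fun t : Circ => N • t + θ) := by fun_prop
      exact this.measurable hBm
    · exact measurableSet_le measurable_const (hφc.measurable.sub hGm).enorm
  · refine (measure_union_le _ _).trans (add_le_add ?_ ?_)
    · refine hθ.trans ?_
      rw [mul_comm]
      gcongr
    · have h1 := mul_meas_ge_le_pow_eLpNorm' hμ (p := 2) (by norm_num) (by norm_num)
        (hφc.measurable.sub hGm).aestronglyMeasurable (ENNReal.ofReal r)
      have h2 : ENNReal.ofReal r ^ (2:ENNReal).toReal
          * hμ {t | ENNReal.ofReal r ≤ ‖φ t - G t‖ₑ}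
          ≤ ENNReal.ofReal r ^ (2:ENNReal).toReal * ENNReal.ofReal ε := by
        refine h1.trans ?_
        calc _ ≤ ENNReal.ofReal δ ^ (2:ENNReal).toReal := by
              gcongr
              exact hsa
          _ ≤ _ := by
              simp only [ENNReal.toReal_ofNat, ENNReal.rpow_ofNat]
              rw [← ENNReal.ofReal_pow hδ0.le, ← ENNReal.ofReal_pow hr0.le,
                ← ENNReal.ofReal_mul (by positivity)]
              apply ENNReal.ofReal_le_ofReal
              rw [hδ, mul_pow]
              gcongr
              have h1 : min 1 ε ≤ 1 := min_le_left _ _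
              have h2 : min 1 ε ≤ ε := min_le_right _ _
              have h3 : 0 < min 1 ε := by positivity
              nlinarith
      refine (ENNReal.mul_le_mul_iff_right ?_ ?_).mp h2
      · simp [hr0]
      · simp
  · intro t ht
    simp only [Set.mem_union, Set.mem_inter_iff, Set.mem_ofPred_eq, not_or, not_and, not_le] at ht
    obtain ⟨ht1, ht2⟩ := ht
    have hd : ‖φ t - G t‖ ≤ r := by
      rw [← ofReal_norm] at ht2
      exact (ENNReal.ofReal_lt_ofReal_iff hr0).mp ht2 |>.le
    have hMt := hM _ (hzn (N • t + θ))
    simp only [hz]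
    set E := F.eval (fourier 1 (N • t + θ) : ℂ) with hE
    have heq : φ t * (1 - F).eval (fourier 1 (N • t + θ) : ℂ) - G t
        = (φ t - G t) * (1 - E) - E * G t := by
      simp only [Polynomial.eval_sub, Polynomial.eval_one]
      rw [← hE]
      ring
    rw [heq]
    have h1 : ‖E * G t‖ ≤ η * ‖G t‖ := by
      by_cases htA : t ∈ A
      · have := ht1 htA
        simp only [hBdef, Set.mem_ofPred_eq, not_lt] at this
        rw [norm_mul]
        gcongr
      · simp [hGA t htA]
    have h2 : ‖(φ t - G t) * (1 - E)‖ ≤ ε := by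
      rw [norm_mul]
      calc _ ≤ r * M := by gcongr
        _ = ε := by rw [hr]; field_simp
    linarith [norm_sub_le ((φ t - G t) * (1 - E)) (E * G t)]
  · have h1 : eLpNorm (fun t => φ t * (1 - F).eval (fourier (N : ℤ) t * fourier 1 θ : ℂ)) 2 hμ
        ≤ ENNReal.ofReal M * eLpNorm φ 2 hμ := by
      apply eLpNorm_le_mul_eLpNorm_of_ae_le_mul
      filter_upwards with t
      rw [norm_mul, mul_comm, hz]
      gcongr
      have := hM _ (hzn (N • t + θ))
      simpa using this
    have h2 : eLpNorm φ 2 hμ ≤ eLpNorm G 2 hμ + ENNReal.ofReal δ := by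
      have : φ = G + (fun t => φ t - G t) := by ext t; simp
      calc eLpNorm φ 2 hμ = eLpNorm (G + (fun t => φ t - G t)) 2 hμ := by rw [← this]
        _ ≤ eLpNorm G 2 hμ + eLpNorm (fun t => φ t - G t) 2 hμ :=
            eLpNorm_add_le hGm.aestronglyMeasurable
              (hφc.measurable.sub hGm).aestronglyMeasurable (by norm_num)
        _ ≤ _ := by gcongr
    refine h1.trans ?_
    calc _ ≤ ENNReal.ofReal M * (eLpNorm G 2 hμ + ENNReal.ofReal δ) := by gcongr
      _ = ENNReal.ofReal M * eLpNorm G 2 hμ + ENNReal.ofReal (M * δ) := by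
          rw [mul_add, ENNReal.ofReal_mul hM0.le]
      _ ≤ _ := by
          gcongr
          calc M * δ ≤ M * (r * 1) := by
                rw [hδ]; gcongr; exact min_le_left _ _
            _ = ε := by rw [hr]; field_simp

lemma eLpNorm_aps_le {c : ℕ → ℂ} {m : ℕ} (hm : ∀ k, m < k → c k = 0) (l : ℕ) :
    eLpNorm (analyticPartialSum c l) 2 hμ ≤ eLpNorm (analyticPartialSum c m) 2 hμ := by
  rcases le_total l m with h | h
  · exact aps_mono c h
  · rw [aps_of_ge hm h]

def ballU (t : Finset Circ) (ρ : ℝ) : Set Circ := ⋃ x ∈ t, Metric.closedBall x ρ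

lemma ballU_meas (t : Finset Circ) (ρ : ℝ) : MeasurableSet (ballU t ρ) :=
  t.measurableSet_biUnion fun _ _ => Metric.isClosed_closedBall.measurableSet

open Classical in
lemma blocks (F : Polynomial ℂ) (hF0 : F.eval 0 = 1) (M : ℝ) (hM0 : 0 < M)
    (hM : ∀ z : ℂ, ‖z‖ = 1 → ‖1 - F.eval z‖ ≤ M) (η : ℝ) (hη : 0 < η)
    (hB : hμ {t | η < ‖F.eval (fourier 1 t)‖} ≤ ENNReal.ofReal η)
    (g : Circ → ℂ) (hgm : Measurable g) (hg : MemLp g 2 hμ) (ρ ε κ : ℝ) (hε : 0 < ε)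
    (hball : ∀ (x : Circ) (A : Set Circ), MeasurableSet A → A ⊆ Metric.closedBall x ρ →
      ENNReal.ofReal M * eLpNorm (A.indicator g) 2 hμ + ENNReal.ofReal ε ≤ ENNReal.ofReal κ)
    (n : ℕ) (t : Finset Circ) :
    ∃ (c : ℕ → ℂ) (m : ℕ) (X : Set Circ), n ≤ m ∧ (∀ k, k ≤ n → c k = 0) ∧
      (∀ k, m < k → c k = 0) ∧ MeasurableSet X ∧
      hμ X ≤ ENNReal.ofReal η * hμ (ballU t ρ) + t.card * ENNReal.ofReal ε ∧
      (∀ x, x ∉ X → ‖analyticPartialSum c m x - (ballU t ρ).indicator g x‖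
        ≤ η * ‖(ballU t ρ).indicator g x‖ + t.card * ε) ∧
      ∀ l, ∃ u r : Circ → ℂ, Continuous u ∧ Continuous r ∧ analyticPartialSum c l = u + r ∧
        (∀ x, x ∉ X → ‖u x‖ ≤ (1 + η) * ‖g x‖ + t.card * ε) ∧
        eLpNorm r 2 hμ ≤ ENNReal.ofReal κ := by
  induction t using Finset.induction_on with
  | empty =>
    refine ⟨0, n, ∅, le_rfl, by simp, by simp, MeasurableSet.empty, by simp, ?_, ?_⟩
    · intro x _
      simp [ballU, analyticPartialSum]
    · intro l
      refine ⟨0, 0, continuous_const, continuous_const, ?_, ?_, ?_⟩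
      · ext x
        simp [analyticPartialSum]
      · intro x _
        simp only [Pi.zero_apply, norm_zero]
        positivity
      · simp
  | insert y t hy ih =>
    obtain ⟨c, m, X, hnm, hc1, hc2, hXm, hX, happ, hpart⟩ := ih
    set U := ballU t ρ with hU
    set A := Metric.closedBall y ρ \ U with hA
    have hUm : MeasurableSet U := ballU_meas t ρ
    have hAm : MeasurableSet A := Metric.isClosed_closedBall.measurableSet.diff hUm
    have hins : ballU (insert y t) ρ = U ∪ A := by
      rw [hA, Set.union_sdiff_self]
      simp only [ballU, hU, Finset.set_biUnion_insert]
      rw [Set.union_comm]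
    have hdisj : Disjoint U A := Set.disjoint_sdiff_right
    have hind : ∀ x, (U ∪ A).indicator g x = U.indicator g x + A.indicator g x := by
      intro x
      rw [Set.indicator_union_of_disjoint hdisj]
    have hindn : ∀ x, ‖(U ∪ A).indicator g x‖ = ‖U.indicator g x‖ + ‖A.indicator g x‖ := by
      intro x
      by_cases hx : x ∈ U
      · have hx' : x ∉ A := fun h => h.2 hx
        rw [hind, Set.indicator_of_notMem hx']; simp
      · rw [hind, Set.indicator_of_notMem hx]; simp
    obtain ⟨P, hP, X', hX'm, hX', happ', hnorm⟩ := piece F hF0 M hM0 hM η hB (A.indicator g)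
      (hg.indicator hAm) (hgm.indicator hAm) A hAm (fun x hx => Set.indicator_of_notMem hx _)
      ε hε m
    obtain ⟨c', m', hmm, hc1', hc2', rfl⟩ := VV_rep hP
    have hκ := hnorm.trans (hball y A hAm Set.sdiff_subset)
    have hcard : ((insert y t).card : ℝ) = t.card + 1 := by
      rw [Finset.card_insert_of_notMem hy]; push_cast; ring
    refine ⟨c + c', m', X ∪ X', by omega, ?_, ?_, hXm.union hX'm, ?_, ?_, ?_⟩
    · intro k hk
      simp [hc1 k hk, hc1' k (by omega)]
    · intro k hk
      simp [hc2 k (by omega), hc2' k hk]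
    · rw [hins, measure_union hdisj hAm, Finset.card_insert_of_notMem hy]
      refine (measure_union_le _ _).trans ((add_le_add hX hX').trans (le_of_eq ?_))
      push_cast
      ring
    · intro x hx
      simp only [Set.mem_union, not_or] at hx
      rw [hins, hindn, hind, hcard, aps_add, aps_of_ge hc2 hmm, Pi.add_apply]
      have h1 := happ x hx.1
      have h2 := happ' x hx.2
      have h3 := norm_add_le (analyticPartialSum c m x - U.indicator g x)
        (analyticPartialSum c' m' x - A.indicator g x)
      rw [show analyticPartialSum c m x + analyticPartialSum c' m' x
        - (U.indicator g x + A.indicator g x) = (analyticPartialSum c m x - U.indicator g x) +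
        (analyticPartialSum c' m' x - A.indicator g x) by ring]
      linarith
    · intro l
      rcases le_or_gt l m with hl | hl
      · obtain ⟨u, r, hu, hr, hsum, hub, hrb⟩ := hpart l
        refine ⟨u, r, hu, hr, ?_, ?_, hrb⟩
        · rw [aps_add, aps_of_le hc1' hl, add_zero, hsum]
        · intro x hx
          simp only [Set.mem_union, not_or] at hx
          have := hub x hx.1
          rw [hcard]
          linarith
      · refine ⟨analyticPartialSum c m, analyticPartialSum c' l, aps_cont _ _, aps_cont _ _, ?_, ?_,
          (eLpNorm_aps_le hc2' l).trans hκ⟩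
        · rw [aps_add, aps_of_ge hc2 hl.le]
        · intro x hx
          simp only [Set.mem_union, not_or] at hx
          have h1 := happ x hx.1
          have h2 := norm_sub_norm_le (analyticPartialSum c m x) (U.indicator g x)
          have h3 : ‖U.indicator g x‖ ≤ ‖g x‖ := norm_indicator_le_norm_self _ _
          rw [hcard]
          nlinarith

lemma exists_trunc (g : Circ → ℂ) (hg : Measurable g) (η : ℝ) (hη : 0 < η) :
    ∃ D : ℝ, 1 ≤ D ∧ hμ {x | D < ‖g x‖} ≤ ENNReal.ofReal η := by
  have hlim : Tendsto (fun n : ℕ => hμ {t : Circ | (n : ℝ) < ‖g t‖}) atTop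
      (𝓝 (hμ (⋂ n : ℕ, {t : Circ | (n : ℝ) < ‖g t‖}))) := by
    apply tendsto_measure_iInter_atTop
    · intro n
      exact (measurableSet_lt measurable_const hg.norm).nullMeasurableSet
    · intro a b hab t ht
      simp only [Set.mem_ofPred_eq] at ht ⊢
      refine lt_of_le_of_lt ?_ ht
      exact_mod_cast hab
    · exact ⟨0, measure_ne_top _ _⟩
  have hempty : (⋂ n : ℕ, {t : Circ | (n : ℝ) < ‖g t‖}) = ∅ := by
    ext t
    simp only [Set.mem_iInter, Set.mem_ofPred_eq, Set.mem_empty_iff_false, iff_false, not_forall,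
      not_lt]
    exact exists_nat_ge _
  rw [hempty, measure_empty] at hlim
  have hev := hlim.eventually (gt_mem_nhds (ENNReal.ofReal_pos.mpr hη))
  obtain ⟨n, hn, hn1⟩ := (hev.and (eventually_ge_atTop 1)).exists
  exact ⟨n, by exact_mod_cast hn1, hn.le⟩

lemma hmu_le_volume (s : Set Circ) : hμ s ≤ volume s := by
  rw [AddCircle.volume_eq_smul_haarAddCircle, Measure.smul_apply, smul_eq_mul]
  have : 1 ≤ ENNReal.ofReal (2 * π) := by
    rw [ENNReal.one_le_ofReal]
    linarith [Real.pi_gt_three]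
  calc _ = 1 * hμ s := (one_mul _).symm
    _ ≤ _ := by gcongr

lemma main_step (g : Circ → ℂ) (hg : Measurable g) (η0 : ℝ) (hη0 : 0 < η0) (n : ℕ) :
    ∃ (c : ℕ → ℂ) (m : ℕ) (X : Set Circ), n ≤ m ∧ (∀ k, k ≤ n → c k = 0) ∧
      (∀ k, m < k → c k = 0) ∧ MeasurableSet X ∧ hμ X ≤ ENNReal.ofReal η0 ∧
      (∀ x, x ∉ X → ‖analyticPartialSum c m x - g x‖ ≤ η0) ∧
      ∀ l, ∃ u r : Circ → ℂ, Continuous u ∧ Continuous r ∧ analyticPartialSum c l = u + r ∧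
        (∀ x, x ∉ X → ‖u x‖ ≤ ‖g x‖ + η0) ∧
        eLpNorm r 2 hμ ≤ ENNReal.ofReal η0 := by
  obtain ⟨D, hD1, hD⟩ := exists_trunc g hg (η0 / 4) (by positivity)
  set Y := {x | D < ‖g x‖} with hY
  have hYm : MeasurableSet Y := measurableSet_lt measurable_const hg.norm
  set g' := Yᶜ.indicator g with hg'
  have hg'm : Measurable g' := hg.indicator hYm.compl
  have hg'D : ∀ x, ‖g' x‖ ≤ D := by
    intro x
    by_cases hx : x ∈ Y
    · rw [hg', Set.indicator_of_notMem (by simpa using hx)]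
      simp
      linarith
    · rw [hg', Set.indicator_of_mem hx]
      simpa [hY] using hx
  have hg'le : ∀ x, ‖g' x‖ ≤ ‖g x‖ := fun x => norm_indicator_le_norm_self _ _
  have hg'2 : MemLp g' 2 hμ :=
    MemLp.of_bound hg'm.aestronglyMeasurable D (Eventually.of_forall hg'D)
  set η : ℝ := η0 / (4 * D) with hη
  have hηpos : 0 < η := by positivity
  have hηD : η * D = η0 / 4 := by rw [hη]; field_simp
  have hηle : η ≤ η0 / 4 := by nlinarith
  obtain ⟨F, hF0, hFB⟩ := exists_F η hηpos
  obtain ⟨M, hM0, hM⟩ : ∃ M : ℝ, 0 < M ∧ ∀ z : ℂ, ‖z‖ = 1 → ‖1 - F.eval z‖ ≤ M := by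
    have hcomp : IsCompact (Metric.sphere (0:ℂ) 1) := isCompact_sphere _ _
    obtain ⟨M, hM⟩ := hcomp.exists_bound_of_continuousOn (f := fun z => 1 - F.eval z)
      (continuous_const.sub F.continuous).continuousOn
    refine ⟨max M 1, by positivity, ?_⟩
    intro z hz
    exact (hM z (by simpa using hz)).trans (le_max_left _ _)
  set τ : ℝ := η0 / (2 * M * D) with hτ
  have hτpos : 0 < τ := by positivity
  have hMDτ : M * (τ * D) = η0 / 2 := by rw [hτ]; field_simp
  set ρ : ℝ := τ ^ 2 / 2 with hρ
  have hρpos : 0 < ρ := by positivity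
  obtain ⟨t0, -, ht0f, ht0⟩ := finite_cover_balls_of_compact (isCompact_univ (X := Circ)) hρpos
  set t : Finset Circ := ht0f.toFinset with ht
  have hcover : ballU t ρ = Set.univ := by
    apply Set.eq_univ_of_univ_subset
    refine ht0.trans ?_
    intro x hx
    simp only [Set.mem_iUnion] at hx
    obtain ⟨i, hi, hx⟩ := hx
    simp only [ballU, Set.mem_iUnion]
    exact ⟨i, by simpa [ht] using hi, Metric.ball_subset_closedBall hx⟩
  set ε : ℝ := η0 / (4 * (t.card + 1)) with hε
  have hεpos : 0 < ε := by positivity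
  have hcε : t.card * ε ≤ η0 / 4 := by
    have : (t.card + 1) * ε = η0 / 4 := by rw [hε]; field_simp
    linarith
  have hε4 : ε ≤ η0 / 4 := by
    rw [hε]
    apply div_le_div_of_nonneg_left hη0.le (by norm_num)
    have : (0:ℝ) ≤ t.card := by positivity
    linarith
  obtain ⟨c, m, X, hnm, hc1, hc2, hXm, hX, happ, hpart⟩ := blocks F hF0 M hM0 hM η hηpos hFB g' hg'm
    hg'2 ρ ε η0 hεpos (by
      intro x A hA hsub
      have h1 : eLpNorm (A.indicator g') 2 hμ ≤ ENNReal.ofReal (τ * D) := by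
        rw [eLpNorm_indicator_eq_eLpNorm_restrict hA]
        refine (eLpNorm_le_of_ae_bound (Eventually.of_forall hg'D)).trans ?_
        rw [Measure.restrict_apply_univ, ENNReal.ofReal_mul hτpos.le]
        gcongr
        have h2 : hμ A ≤ ENNReal.ofReal (τ ^ 2) := by
          refine (measure_mono hsub).trans ((hmu_le_volume _).trans ?_)
          rw [AddCircle.volume_closedBall]
          apply ENNReal.ofReal_le_ofReal
          refine (min_le_right _ _).trans (le_of_eq ?_)
          rw [hρ]; ring
        calc _ ≤ ENNReal.ofReal (τ ^ 2) ^ ((2:ENNReal).toReal)⁻¹ := by gcongr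
          _ = ENNReal.ofReal τ := by
            rw [ENNReal.ofReal_rpow_of_pos (by positivity)]
            congr 1
            rw [← Real.rpow_natCast, ← Real.rpow_mul hτpos.le]
            simp
      calc _ ≤ ENNReal.ofReal M * ENNReal.ofReal (τ * D) + ENNReal.ofReal ε := by gcongr
        _ = ENNReal.ofReal (M * (τ * D) + ε) := by
            rw [ENNReal.ofReal_add (by positivity) hεpos.le, ENNReal.ofReal_mul hM0.le]
        _ ≤ _ := by
            apply ENNReal.ofReal_le_ofReal
            linarith) n t
  have hgY : ∀ x, x ∉ Y → g' x = g x := fun x hx => Set.indicator_of_mem hx _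
  have hηg : ∀ x, η * ‖g' x‖ ≤ η0 / 4 := by
    intro x
    rw [← hηD]
    have := hg'D x
    gcongr
  refine ⟨c, m, X ∪ Y, hnm, hc1, hc2, hXm.union hYm, ?_, ?_, ?_⟩
  · refine (measure_union_le _ _).trans ?_
    rw [hcover, measure_univ, mul_one] at hX
    calc _ ≤ (ENNReal.ofReal η + t.card * ENNReal.ofReal ε) + ENNReal.ofReal (η0 / 4) := by gcongr
      _ = ENNReal.ofReal (η + t.card * ε + η0 / 4) := by
          rw [ENNReal.ofReal_add (by positivity) (by positivity),
            ENNReal.ofReal_add (by positivity) (by positivity),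
            ENNReal.ofReal_mul (by positivity), ENNReal.ofReal_natCast]
      _ ≤ _ := ENNReal.ofReal_le_ofReal (by linarith)
  · intro x hx
    simp only [Set.mem_union, not_or] at hx
    have h1 := happ x hx.1
    rw [hcover, Set.indicator_univ, hgY x hx.2] at h1
    have h2 := hηg x
    rw [hgY x hx.2] at h2
    linarith
  · intro l
    obtain ⟨u, r, hu, hr, hsum, hub, hrb⟩ := hpart l
    refine ⟨u, r, hu, hr, hsum, ?_, hrb⟩
    intro x hx
    simp only [Set.mem_union, not_or] at hx
    have h1 := hub x hx.1
    have h2 := hηg x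
    have h3 := hg'le x
    linarith

lemma integral_sq_le {ν : Measure Circ} (h : Circ → ℂ) (hm : Measurable h) (C : ℝ) (hC : 0 ≤ C)
    (hle : eLpNorm h 2 ν ≤ ENNReal.ofReal C) : ∫ x, ‖h x‖ ^ 2 ∂ν ≤ C ^ 2 := by
  rw [integral_eq_lintegral_of_nonneg_ae (Eventually.of_forall fun x => by positivity)
    (hm.norm.pow_const 2).aestronglyMeasurable]
  have h1 : ∫⁻ x, ENNReal.ofReal (‖h x‖ ^ 2) ∂ν = eLpNorm h 2 ν ^ 2 := by
    have := eLpNorm_nnreal_pow_eq_lintegral (p := 2) (f := h) (μ := ν) (by norm_num)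
    simp only [NNReal.coe_ofNat, ENNReal.rpow_ofNat, ENNReal.coe_ofNat] at this
    rw [this]
    apply lintegral_congr
    intro x
    rw [ENNReal.ofReal_pow (norm_nonneg _), ofReal_norm]
  rw [h1]
  apply ENNReal.toReal_le_of_le_ofReal (by positivity)
  rw [ENNReal.ofReal_pow hC]
  gcongr

lemma exists_coeffs (f : Circ → ℂ) (hf : Measurable f) :
    ∃ (c : ℕ → ℂ) (X : ℕ → Set Circ) (m : ℕ → ℕ), (∀ j, MeasurableSet (X j)) ∧
      (∀ j, hμ (X j) ≤ ENNReal.ofReal ((1 / 2) ^ j)) ∧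
      (∀ j l, m j ≤ l → ∃ i, j ≤ i ∧ ∃ u r : Circ → ℂ, Measurable u ∧ Measurable r ∧
        (∀ x, analyticPartialSum c l x - f x = u x + r x) ∧
        (∀ x, x ∉ X i → x ∉ X (i + 1) → ‖u x‖ ≤ 3 * (1 / 2) ^ i) ∧
        eLpNorm r 2 hμ ≤ ENNReal.ofReal ((1 / 2) ^ i)) := by
  have hstep := fun (p : (ℕ → ℂ) × ℕ) (j : ℕ) =>
    main_step (fun x => f x - analyticPartialSum p.1 p.2 x)
      (hf.sub (aps_cont p.1 p.2).measurable) ((1 / 2) ^ j) (by positivity) (p.2 + 1)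
  choose C Q X hQ hC1 hC2 hXm hX happ hpart using hstep
  let st : ℕ → (ℕ → ℂ) × ℕ := fun j =>
    Nat.rec (0, 0) (fun j p => (p.1 + C p j, Q p j)) j
  have hst : ∀ j, st (j + 1) = ((st j).1 + C (st j) j, Q (st j) j) := fun j => rfl
  have hmlt : ∀ j, (st j).2 < (st (j + 1)).2 := by
    intro j
    have := hQ (st j) j
    rw [hst]
    simp only
    omega
  have hmono : StrictMono (fun j => (st j).2) := strictMono_nat_of_lt_succ hmlt
  have hid : ∀ j, j ≤ (st j).2 := hmono.id_le
  have hsupp : ∀ j k, (st j).2 < k → (st j).1 k = 0 := by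
    intro j
    induction j with
    | zero => intro k _; rfl
    | succ j ih =>
      intro k hk
      have h1 := ih k ((hmlt j).trans hk)
      rw [hst] at hk ⊢
      simp only at hk ⊢
      rw [Pi.add_apply, h1, hC2 _ _ k hk, add_zero]
  have hstab1 : ∀ j k, k ≤ (st j).2 → (st (j + 1)).1 k = (st j).1 k := by
    intro j k hk
    rw [hst]
    simp only
    rw [Pi.add_apply, hC1 _ _ k (by omega), add_zero]
  have hstab : ∀ j k i, k ≤ (st j).2 → (st (j + i)).1 k = (st j).1 k := by
    intro j k i hk
    induction i with
    | zero => rfl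
    | succ i ih =>
      rw [← add_assoc, hstab1 (j + i) k (hk.trans (hmono.monotone (by omega))), ih]
  let c : ℕ → ℂ := fun k => (st k).1 k
  have hc : ∀ j k, k ≤ (st j).2 → c k = (st j).1 k := by
    intro j k hk
    have h1 := hstab j k k hk
    have h2 := hstab k k j (hid k)
    rw [add_comm] at h2
    rw [← h1, h2]
  have hSc : ∀ j l, l ≤ (st j).2 → analyticPartialSum c l = analyticPartialSum (st j).1 l := by
    intro j l hl
    ext x
    unfold analyticPartialSum
    apply Finset.sum_congr rfl
    intro k hk
    rw [hc j k ((Finset.mem_Icc.mp hk).2.trans hl)]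
  refine ⟨c, fun j => X (st j) j, fun j => (st (j + 1)).2, fun j => hXm _ _, fun j => hX _ _, ?_⟩
  intro j l hl
  have hex : ∃ i, l < (st i).2 := ⟨l + 1, hid (l + 1)⟩
  classical
  have hfind := Nat.find_spec hex
  have hjf : j + 1 < Nat.find hex := by
    by_contra hcon
    push Not at hcon
    have := hmono.monotone hcon
    simp only at this hl
    omega
  obtain ⟨i, hi⟩ : ∃ i, Nat.find hex = i + 2 := ⟨Nat.find hex - 2, by omega⟩
  have hlow : (st (i + 1)).2 ≤ l := by
    have := Nat.find_min hex (m := i + 1) (by omega)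
    omega
  rw [hi] at hfind
  refine ⟨i, by omega, ?_⟩
  obtain ⟨u, r, hu, hr, hsum, hub, hrb⟩ := hpart (st (i + 1)) (i + 1) l
  have hSl : analyticPartialSum c l
      = analyticPartialSum (st (i + 1)).1 (st (i + 1)).2 + (u + r) := by
    rw [hSc (i + 2) l hfind.le, hst (i + 1), aps_add, aps_of_ge (hsupp (i + 1)) hlow, hsum]
  refine ⟨fun x => analyticPartialSum (st (i + 1)).1 (st (i + 1)).2 x - f x + u x, r,
    ((aps_cont _ _).measurable.sub hf).add hu.measurable, hr.measurable, ?_, ?_, ?_⟩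
  · intro x
    rw [hSl]
    simp only [Pi.add_apply]
    ring
  · intro x hx1 hx2
    have h1 := happ (st i) i x hx1
    have h2 := hub x hx2
    have h3 : analyticPartialSum (st (i + 1)).1 (st (i + 1)).2 x - f x
        = analyticPartialSum (C (st i) i) (Q (st i) i) x
          - (f x - analyticPartialSum (st i).1 (st i).2 x) := by
      rw [hst i]
      simp only
      have hle : (st i).2 ≤ Q (st i) i := (hmlt i).le
      rw [aps_add, aps_of_ge (hsupp i) hle, Pi.add_apply]
      ring
    have h4 : ‖analyticPartialSum (st (i + 1)).1 (st (i + 1)).2 x - f x‖ ≤ (1 / 2) ^ i := by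
      rw [h3]; exact h1
    rw [norm_sub_rev] at h2
    have h5 : ((1:ℝ) / 2) ^ (i + 1) ≤ (1 / 2) ^ i :=
      pow_le_pow_of_le_one (by norm_num) (by norm_num) (by omega)
    have h6 := norm_add_le (analyticPartialSum (st (i + 1)).1 (st (i + 1)).2 x - f x) (u x)
    linarith
  · refine hrb.trans (ENNReal.ofReal_le_ofReal ?_)
    exact pow_le_pow_of_le_one (by norm_num) (by norm_num) (by omega)

/-- **Theorem 4**: for every measurable `f : 𝕋 → ℂ` there are coefficients `(c_k)_{k>0}`
and compact sets `K_n ⊆ 𝕋` with `m(𝕋 \ K_n) → 0` such that the partial sums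
`S_N = ∑_{0<k≤N} c_k e^{ikt}` converge to `f` in the norm of `L²(K_n)` for every `n`. -/
theorem analytic_menshov_L2_on_compacts (f : AddCircle (2 * π) → ℂ)
    (hf : Measurable f) :
    ∃ (c : ℕ → ℂ) (K : ℕ → Set (AddCircle (2 * π))),
      (∀ n, IsCompact (K n)) ∧
      Tendsto (fun n => volume (K n)ᶜ) atTop (𝓝 0) ∧
      ∀ n, Tendsto
        (fun N => ∫ t in K n, ‖analyticPartialSum c N t - f t‖ ^ 2 ∂volume)
        atTop (𝓝 0) := by
  obtain ⟨c, X, m, hXm, hX, hpart⟩ := exists_coeffs f hf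
  have hYm : ∀ n, MeasurableSet (⋃ j, X (n + j)) := fun n => MeasurableSet.iUnion fun j => hXm _
  have hK := fun n => (hYm n).compl.exists_isCompact_sdiff_lt (μ := hμ) (measure_ne_top _ _)
    (ε := ENNReal.ofReal ((1 / 2) ^ n)) (by simp)
  choose K hKsub hKc hKm using hK
  refine ⟨c, K, hKc, ?_, ?_⟩
  · have hbound : ∀ n, volume (K n)ᶜ ≤ ENNReal.ofReal (2 * π * (3 * (1 / 2) ^ n)) := by
      intro n
      have h1 : hμ (⋃ j, X (n + j)) ≤ ENNReal.ofReal (2 * (1 / 2) ^ n) := by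
        calc _ ≤ ∑' j, hμ (X (n + j)) := measure_iUnion_le _
          _ ≤ ∑' j, ENNReal.ofReal ((1 / 2) ^ (n + j)) := ENNReal.tsum_le_tsum fun j => hX _
          _ = ENNReal.ofReal (∑' j, (1 / 2) ^ (n + j)) := by
              rw [ENNReal.ofReal_tsum_of_nonneg (fun j => by positivity)]
              simp_rw [pow_add]
              exact (summable_geometric_two).mul_left _
          _ = _ := by
              congr 1
              simp_rw [pow_add]
              rw [tsum_mul_left, tsum_geometric_two, mul_comm]
      have h2 : hμ (K n)ᶜ ≤ ENNReal.ofReal (3 * (1 / 2) ^ n) := by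
        have hsub : (K n)ᶜ ⊆ (⋃ j, X (n + j)) ∪ ((⋃ j, X (n + j))ᶜ \ K n) := by
          intro x hx
          by_cases h : x ∈ ⋃ j, X (n + j)
          · exact Or.inl h
          · exact Or.inr ⟨h, hx⟩
        calc _ ≤ hμ (⋃ j, X (n + j)) + hμ ((⋃ j, X (n + j))ᶜ \ K n) :=
              (measure_mono hsub).trans (measure_union_le _ _)
          _ ≤ ENNReal.ofReal (2 * (1 / 2) ^ n) + ENNReal.ofReal ((1 / 2) ^ n) :=
              add_le_add h1 (hKm n).le
          _ = _ := by
              rw [← ENNReal.ofReal_add (by positivity) (by positivity)]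
              congr 1
              ring
      rw [AddCircle.volume_eq_smul_haarAddCircle, Measure.smul_apply, smul_eq_mul,
        ENNReal.ofReal_mul (p := 2 * π) (by positivity)]
      exact mul_le_mul' le_rfl h2
    refine tendsto_of_tendsto_of_tendsto_of_le_of_le tendsto_const_nhds ?_
      (fun n => zero_le) hbound
    rw [← ENNReal.ofReal_zero]
    apply ENNReal.tendsto_ofReal
    have h := tendsto_pow_atTop_nhds_zero_of_lt_one (r := (1 / 2 : ℝ)) (by norm_num) (by norm_num)
    have h2 := (h.const_mul 3).const_mul (2 * π)
    simpa using h2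
  · intro n
    have hbd : ∀ j, n ≤ j → ∀ N, m j ≤ N →
        ∫ t in K n, ‖analyticPartialSum c N t - f t‖ ^ 2 ∂volume
          ≤ 2 * π * (4 * (1 / 2) ^ j) ^ 2 := by
      intro j hj N hN
      obtain ⟨i, hji, u, r, hu, hr, hsum, hub, hrb⟩ := hpart j N hN
      rw [AddCircle.volume_eq_smul_haarAddCircle, Measure.restrict_smul, integral_smul_measure,
        ENNReal.toReal_ofReal (by positivity), smul_eq_mul]
      apply mul_le_mul_of_nonneg_left _ (by positivity)
      have hKmeas : MeasurableSet (K n) := (hKc n).measurableSet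
      apply integral_sq_le
      · exact (aps_cont c N).measurable.sub hf
      · positivity
      have hnot : ∀ x ∈ K n, ∀ i', n ≤ i' → x ∉ X i' := by
        intro x hx i' hi' hxi
        apply hKsub n hx
        rw [Set.mem_iUnion]
        exact ⟨i' - n, by rwa [Nat.add_sub_cancel' hi']⟩
      have hfun : (fun t => analyticPartialSum c N t - f t) = u + r := by
        ext x
        exact hsum x
      have hu2 : eLpNorm u 2 ((hμ).restrict (K n)) ≤ ENNReal.ofReal (3 * (1 / 2) ^ i) := by
        have h1 : ∀ᵐ x ∂((hμ).restrict (K n)), ‖u x‖ ≤ 3 * (1 / 2) ^ i := by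
          rw [ae_restrict_iff' hKmeas]
          filter_upwards with x hx
          exact hub x (hnot x hx i (by omega)) (hnot x hx (i + 1) (by omega))
        refine (eLpNorm_le_of_ae_bound h1).trans ?_
        have h2 : ((hμ).restrict (K n) Set.univ) ^ ((2:ENNReal).toReal)⁻¹ ≤ 1 := by
          apply ENNReal.rpow_le_one
          · rw [Measure.restrict_apply_univ]
            exact prob_le_one
          · simp
        calc _ ≤ 1 * ENNReal.ofReal (3 * (1 / 2) ^ i) := by gcongr
          _ = _ := one_mul _
      have hr2 : eLpNorm r 2 ((hμ).restrict (K n)) ≤ ENNReal.ofReal ((1 / 2) ^ i) :=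
        (eLpNorm_mono_measure r Measure.restrict_le_self).trans hrb
      rw [hfun]
      calc _ ≤ eLpNorm u 2 ((hμ).restrict (K n)) + eLpNorm r 2 ((hμ).restrict (K n)) :=
            eLpNorm_add_le hu.aestronglyMeasurable hr.aestronglyMeasurable (by norm_num)
        _ ≤ ENNReal.ofReal (3 * (1 / 2) ^ i) + ENNReal.ofReal ((1 / 2) ^ i) := add_le_add hu2 hr2
        _ = ENNReal.ofReal (4 * (1 / 2) ^ i) := by
            rw [← ENNReal.ofReal_add (by positivity) (by positivity)]
            congr 1
            ring
        _ ≤ _ := by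
            apply ENNReal.ofReal_le_ofReal
            apply mul_le_mul_of_nonneg_left _ (by norm_num)
            exact pow_le_pow_of_le_one (by norm_num) (by norm_num) hji
    have hlim : Tendsto (fun j : ℕ => 2 * π * (4 * (1 / 2 : ℝ) ^ j) ^ 2) atTop (𝓝 0) := by
      have h := tendsto_pow_atTop_nhds_zero_of_lt_one (r := (1 / 2 : ℝ)) (by norm_num)
        (by norm_num)
      have h2 := (((h.const_mul 4).pow 2)).const_mul (2 * π)
      simpa using h2
    rw [Metric.tendsto_atTop]
    intro ε hε
    obtain ⟨j, hj, hnj⟩ := ((hlim.eventually (gt_mem_nhds hε)).and (eventually_ge_atTop n)).exists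
    refine ⟨m j, fun N hN => ?_⟩
    rw [Real.dist_eq, sub_zero, abs_of_nonneg (integral_nonneg fun x => by positivity)]
    exact (hbd j hnj N hN).trans_lt hj
end

section
/- Given any measurable function f : 𝕋 → ℂ, there exist complex coefficients (c_k)_{k>0} satisfying ∑_{k>0} |c_k|^{2+ε} < ∞ for every ε > 0, such that the partial sums S_N(t) = ∑_{0<k≤N} c_k e^{ikt} converge to f in Lebesgue measure on 𝕋. -/
open MeasureTheory Filter Topology Real

namespace AM

/-- The circle. -/
abbrev Tor := AddCircle (2 * π)

theorem integral_const_tor (a : ℝ) : ∫ _ : Tor, a = 2 * π * a := by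
  rw [integral_const, measureReal_def, AddCircle.measure_univ,
    ENNReal.toReal_ofReal (by positivity), smul_eq_mul]

theorem cont_int {E : Type*} [NormedAddCommGroup E] {f : Tor → E}
    (hf : Continuous f) : Integrable f volume :=
  hf.integrable_of_hasCompactSupport (HasCompactSupport.of_compactSpace f)

theorem integral_fourier_one (f : ℂ → ℝ) (b : ℝ) :
    ∫ s : Tor, f (b * fourier 1 s) = 2 * π * circleAverage f 0 b := by
  rw [← AddCircle.intervalIntegral_preimage (2 * π) 0, circleAverage_def, zero_add, smul_eq_mul,
    ← mul_assoc, mul_inv_cancel₀ (by positivity), one_mul]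
  congr 1
  ext θ
  rw [fourier_coe_apply, circleMap]
  congr 1
  rw [zero_add]
  congr 2
  have : (π : ℂ) ≠ 0 := by exact_mod_cast Real.pi_ne_zero
  push_cast
  field_simp

theorem mean_log (x : ℂ) (b : ℝ) (hb : 0 ≤ b) (hx : 0 < ‖x‖) (hbx : b ≤ ‖x‖) :
    ∫ s : Tor, log ‖x - b * fourier 1 s‖ = 2 * π * log ‖x‖ := by
  rcases hb.eq_or_lt with h | h
  · subst h
    simp only [Complex.ofReal_zero, zero_mul, sub_zero]
    exact integral_const_tor _
  · rw [integral_fourier_one (fun w => log ‖x - w‖) b]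
    congr 1
    have := circleAverage_log_norm_sub_const_eq_log_radius_add_posLog (a := x) (c := 0) h.ne'
    simp_rw [norm_sub_rev x]
    rw [this, zero_sub, norm_neg, posLog_eq_log, log_mul (by positivity) (by positivity), log_inv]
    · ring
    · rw [abs_of_nonneg (by positivity)]
      rw [inv_mul_eq_div, le_div_iff₀ h]; linarith

theorem mean_inv (x : ℂ) (b : ℝ) (hb : 0 ≤ b) (hbx : b < ‖x‖) :
    2 * π * ((‖x‖ ^ 2)⁻¹ + b ^ 2 / ‖x‖ ^ 4) ≤ ∫ s : Tor, (‖x - b * fourier 1 s‖ ^ 2)⁻¹ := by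
  have hx : 0 < ‖x‖ := hb.trans_lt hbx
  have hx0 : x ≠ 0 := norm_pos_iff.1 hx
  rw [integral_fourier_one (fun w => (‖x - w‖ ^ 2)⁻¹) b]
  have hd : 0 < ‖x‖ ^ 2 - b ^ 2 := by nlinarith
  have key : circleAverage (fun w => (‖x - w‖ ^ 2)⁻¹) 0 b = (‖x‖ ^ 2 - b ^ 2)⁻¹ := by
    have hne : ∀ w : ℂ, ‖w‖ ≤ b → x - w ≠ 0 := by
      intro w hw h
      rw [sub_eq_zero] at h
      subst h; linarith
    have h1 : circleAverage (fun w => (x + w) / (x - w)) 0 b = 1 := by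
      have hdiff : DiffContOnCl ℂ (fun w => (x + w) / (x - w)) (Metric.ball 0 |b|) := by
        apply DifferentiableOn.diffContOnCl
        intro w hw
        have hw' : ‖w‖ ≤ b := by
          have := Metric.closure_ball_subset_closedBall hw
          rw [abs_of_nonneg hb] at this
          simpa using this
        apply DifferentiableAt.differentiableWithinAt
        exact DifferentiableAt.div (by fun_prop) (by fun_prop) (hne w hw')
      rw [hdiff.circleAverage]
      simp [hx0]
    have hci : CircleIntegrable (fun w => (x + w) / (x - w)) 0 b := by
      apply ContinuousOn.circleIntegrable hb
      intro w hw
      apply ContinuousAt.continuousWithinAt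
      have : ‖w‖ ≤ b := by simpa using (le_of_eq hw)
      exact ContinuousAt.div (by fun_prop) (by fun_prop) (hne w this)
    have h2 := ContinuousLinearMap.circleAverage_comp_comm Complex.reCLM hci
    rw [h1] at h2
    have h3 : circleAverage (fun w => (‖x - w‖ ^ 2)⁻¹) 0 b =
        circleAverage ((‖x‖ ^ 2 - b ^ 2)⁻¹ • (Complex.reCLM ∘ (fun w => (x + w) / (x - w)))) 0 b := by
      apply circleAverage_congr_sphere
      intro w hw
      have hw : ‖w‖ = b := by simpa [abs_of_nonneg hb] using hw
      have hne' := hne w hw.le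
      have hn : 0 < ‖x - w‖ ^ 2 := by positivity
      simp only [Pi.smul_apply, Function.comp, Complex.reCLM_apply, smul_eq_mul]
      rw [← hw] at hd ⊢
      rw [Complex.div_re, ← add_div, Complex.normSq_eq_norm_sq]
      rw [inv_mul_eq_div, div_div, eq_div_iff (by positivity), mul_comm (‖x - w‖ ^ 2) (_ - _),
        mul_left_comm, inv_mul_cancel₀ hn.ne']
      rw [Complex.sq_norm, Complex.sq_norm, Complex.normSq_apply, Complex.normSq_apply]
      simp; ring
    rw [h3, circleAverage_smul, h2]
    simp
  rw [key]
  gcongr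
  have e : b ^ 2 / ‖x‖ ^ 4 = (‖x‖ ^ 2)⁻¹ * (b ^ 2 / ‖x‖ ^ 2) := by field_simp
  rw [e, ← one_div (_ - _), le_div_iff₀ hd]
  have : 0 < ‖x‖ ^ 2 := by positivity
  field_simp
  nlinarith [sq_nonneg (b ^ 2)]

/-- Asymptotic independence of `t` and `n • t`. -/
theorem fejer (H : C(Tor × Tor, ℝ)) :
    Tendsto (fun n : ℕ => ∫ t : Tor, H (t, n • t)) atTop
      (𝓝 ((2 * π)⁻¹ * ∫ t : Tor, ∫ s : Tor, H (t, s))) := by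
  have hpi : 0 < 2 * π := by positivity
  rw [Metric.tendsto_atTop]
  intro ε hε
  have huc : UniformContinuous H := CompactSpace.uniformContinuous_of_continuous H.continuous
  obtain ⟨δ, hδ, hH⟩ := Metric.uniformContinuous_iff.1 huc (ε / (2 * (2 * π))) (by positivity)
  obtain ⟨n0, hn0⟩ := exists_nat_gt (2 * π / δ)
  refine ⟨n0 + 1, fun n hn => ?_⟩
  have hnpos : (0 : ℝ) < n := by
    have : 0 < n := by omega
    exact_mod_cast this
  have hnδ : 2 * π / n < δ := by
    rw [div_lt_iff₀ hδ] at hn0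
    rw [div_lt_iff₀ hnpos]
    have : (n0 : ℝ) ≤ n := by exact_mod_cast (by omega : n0 ≤ n)
    nlinarith
  -- averaged shift
  have h1 : ∀ s : ℝ, ∫ t : Tor, H (t, n • t) =
      ∫ t : Tor, H (t + ((s / n : ℝ) : Tor), n • t + (s : Tor)) := by
    intro s
    rw [← integral_add_right_eq_self (fun t : Tor => H (t, n • t)) ((s / n : ℝ) : Tor)]
    congr 1
    ext t
    congr 2
    rw [smul_add]
    congr 1
    rw [← AddCircle.coe_nsmul]
    congr 1
    simp; field_simp
  have hbound : ∀ s : ℝ, s ∈ Set.Ioc 0 (2 * π) →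
      |(∫ t : Tor, H (t, n • t)) - ∫ t : Tor, H (t, n • t + (s : Tor))| ≤ ε / 2 := by
    intro s hs
    rw [h1 s, ← integral_sub (cont_int (by fun_prop)) (cont_int (by fun_prop))]
    have := norm_integral_le_of_norm_le_const (μ := (volume : Measure Tor))
      (f := fun t => H (t + ((s / n : ℝ) : Tor), n • t + (s : Tor)) - H (t, n • t + (s : Tor)))
      (C := ε / (2 * (2 * π))) (Eventually.of_forall fun t => by
        refine le_of_lt ?_
        rw [← dist_eq_norm]
        apply hH
        rw [Prod.dist_eq]
        simp only [dist_self, max_lt_iff]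
        refine ⟨?_, hδ⟩
        rw [dist_eq_norm, add_sub_cancel_left]
        refine lt_of_le_of_lt ?_ hnδ
        refine le_trans (QuotientAddGroup.norm_mk_le_norm (S := AddSubgroup.zmultiples (2 * π))
          (m := s / n)) ?_
        rw [Real.norm_eq_abs]
        rw [abs_of_pos (by have := hs.1; positivity)]
        have := hs.2
        gcongr)
    rw [Real.norm_eq_abs, measureReal_def, AddCircle.measure_univ,
      ENNReal.toReal_ofReal (by positivity)] at this
    refine this.trans (le_of_eq ?_)
    field_simp
  have h2 : ∫ t : Tor, ∫ s : Tor, H (t, s) =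
      ∫ s in (0:ℝ)..(0 + 2 * π), ∫ t : Tor, H (t, n • t + (s : Tor)) := by
    rw [AddCircle.intervalIntegral_preimage (2 * π) 0 (fun s => ∫ t : Tor, H (t, n • t + s))]
    have hI : Integrable (Function.uncurry fun (s t : Tor) => H (t, n • t + s))
        (volume.prod volume) := by
      apply Continuous.integrable_of_hasCompactSupport
      · have : Continuous fun p : Tor × Tor => H (p.2, n • p.2 + p.1) := by fun_prop
        exact this
      · exact HasCompactSupport.of_compactSpace _
    rw [integral_integral_swap hI]
    congr 1
    ext t
    rw [← integral_add_left_eq_self (fun s => H (t, s)) (n • t)]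
  rw [h2, Real.dist_eq]
  have h3 : (∫ t : Tor, H (t, n • t)) - (2 * π)⁻¹ *
      ∫ s in (0:ℝ)..(0 + 2 * π), ∫ t : Tor, H (t, n • t + (s : Tor)) =
      (2 * π)⁻¹ * ∫ s in (0:ℝ)..(0 + 2 * π), ((∫ t : Tor, H (t, n • t)) -
        ∫ t : Tor, H (t, n • t + (s : Tor))) := by
    rw [intervalIntegral.integral_sub]
    · simp; field_simp
    · simp
    · apply Continuous.intervalIntegrable
      have hc : Continuous (fun s : Tor => ∫ t : Tor, H (t, n • t + s)) := by
        have : Continuous (Function.uncurry fun (s t : Tor) => H (t, n • t + s)) := by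
          have : Continuous fun p : Tor × Tor => H (p.2, n • p.2 + p.1) := by fun_prop
          exact this
        exact continuous_parametric_integral_of_continuous (μ := volume) this isCompact_univ |>.congr
          (fun s => by simp)
      exact hc.comp (AddCircle.continuous_mk' _)
  rw [h3, abs_mul, abs_of_pos (by positivity)]
  have h4 := intervalIntegral.norm_integral_le_of_norm_le_const (a := 0) (b := 0 + 2 * π)
    (C := ε / 2) (f := fun s : ℝ => (∫ t : Tor, H (t, n • t)) -
        ∫ t : Tor, H (t, n • t + (s : Tor))) (fun s hs => by
      rw [Set.uIoc_of_le (by linarith), zero_add] at hs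
      exact hbound s hs)
  rw [Real.norm_eq_abs] at h4
  calc _ ≤ (2 * π)⁻¹ * (ε / 2 * |0 + 2 * π - 0|) := by gcongr
    _ = ε / 2 := by rw [zero_add, sub_zero, abs_of_pos hpi]; field_simp
    _ < ε := by linarith

theorem integral_fourier (n : ℤ) :
    ∫ t : Tor, (fourier n t : ℂ) = if n = 0 then (2 * π : ℂ) else 0 := by
  have h := congrFun (fourierCoeff_fourier (T := 2 * π) n) 0
  rw [fourierCoeff, AddCircle.integral_haarAddCircle] at h
  simp only [neg_zero, fourier_zero, one_smul] at h
  have h2 : ∫ t : Tor, (fourier n t : ℂ) = (2 * π) • ((2 * π)⁻¹ • ∫ t : Tor, (fourier n t : ℂ)) := by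
    rw [smul_smul, mul_inv_cancel₀ (by positivity), one_smul]
  rw [h2, h]
  by_cases hn : n = 0
  · subst hn; simp
  · rw [Pi.single_eq_of_ne (Ne.symm hn)]
    simp [hn]

theorem parseval (s : Finset ℕ) (c : ℕ → ℂ) :
    ∫ t : Tor, ‖∑ k ∈ s, c k * fourier (k : ℤ) t‖ ^ 2 = 2 * π * ∑ k ∈ s, ‖c k‖ ^ 2 := by
  have h : ∀ t : Tor, ((‖∑ k ∈ s, c k * fourier (k : ℤ) t‖ ^ 2 : ℝ) : ℂ) =
      ∑ k ∈ s, ∑ l ∈ s, c k * (starRingEnd ℂ) (c l) * fourier ((k : ℤ) - l) t := by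
    intro t
    rw [Complex.ofReal_pow, ← Complex.mul_conj', map_sum, Finset.sum_mul_sum]
    refine Finset.sum_congr rfl fun k _ => Finset.sum_congr rfl fun l _ => ?_
    rw [map_mul, sub_eq_add_neg, fourier_add, fourier_neg]
    ring
  have h2 : ((∫ t : Tor, ‖∑ k ∈ s, c k * fourier (k : ℤ) t‖ ^ 2 : ℝ) : ℂ) =
      ((2 * π * ∑ k ∈ s, ‖c k‖ ^ 2 : ℝ) : ℂ) := by
    rw [← integral_complex_ofReal]
    simp_rw [h]
    rw [integral_finsetSum _ fun k _ => cont_int (by fun_prop)]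
    have h3 : ∀ k : ℕ, ∫ t : Tor, ∑ l ∈ s, c k * (starRingEnd ℂ) (c l) * fourier ((k : ℤ) - l) t =
        ∑ l ∈ s, c k * (starRingEnd ℂ) (c l) * if k = l then (2 * π : ℂ) else 0 := by
      intro k
      rw [integral_finsetSum _ fun l _ => cont_int (by fun_prop)]
      refine Finset.sum_congr rfl fun l _ => ?_
      rw [integral_const_mul, integral_fourier]
      simp only [sub_eq_zero, Nat.cast_inj]
    simp_rw [h3]
    push_cast
    rw [Finset.mul_sum]
    refine Finset.sum_congr rfl fun k hk => ?_
    simp only [mul_ite, mul_zero]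
    rw [Finset.sum_ite_eq]
    simp only [hk, if_true]
    rw [Complex.mul_conj']
    ring
  exact_mod_cast h2

theorem block (F : C(Tor, ℂ)) (η : ℝ) (hη : 0 < η) (N0 : ℕ) :
    ∃ M : ℕ, ∀ n ≥ M, ∃ (N1 : ℕ) (c : ℕ → ℂ), N0 < N1 ∧ (∀ k, k ∉ Finset.Ioc N0 N1 → c k = 0) ∧
      (∀ t : Tor, ‖∑ k ∈ Finset.Ioc N0 N1, c k * fourier (k : ℤ) t - F t * fourier (n : ℤ) t‖ ≤ η) ∧
      ∑ k ∈ Finset.Ioc N0 N1, ‖c k‖ ^ 2 ≤ (‖F‖ + η) ^ 2 := by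
  have hF : F ∈ (Submodule.span ℂ (Set.range (@fourier (2 * π)))).topologicalClosure := by
    rw [span_fourier_closure_eq_top]; trivial
  obtain ⟨h, hh, hdist⟩ := Metric.mem_closure_iff.1 hF η hη
  obtain ⟨l, rfl⟩ := (Finsupp.mem_span_range_iff_exists_finsupp).1 hh
  obtain ⟨D, hD⟩ : ∃ D : ℕ, ∀ j ∈ l.support, j.natAbs ≤ D :=
    ⟨l.support.sup Int.natAbs, fun j hj => Finset.le_sup (f := Int.natAbs) hj⟩
  refine ⟨N0 + D + 1, fun n hn => ⟨n + D, fun k => l ((k : ℤ) - n), by omega, ?_, ?_⟩⟩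
  · intro k hk
    by_contra hne
    have := hD _ (Finsupp.mem_support_iff.2 hne)
    apply hk
    rw [Finset.mem_Ioc]
    omega
  have hS : ∀ t : Tor, ∑ k ∈ Finset.Ioc N0 (n + D), l ((k : ℤ) - n) * fourier (k : ℤ) t =
      (l.sum fun i a => a • fourier i : C(Tor, ℂ)) t * fourier (n : ℤ) t := by
    intro t
    rw [Finsupp.sum, ContinuousMap.sum_apply, Finset.sum_mul]
    symm
    apply Finset.sum_of_injOn (fun j : ℤ => (j + n).toNat)
    · intro i hi j hj hij
      have h1 := hD i hi
      have h2 := hD j hj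
      simp only at hij
      omega
    · intro i hi
      have h1 := hD i hi
      simp only [Finset.coe_Ioc, Set.mem_Ioc]
      omega
    · intro k hk hne
      have : l ((k : ℤ) - n) = 0 := by
        by_contra h0
        apply hne
        refine ⟨(k : ℤ) - n, Finsupp.mem_support_iff.2 h0, ?_⟩
        simp
      simp [this]
    · intro i hi
      have h1 := hD i hi
      have h2 : (((i + n).toNat : ℕ) : ℤ) = i + n := by omega
      rw [h2, fourier_add]
      simp [mul_assoc]
  have hd : ∀ t : Tor, ‖F t - (l.sum fun i a => a • fourier i : C(Tor, ℂ)) t‖ ≤ η := by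
    intro t
    rw [dist_eq_norm] at hdist
    exact (ContinuousMap.norm_coe_le_norm (F - _) t).trans hdist.le
  have hf1 : ∀ t : Tor, ‖(fourier (n : ℤ) t : ℂ)‖ = 1 := by
    intro t; rw [fourier_apply]; exact Circle.norm_coe _
  refine ⟨fun t => ?_, ?_⟩
  · rw [hS, ← sub_mul, norm_mul, hf1, mul_one, norm_sub_rev]
    exact hd t
  · have hp := parseval (Finset.Ioc N0 (n + D)) (fun k => l ((k : ℤ) - n))
    have hle : ∫ t : Tor, ‖∑ k ∈ Finset.Ioc N0 (n + D), l ((k : ℤ) - n) * fourier (k : ℤ) t‖ ^ 2 ≤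
        ∫ t : Tor, (‖F‖ + η) ^ 2 := by
      apply integral_mono (cont_int (by fun_prop)) (cont_int (by fun_prop))
      intro t
      simp only
      rw [hS, norm_mul, hf1, mul_one]
      gcongr
      calc _ = ‖F t - (F t - (l.sum fun i a => a • fourier i : C(Tor, ℂ)) t)‖ := by
            rw [sub_sub_cancel]
        _ ≤ ‖F t‖ + ‖F t - (l.sum fun i a => a • fourier i : C(Tor, ℂ)) t‖ := norm_sub_le _ _
        _ ≤ _ := add_le_add (ContinuousMap.norm_coe_le_norm F t) (hd t)
    rw [hp, integral_const_tor] at hle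
    exact le_of_mul_le_mul_left hle (by positivity)

theorem norm_four (n : ℤ) (t : Tor) : ‖(fourier n t : ℂ)‖ = 1 := by
  rw [fourier_apply]; exact Circle.norm_coe _

/-- The speed of the random walk. -/
noncomputable def phi (x : ℂ) : ℝ := min 1 (‖x‖ - 1 / 2)

theorem phi_cont : Continuous phi := by unfold phi; fun_prop

theorem phi_nonneg {x : ℂ} (hx : 1 / 2 ≤ ‖x‖) : 0 ≤ phi x :=
  le_min zero_le_one (by linarith)

theorem phi_le_one (x : ℂ) : phi x ≤ 1 := min_le_left _ _

theorem phi_le (x : ℂ) : phi x ≤ ‖x‖ - 1 / 2 := min_le_right _ _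

theorem step (g ρ : C(Tor, ℂ)) (hρ : ∀ t, 1 / 2 ≤ ‖ρ t‖) (a η τ : ℝ) (ha : 0 < a) (ha2 : a ≤ 1 / 2)
    (hη : 0 < η) (hτ : 0 < τ) (N0 : ℕ) :
    ∃ (ρ' : C(Tor, ℂ)) (N1 : ℕ) (c : ℕ → ℂ), (∀ t, 1 / 2 ≤ ‖ρ' t‖) ∧ N0 < N1 ∧
      (∀ k, k ∉ Finset.Ioc N0 N1 → c k = 0) ∧
      (∀ t : Tor, ‖∑ k ∈ Finset.Ioc N0 N1, c k * fourier (k : ℤ) t -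
        (g t * ρ t - g t * ρ' t)‖ ≤ η) ∧
      ∑ k ∈ Finset.Ioc N0 N1, ‖c k‖ ^ 2 ≤ (a * ‖g‖ + η) ^ 2 ∧
      ∫ t : Tor, log ‖ρ' t‖ ≤ (∫ t : Tor, log ‖ρ t‖) + τ ∧
      (∫ t : Tor, (‖ρ t‖ ^ 2)⁻¹) + a ^ 2 * (∫ t : Tor, phi (ρ t) ^ 2 / ‖ρ t‖ ^ 4) - τ ≤
        ∫ t : Tor, (‖ρ' t‖ ^ 2)⁻¹ := by
  have hphc : Continuous fun t => phi (ρ t) := phi_cont.comp ρ.continuous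
  have hb0 : ∀ t, 0 ≤ a * phi (ρ t) := fun t => mul_nonneg ha.le (phi_nonneg (hρ t))
  have hb1 : ∀ t, a * phi (ρ t) ≤ ‖ρ t‖ - 1 / 2 := fun t => by
    have := phi_le (ρ t); have := phi_nonneg (hρ t); nlinarith
  have hlow : ∀ t (z : ℂ), ‖z‖ = 1 → 1 / 2 ≤ ‖ρ t - (a * phi (ρ t) : ℝ) * z‖ := by
    intro t z hz
    have h1 := norm_sub_norm_le (ρ t) ((a * phi (ρ t) : ℝ) * z)
    rw [norm_mul, hz, mul_one, Complex.norm_real, Real.norm_eq_abs, abs_of_nonneg (hb0 t)] at h1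
    linarith [hb1 t]
  let Q : C(Tor × Tor, ℂ) := ⟨fun p => ρ p.1 - (a * phi (ρ p.1) : ℝ) * fourier 1 p.2, by
    have : Continuous fun p : Tor × Tor => phi (ρ p.1) := hphc.comp continuous_fst
    fun_prop⟩
  have hQ : ∀ p, 1 / 2 ≤ ‖Q p‖ := fun p => hlow p.1 _ (norm_four 1 p.2)
  let H1 : C(Tor × Tor, ℝ) := ⟨fun p => log ‖Q p‖, by
    apply Continuous.log (by fun_prop)
    intro p; have := hQ p; positivity⟩
  let H2 : C(Tor × Tor, ℝ) := ⟨fun p => (‖Q p‖ ^ 2)⁻¹, by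
    apply Continuous.inv₀ (by fun_prop)
    intro p; have := hQ p; positivity⟩
  have hρp : ∀ t, 0 < ‖ρ t‖ := fun t => by linarith [hρ t]
  have L1 := fejer H1
  have E1 : (2 * π)⁻¹ * ∫ t : Tor, ∫ s : Tor, H1 (t, s) = ∫ t : Tor, log ‖ρ t‖ := by
    have : ∀ t, ∫ s : Tor, H1 (t, s) = 2 * π * log ‖ρ t‖ := fun t =>
      mean_log (ρ t) (a * phi (ρ t)) (hb0 t) (hρp t) (by linarith [hb1 t])
    simp_rw [this, integral_const_mul]
    field_simp
  have L2 := fejer H2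
  have hci : Continuous fun t => (‖ρ t‖ ^ 2)⁻¹ := by
    apply Continuous.inv₀ (by fun_prop)
    intro t; have := hρp t; positivity
  have hck : Continuous fun t => phi (ρ t) ^ 2 / ‖ρ t‖ ^ 4 := by
    apply Continuous.div (by fun_prop) (by fun_prop)
    intro t; have := hρp t; positivity
  have E2 : (∫ t : Tor, (‖ρ t‖ ^ 2)⁻¹) + a ^ 2 * (∫ t : Tor, phi (ρ t) ^ 2 / ‖ρ t‖ ^ 4) ≤
      (2 * π)⁻¹ * ∫ t : Tor, ∫ s : Tor, H2 (t, s) := by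
    have h : ∀ t, 2 * π * ((‖ρ t‖ ^ 2)⁻¹ + a ^ 2 * (phi (ρ t) ^ 2 / ‖ρ t‖ ^ 4)) ≤
        ∫ s : Tor, H2 (t, s) := fun t => by
      have := mean_inv (ρ t) (a * phi (ρ t)) (hb0 t) (by linarith [hb1 t])
      rw [mul_pow, mul_div_assoc] at this
      exact this
    have hc2 : Continuous fun t : Tor => ∫ s : Tor, H2 (t, s) := by
      have : Continuous (Function.uncurry fun (t s : Tor) => H2 (t, s)) := H2.continuous
      exact continuous_parametric_integral_of_continuous (μ := volume) this isCompact_univ |>.congr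
          (fun s => by simp)
    have := integral_mono (μ := (volume : Measure Tor)) (cont_int (by fun_prop)) (cont_int hc2) h
    rw [integral_const_mul, integral_add (cont_int hci) (cont_int (by fun_prop)),
      integral_const_mul] at this
    rw [inv_mul_eq_div, le_div_iff₀ (by positivity)]
    linarith
  rw [E1] at L1
  let F : C(Tor, ℂ) := ⟨fun t => g t * (a * phi (ρ t) : ℝ), by fun_prop⟩
  have hFn : ‖F‖ ≤ a * ‖g‖ := by
    rw [ContinuousMap.norm_le _ (by positivity)]
    intro t
    change ‖g t * (a * phi (ρ t) : ℝ)‖ ≤ _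
    rw [norm_mul, Complex.norm_real, Real.norm_eq_abs, abs_of_nonneg (hb0 t), mul_comm]
    have := phi_le_one (ρ t)
    have := phi_nonneg (hρ t)
    gcongr
    · nlinarith
    · exact ContinuousMap.norm_coe_le_norm g t
  obtain ⟨M, hM⟩ := block F η hη N0
  have ev1 := L1.eventually (gt_mem_nhds (show ∫ t : Tor, log ‖ρ t‖ < (∫ t : Tor, log ‖ρ t‖) + τ by linarith))
  have ev2 := L2.eventually (lt_mem_nhds (show (2 * π)⁻¹ * (∫ t : Tor, ∫ s : Tor, H2 (t, s)) - τ <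
    (2 * π)⁻¹ * ∫ t : Tor, ∫ s : Tor, H2 (t, s) by linarith))
  obtain ⟨n, h1, h2, hn⟩ := (ev1.and (ev2.and (eventually_ge_atTop M))).exists
  obtain ⟨N1, c, hN, hc0, hcF, hcs⟩ := hM n hn
  let ρ' : C(Tor, ℂ) := ⟨fun t => Q (t, n • t), by fun_prop⟩
  refine ⟨ρ', N1, c, fun t => hQ _, hN, hc0, fun t => ?_, ?_, h1.le, ?_⟩
  · convert hcF t using 3
    change g t * ρ t - g t * (ρ t - (a * phi (ρ t) : ℝ) * fourier 1 (n • t)) =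
      g t * (a * phi (ρ t) : ℝ) * fourier (n : ℤ) t
    have : (fourier 1 (n • t) : ℂ) = fourier (n : ℤ) t := by
      rw [fourier_apply, fourier_apply, one_smul, natCast_zsmul]
    rw [this]; ring
  · refine hcs.trans ?_
    gcongr
  · change _ ≤ ∫ t : Tor, H2 (t, n • t)
    linarith

theorem exists_seq {α : Type*} (P : α → Prop) (R : ℕ → α → α → Prop) (a0 : α) (h0 : P a0)
    (h : ∀ n a, P a → ∃ b, P b ∧ R n a b) :
    ∃ s : ℕ → α, s 0 = a0 ∧ ∀ n, P (s n) ∧ R n (s n) (s (n + 1)) := by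
  choose! F hF using h
  refine ⟨fun n => Nat.rec a0 (fun n a => F n a) n, rfl, ?_⟩
  have hP : ∀ n, P (Nat.rec a0 (fun n a => F n a) n : α) := by
    intro n
    induction n with
    | zero => exact h0
    | succ k ih => exact (hF k _ ih).1
  exact fun n => ⟨hP n, (hF n _ (hP n)).2⟩

theorem glue (N : ℕ → ℕ) (hN : StrictMono N) (d : ℕ → ℕ → ℂ) :
    ∃ c : ℕ → ℂ, (∀ k ≤ N 0, c k = 0) ∧ ∀ l, ∀ k ∈ Finset.Ioc (N l) (N (l + 1)), c k = d l k := by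
  classical
  refine ⟨fun k => if h : ∃ l, k ∈ Finset.Ioc (N l) (N (l + 1)) then d h.choose k else 0, ?_, ?_⟩
  · intro k hk
    simp only
    rw [dif_neg]
    rintro ⟨l, hl⟩
    have := hN.monotone (Nat.zero_le l)
    rw [Finset.mem_Ioc] at hl
    omega
  · intro l k hk
    have hex : ∃ l, k ∈ Finset.Ioc (N l) (N (l + 1)) := ⟨l, hk⟩
    simp only
    rw [dif_pos hex]
    have h2 := hex.choose_spec
    congr 1
    generalize hex.choose = m at h2
    rw [Finset.mem_Ioc] at hk h2
    rcases lt_trichotomy m l with h | h | h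
    · have := hN.monotone (show m + 1 ≤ l by omega); omega
    · exact h
    · have := hN.monotone (show l + 1 ≤ m by omega); omega

theorem chain (g : C(Tor, ℂ)) (a η τ : ℝ) (ha : 0 < a) (ha2 : a ≤ 1 / 2)
    (hη : 0 < η) (hτ : 0 < τ) (N0 : ℕ) :
    ∃ (ρ : ℕ → C(Tor, ℂ)) (N : ℕ → ℕ) (c : ℕ → ℂ), ρ 0 = 1 ∧ N 0 = N0 ∧ StrictMono N ∧
      ∀ l, (∀ t, 1 / 2 ≤ ‖ρ l t‖) ∧
      (∀ t : Tor, ‖∑ k ∈ Finset.Ioc (N l) (N (l + 1)), c k * fourier (k : ℤ) t -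
        (g t * ρ l t - g t * ρ (l + 1) t)‖ ≤ η) ∧
      ∑ k ∈ Finset.Ioc (N l) (N (l + 1)), ‖c k‖ ^ 2 ≤ (a * ‖g‖ + η) ^ 2 ∧
      ∫ t : Tor, log ‖ρ (l + 1) t‖ ≤ (∫ t : Tor, log ‖ρ l t‖) + τ ∧
      (∫ t : Tor, (‖ρ l t‖ ^ 2)⁻¹) + a ^ 2 * (∫ t : Tor, phi (ρ l t) ^ 2 / ‖ρ l t‖ ^ 4) - τ ≤
        ∫ t : Tor, (‖ρ (l + 1) t‖ ^ 2)⁻¹ := by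
  obtain ⟨s, hs0, hs⟩ := exists_seq (α := C(Tor, ℂ) × ℕ × (ℕ → ℂ))
    (fun s => ∀ t, 1 / 2 ≤ ‖s.1 t‖)
    (fun _ s s' => s.2.1 < s'.2.1 ∧
      (∀ t : Tor, ‖∑ k ∈ Finset.Ioc s.2.1 s'.2.1, s'.2.2 k * fourier (k : ℤ) t -
        (g t * s.1 t - g t * s'.1 t)‖ ≤ η) ∧
      ∑ k ∈ Finset.Ioc s.2.1 s'.2.1, ‖s'.2.2 k‖ ^ 2 ≤ (a * ‖g‖ + η) ^ 2 ∧
      ∫ t : Tor, log ‖s'.1 t‖ ≤ (∫ t : Tor, log ‖s.1 t‖) + τ ∧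
      (∫ t : Tor, (‖s.1 t‖ ^ 2)⁻¹) + a ^ 2 * (∫ t : Tor, phi (s.1 t) ^ 2 / ‖s.1 t‖ ^ 4) - τ ≤
        ∫ t : Tor, (‖s'.1 t‖ ^ 2)⁻¹) (1, N0, 0) (by intro t; simp; norm_num) (by
      rintro _ ⟨ρ, N, c⟩ hρ
      obtain ⟨ρ', N1, d, h1, h2, -, h4⟩ := step g ρ hρ a η τ ha ha2 hη hτ N
      exact ⟨(ρ', N1, d), h1, h2, h4⟩)
  have hmono : StrictMono fun l => (s l).2.1 := strictMono_nat_of_lt_succ fun l => (hs l).2.1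
  obtain ⟨c, -, hc⟩ := glue _ hmono (fun l => (s (l + 1)).2.2)
  refine ⟨fun l => (s l).1, fun l => (s l).2.1, c, by simp [hs0], by simp [hs0], hmono, fun l => ?_⟩
  obtain ⟨h1, -, h3, h4, h5⟩ := hs l
  refine ⟨h1, fun t => ?_, ?_, h5⟩
  · rw [Finset.sum_congr rfl fun k hk => by rw [hc l k hk]]
    exact h3 t
  · rw [Finset.sum_congr rfl fun k hk => by rw [hc l k hk]]
    exact h4

theorem sum_Ioc_split {M : Type*} [AddCommMonoid M] (f : ℕ → M) {a b c : ℕ} (h1 : a ≤ b)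
    (h2 : b ≤ c) :
    ∑ k ∈ Finset.Ioc a c, f k = ∑ k ∈ Finset.Ioc a b, f k + ∑ k ∈ Finset.Ioc b c, f k :=
  (Finset.sum_Ioc_consecutive f h1 h2).symm

theorem log_tail (ρ : C(Tor, ℂ)) (hρ : ∀ t, 1 / 2 ≤ ‖ρ t‖) (h : ∫ t : Tor, log ‖ρ t‖ ≤ 1)
    (K : ℝ) (hK : 1 ≤ K) : volume.real {t : Tor | K < ‖ρ t‖} ≤ 10 / log (2 * K) := by
  have hc : Continuous fun t => log ‖ρ t‖ := by
    apply Continuous.log (by fun_prop)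
    intro t; have := hρ t; positivity
  have hlog : 0 < log (2 * K) := log_pos (by linarith)
  have h1 := mul_meas_ge_le_integral_of_nonneg (μ := (volume : Measure Tor))
    (f := fun t => log 2 + log ‖ρ t‖)
    (Eventually.of_forall fun t => by
      simp only [Pi.zero_apply]
      rw [← log_mul (by norm_num) (by have := hρ t; positivity)]
      exact log_nonneg (by linarith [hρ t])) (cont_int (by fun_prop)) (log (2 * K))
  rw [integral_add (cont_int (by fun_prop)) (cont_int hc), integral_const_tor] at h1
  have h2 : volume.real {t : Tor | K < ‖ρ t‖} ≤
      volume.real {t : Tor | log (2 * K) ≤ log 2 + log ‖ρ t‖} := by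
    apply measureReal_mono _ (measure_ne_top _ _)
    intro t ht
    simp only [Set.mem_ofPred_eq] at ht ⊢
    rw [← log_mul (by norm_num) (by linarith)]
    exact log_le_log (by linarith) (by linarith)
  rw [le_div_iff₀ hlog]
  have h3 : 2 * π * log 2 ≤ 9 := by
    have := log_two_lt_d9
    have := pi_lt_d2
    have := pi_pos
    have := log_two_gt_d9
    nlinarith
  nlinarith

theorem kappa_tail (ρ : C(Tor, ℂ)) (hρ : ∀ t, 1 / 2 ≤ ‖ρ t‖) (R : ℝ) (hR : 1 ≤ R) :
    volume.real {t : Tor | 3 / 4 < ‖ρ t‖ ∧ ‖ρ t‖ ≤ R} ≤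
      16 * R ^ 4 * ∫ t : Tor, phi (ρ t) ^ 2 / ‖ρ t‖ ^ 4 := by
  have hphc : Continuous fun t => phi (ρ t) := phi_cont.comp ρ.continuous
  have hρp : ∀ t, 0 < ‖ρ t‖ := fun t => by linarith [hρ t]
  have hck : Continuous fun t => phi (ρ t) ^ 2 / ‖ρ t‖ ^ 4 := by
    apply Continuous.div (by fun_prop) (by fun_prop)
    intro t; have := hρp t; positivity
  have h1 := mul_meas_ge_le_integral_of_nonneg (μ := (volume : Measure Tor))
    (f := fun t => phi (ρ t) ^ 2 / ‖ρ t‖ ^ 4)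
    (Eventually.of_forall fun t => by
      simp only [Pi.zero_apply]; positivity) (cont_int hck) (1 / (16 * R ^ 4))
  have h2 : volume.real {t : Tor | 3 / 4 < ‖ρ t‖ ∧ ‖ρ t‖ ≤ R} ≤
      volume.real {t : Tor | 1 / (16 * R ^ 4) ≤ phi (ρ t) ^ 2 / ‖ρ t‖ ^ 4} := by
    apply measureReal_mono _ (measure_ne_top _ _)
    rintro t ⟨h3, h4⟩
    simp only [Set.mem_ofPred_eq]
    have : 1 / 4 ≤ phi (ρ t) := le_min (by norm_num) (by linarith)
    have h5 : 0 < ‖ρ t‖ := hρp t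
    calc 1 / (16 * R ^ 4) = (1 / 4) ^ 2 / R ^ 4 := by field_simp; norm_num
      _ ≤ _ := by gcongr
  simp only [one_div] at h1 h2
  rw [inv_mul_le_iff₀ (by positivity)] at h1
  exact h2.trans h1

theorem params (G δ T : ℝ) (hG : 0 ≤ G) (hδ : 0 < δ) (hT : 0 < T) :
    ∃ (n : ℕ) (a : ℝ), 0 < n ∧ 0 < a ∧ a ≤ 1 / 2 ∧ a ^ 2 * n = T ∧ a * (G + 1) ≤ 1 ∧
      n * ((a * (G + 1)) ^ 2 * (a * (G + 1)) ^ δ) ≤ δ ∧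
      2 * π * (a * (G + 1)) ^ 2 ≤ δ * (δ / 2) ^ 2 := by
  have ha : Tendsto (fun n : ℕ => √(T / n)) atTop (𝓝 0) := by
    have : Tendsto (fun n : ℕ => T / (n : ℝ)) atTop (𝓝 0) :=
      tendsto_const_div_atTop_nhds_zero_nat T
    simpa using this.sqrt
  have hA : Tendsto (fun n : ℕ => √(T / n) * (G + 1)) atTop (𝓝 0) := by
    simpa using ha.mul_const (G + 1)
  have h1 : Tendsto (fun n : ℕ => T * (G + 1) ^ 2 * (√(T / n) * (G + 1)) ^ δ) atTop (𝓝 0) := by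
    have := hA.rpow_const (p := δ) (Or.inr hδ.le)
    rw [Real.zero_rpow hδ.ne'] at this
    simpa using this.const_mul (T * (G + 1) ^ 2)
  have h2 : Tendsto (fun n : ℕ => 2 * π * (√(T / n) * (G + 1)) ^ 2) atTop (𝓝 0) := by
    simpa using (hA.pow 2).const_mul (2 * π)
  obtain ⟨n, hn, e1, e2, e3, e4⟩ := ((eventually_gt_atTop 0).and
    ((ha.eventually (ge_mem_nhds (show (0:ℝ) < 1 / 2 by norm_num))).and
    ((hA.eventually (ge_mem_nhds (show (0:ℝ) < 1 by norm_num))).and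
    ((h1.eventually (ge_mem_nhds hδ)).and
    (h2.eventually (ge_mem_nhds (show 0 < δ * (δ / 2) ^ 2 by positivity))))))).exists
  have hn' : (0 : ℝ) < n := by exact_mod_cast hn
  have hsq : √(T / n) ^ 2 * n = T := by
    rw [Real.sq_sqrt (by positivity)]; field_simp
  refine ⟨n, √(T / n), hn, by positivity, e1, hsq, e2, ?_, e4⟩
  calc _ = (√(T / n) ^ 2 * n) * (G + 1) ^ 2 * (√(T / n) * (G + 1)) ^ δ := by ring
    _ ≤ δ := by rw [hsq]; exact e3

theorem exists_block (N : ℕ → ℕ) (i m : ℕ) (hi : 0 < i) (h0 : N 0 ≤ m) (h1 : m ≤ N i) :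
    ∃ l < i, N l ≤ m ∧ m ≤ N (l + 1) := by
  induction i with
  | zero => omega
  | succ i ih =>
    by_cases h : m ≤ N i
    · rcases Nat.eq_zero_or_pos i with h' | h'
      · subst h'; exact ⟨0, by omega, h0, h1⟩
      · obtain ⟨l, hl, h⟩ := ih h' h
        exact ⟨l, by omega, h⟩
    · exact ⟨i, by omega, by omega, h1⟩

theorem stage (g : C(Tor, ℂ)) (δ : ℝ) (hδ : 0 < δ) (N0 : ℕ) :
    ∃ (N1 : ℕ) (c : ℕ → ℂ), N0 < N1 ∧ (∀ k ∈ Finset.Ioc N0 N1, ‖c k‖ ≤ 1) ∧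
      ∑ k ∈ Finset.Ioc N0 N1, ‖c k‖ ^ (2 + δ) ≤ δ ∧
      volume.real {t : Tor | 3 / 4 * ‖g t‖ + δ <
        ‖g t - ∑ k ∈ Finset.Ioc N0 N1, c k * fourier (k : ℤ) t‖} ≤ δ ∧
      ∀ m, N0 ≤ m → m ≤ N1 → ∀ K : ℝ, 1 ≤ K → volume.real {t : Tor | K * ‖g t‖ + δ <
        ‖g t - ∑ k ∈ Finset.Ioc N0 m, c k * fourier (k : ℤ) t‖} ≤ 10 / log (2 * K) + δ := by
  -- parameters
  obtain ⟨R, hR1, hR⟩ : ∃ R : ℝ, 1 ≤ R ∧ 10 / log (2 * R) ≤ δ / 2 := by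
    have : Tendsto (fun R : ℝ => 10 / log (2 * R)) atTop (𝓝 0) :=
      (tendsto_log_atTop.comp (tendsto_id.const_mul_atTop (by norm_num : (0:ℝ) < 2))).const_div_atTop 10
    obtain ⟨R, h1, h2⟩ := ((eventually_ge_atTop 1).and
      (this.eventually (ge_mem_nhds (half_pos hδ)))).exists
    exact ⟨R, h1, h2⟩
  set T : ℝ := 32 * R ^ 4 * (8 * π + 1) / δ with hTdef
  have hT : 0 < T := by positivity
  obtain ⟨n, a, hn, ha, ha2, hna, hA1, hAn, hAδ⟩ := params ‖g‖ δ T (norm_nonneg _) hδ hT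
  set A := a * (‖g‖ + 1) with hA
  have hA0 : 0 < A := by positivity
  set η := min a (δ / (2 * n)) with hη
  have hn' : (0 : ℝ) < n := by exact_mod_cast hn
  have hη0 : 0 < η := lt_min ha (by positivity)
  have hηn : n * η ≤ δ / 2 := by
    calc n * η ≤ n * (δ / (2 * n)) := by gcongr; exact min_le_right _ _
      _ = δ / 2 := by field_simp
  have haη : a * ‖g‖ + η ≤ A := by
    have : η ≤ a := min_le_left _ _
    rw [hA]; linarith
  obtain ⟨ρ, N, c, hρ0, hN0, hN, hch⟩ := chain g a η (1 / (n + 1)) ha ha2 hη0 (by positivity) N0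
  have hsq : ∀ l, ∑ k ∈ Finset.Ioc (N l) (N (l + 1)), ‖c k‖ ^ 2 ≤ A ^ 2 := fun l =>
    (hch l).2.2.1.trans (by gcongr)
  have hN0l : ∀ l, N0 ≤ N l := fun l => hN0 ▸ hN.monotone (Nat.zero_le l)
  -- cumulative error
  have herr : ∀ l : ℕ, ∀ t : Tor, ‖∑ k ∈ Finset.Ioc N0 (N l), c k * fourier (k : ℤ) t -
      (g t - g t * ρ l t)‖ ≤ l * η := by
    intro l t
    induction l with
    | zero => simp [hN0, hρ0]
    | succ l ih =>
      rw [sum_Ioc_split _ (hN0l l) (hN.monotone (Nat.le_succ l))]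
      have := (hch l).2.1 t
      calc _ = ‖(∑ k ∈ Finset.Ioc N0 (N l), c k * fourier (k : ℤ) t - (g t - g t * ρ l t)) +
            (∑ k ∈ Finset.Ioc (N l) (N (l + 1)), c k * fourier (k : ℤ) t -
              (g t * ρ l t - g t * ρ (l + 1) t))‖ := by congr 1; ring
        _ ≤ l * η + η := (norm_add_le _ _).trans (add_le_add ih this)
        _ = _ := by push_cast; ring
  have hlog : ∀ l : ℕ, ∫ t : Tor, log ‖ρ l t‖ ≤ l * (1 / (n + 1)) := by
    intro l
    induction l with
    | zero => simp [hρ0]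
    | succ l ih =>
      have := (hch l).2.2.2.1
      push_cast
      linarith
  have hlog1 : ∀ l ≤ n, ∫ t : Tor, log ‖ρ l t‖ ≤ 1 := by
    intro l hl
    refine (hlog l).trans ?_
    rw [mul_one_div, div_le_one (by positivity)]
    have : (l : ℝ) ≤ n := by exact_mod_cast hl
    linarith
  have hinv : ∀ l : ℕ, a ^ 2 * (∑ i ∈ Finset.range l, ∫ t : Tor, phi (ρ i t) ^ 2 / ‖ρ i t‖ ^ 4) -
      l * (1 / (n + 1)) ≤ ∫ t : Tor, (‖ρ l t‖ ^ 2)⁻¹ := by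
    intro l
    induction l with
    | zero => simp [hρ0]
    | succ l ih =>
      have := (hch l).2.2.2.2
      rw [Finset.sum_range_succ]
      push_cast
      linarith
  have hinv_le : ∀ l, ∫ t : Tor, (‖ρ l t‖ ^ 2)⁻¹ ≤ 8 * π := by
    intro l
    have hp := (hch l).1
    calc ∫ t : Tor, (‖ρ l t‖ ^ 2)⁻¹ ≤ ∫ t : Tor, (4 : ℝ) := by
          apply integral_mono (cont_int _) (cont_int (by fun_prop))
          · intro t
            have := hp t
            simp only
            rw [inv_le_comm₀ (by positivity) (by norm_num)]
            nlinarith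
          · apply Continuous.inv₀ (by fun_prop)
            intro t; have := hp t; positivity
      _ = _ := by rw [integral_const_tor]; ring
  -- choose the good index
  obtain ⟨j, hj, hκ⟩ : ∃ j < n, ∫ t : Tor, phi (ρ (j + 1) t) ^ 2 / ‖ρ (j + 1) t‖ ^ 4 ≤
      (8 * π + 1) / T := by
    by_contra! hcon
    have h1 := hinv (n + 1)
    have h2 := hinv_le (n + 1)
    rw [Finset.sum_range_succ'] at h1
    have h3 : ∑ i ∈ Finset.range n, (8 * π + 1) / T <
        ∑ i ∈ Finset.range n, ∫ t : Tor, phi (ρ (i + 1) t) ^ 2 / ‖ρ (i + 1) t‖ ^ 4 :=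
      Finset.sum_lt_sum_of_nonempty ⟨0, by simpa using hn⟩ fun i hi => hcon i (by simpa using hi)
    have h4 : 0 ≤ ∫ t : Tor, phi (ρ 0 t) ^ 2 / ‖ρ 0 t‖ ^ 4 := integral_nonneg fun t => by positivity
    rw [Finset.sum_const, Finset.card_range, nsmul_eq_mul] at h3
    have h5 : a ^ 2 * (n * ((8 * π + 1) / T)) = 8 * π + 1 := by
      rw [← mul_assoc, hna]; field_simp
    have h6 : ((n + 1 : ℕ) : ℝ) * (1 / (n + 1)) = 1 := by push_cast; field_simp
    have h7 := mul_lt_mul_of_pos_left h3 (show 0 < a ^ 2 by positivity)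
    have h8 : 0 ≤ a ^ 2 * ∫ t : Tor, phi (ρ 0 t) ^ 2 / ‖ρ 0 t‖ ^ 4 := by positivity
    rw [mul_add] at h1
    linarith
  have hjn : ((j + 1 : ℕ) : ℝ) ≤ n := by exact_mod_cast hj
  have hle : ∀ l : ℕ, (l : ℝ) ≤ n → ∀ t : Tor, ‖g t - ∑ k ∈ Finset.Ioc N0 (N l), c k * fourier (k : ℤ) t‖ ≤
      ‖ρ l t‖ * ‖g t‖ + δ / 2 := by
    intro l hl t
    calc _ = ‖ρ l t * g t - (∑ k ∈ Finset.Ioc N0 (N l), c k * fourier (k : ℤ) t -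
          (g t - g t * ρ l t))‖ := by congr 1; ring
      _ ≤ ‖ρ l t * g t‖ + l * η := (norm_sub_le _ _).trans (by gcongr; exact herr l t)
      _ ≤ ‖ρ l t‖ * ‖g t‖ + δ / 2 := by
        rw [norm_mul]
        have : l * η ≤ n * η := by gcongr
        linarith
  have hcA : ∀ l, ∀ k ∈ Finset.Ioc (N l) (N (l + 1)), ‖c k‖ ≤ A := by
    intro l k hk
    have h1 : ‖c k‖ ^ 2 ≤ ∑ k ∈ Finset.Ioc (N l) (N (l + 1)), ‖c k‖ ^ 2 :=
      Finset.single_le_sum (f := fun k => ‖c k‖ ^ 2) (fun _ _ => by positivity) hk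
    exact le_of_sq_le_sq (h1.trans (hsq l)) hA0.le
  refine ⟨N (j + 1), c, ?_, ?_, ?_, ?_, ?_⟩
  · rw [← hN0]; exact hN (Nat.succ_pos j)
  · intro k hk
    rw [Finset.mem_Ioc] at hk
    obtain ⟨l, hl, h1, h2⟩ := exists_block (fun i => N i + 1) (j + 1) k (by omega)
      (by simp only [hN0]; omega) (by omega)
    by_cases h3 : k ≤ N (l + 1)
    · exact (hcA l k (by rw [Finset.mem_Ioc]; omega)).trans hA1
    · have : N (l + 1) < N (l + 1 + 1) := hN (by omega)
      exact (hcA (l + 1) k (by rw [Finset.mem_Ioc]; constructor <;> omega)).trans hA1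
  · have hs : ∀ l : ℕ, ∑ k ∈ Finset.Ioc N0 (N l), ‖c k‖ ^ (2 + δ) ≤ l * (A ^ 2 * A ^ δ) := by
      intro l
      induction l with
      | zero => simp [hN0]
      | succ l ih =>
        rw [sum_Ioc_split _ (hN0l l) (hN.monotone (Nat.le_succ l))]
        have : ∑ k ∈ Finset.Ioc (N l) (N (l + 1)), ‖c k‖ ^ (2 + δ) ≤ A ^ 2 * A ^ δ := by
          calc _ ≤ ∑ k ∈ Finset.Ioc (N l) (N (l + 1)), ‖c k‖ ^ 2 * A ^ δ := by
                apply Finset.sum_le_sum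
                intro k hk
                rw [Real.rpow_add_of_nonneg (norm_nonneg _) (by norm_num) hδ.le, Real.rpow_two]
                have := hcA l k hk
                gcongr
            _ ≤ _ := by
                rw [← Finset.sum_mul]
                have := hsq l
                gcongr
        push_cast
        linarith
    refine (hs (j + 1)).trans (le_trans ?_ hAn)
    gcongr
  · have hsub : {t : Tor | 3 / 4 * ‖g t‖ + δ <
        ‖g t - ∑ k ∈ Finset.Ioc N0 (N (j + 1)), c k * fourier (k : ℤ) t‖} ⊆
        {t : Tor | 3 / 4 < ‖ρ (j + 1) t‖ ∧ ‖ρ (j + 1) t‖ ≤ R} ∪ {t : Tor | R < ‖ρ (j + 1) t‖} := by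
      intro t ht
      simp only [Set.mem_ofPred_eq, Set.mem_union] at ht ⊢
      have := hle (j + 1) hjn t
      rcases le_or_gt ‖ρ (j + 1) t‖ R with h | h
      · refine Or.inl ⟨?_, h⟩
        by_contra! h3
        have : ‖ρ (j + 1) t‖ * ‖g t‖ ≤ 3 / 4 * ‖g t‖ := by gcongr
        linarith
      · exact Or.inr h
    calc _ ≤ _ := measureReal_mono hsub (measure_ne_top _ _)
      _ ≤ _ := measureReal_union_le _ _
      _ ≤ 16 * R ^ 4 * ((8 * π + 1) / T) + 10 / log (2 * R) := by
        apply add_le_add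
        · refine (kappa_tail _ (hch (j + 1)).1 R hR1).trans ?_
          gcongr
        · exact log_tail _ (hch (j + 1)).1 (hlog1 _ (by omega)) R hR1
      _ ≤ δ / 2 + δ / 2 := by
        apply add_le_add _ hR
        rw [hTdef]
        apply le_of_eq
        field_simp
        norm_num
      _ = δ := by ring
  · intro m hm0 hm1 K hK
    obtain ⟨l, hl, h1, h2⟩ := exists_block N (j + 1) m (by omega) (by omega) hm1
    have hln : (l : ℝ) ≤ n := by exact_mod_cast (by omega : l ≤ n)
    have hsub : {t : Tor | K * ‖g t‖ + δ <
        ‖g t - ∑ k ∈ Finset.Ioc N0 m, c k * fourier (k : ℤ) t‖} ⊆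
        {t : Tor | K < ‖ρ l t‖} ∪
        {t : Tor | (δ / 2) ^ 2 ≤ ‖∑ k ∈ Finset.Ioc (N l) m, c k * fourier (k : ℤ) t‖ ^ 2} := by
      intro t ht
      simp only [Set.mem_ofPred_eq, Set.mem_union] at ht ⊢
      have h3 := hle l hln t
      rw [sum_Ioc_split _ (hN0l l) h1, ← sub_sub] at ht
      have h4 := norm_sub_le (g t - ∑ k ∈ Finset.Ioc N0 (N l), c k * fourier (k : ℤ) t)
        (∑ k ∈ Finset.Ioc (N l) m, c k * fourier (k : ℤ) t)
      rcases le_or_gt ‖ρ l t‖ K with h | h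
      · right
        have : ‖ρ l t‖ * ‖g t‖ ≤ K * ‖g t‖ := by gcongr
        gcongr
        linarith
      · exact Or.inl h
    calc _ ≤ _ := measureReal_mono hsub (measure_ne_top _ _)
      _ ≤ _ := measureReal_union_le _ _
      _ ≤ _ := by
        apply add_le_add
        · exact log_tail _ (hch l).1 (hlog1 _ (by omega)) K hK
        · have h5 := mul_meas_ge_le_integral_of_nonneg (μ := (volume : Measure Tor))
            (f := fun t : Tor => ‖∑ k ∈ Finset.Ioc (N l) m, c k * fourier (k : ℤ) t‖ ^ 2)
            (Eventually.of_forall fun t => by simp only [Pi.zero_apply]; positivity)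
            (cont_int (by fun_prop)) ((δ / 2) ^ 2)
          rw [parseval] at h5
          have h6 : ∑ k ∈ Finset.Ioc (N l) m, ‖c k‖ ^ 2 ≤ A ^ 2 := by
            refine le_trans (Finset.sum_le_sum_of_subset_of_nonneg ?_ fun _ _ _ => by positivity)
              (hsq l)
            exact Finset.Ioc_subset_Ioc_right h2
          have h7 : 2 * π * ∑ k ∈ Finset.Ioc (N l) m, ‖c k‖ ^ 2 ≤ 2 * π * A ^ 2 := by gcongr
          have h8 : 0 < (δ / 2) ^ 2 := by positivity
          refine le_of_mul_le_mul_left (h5.trans (h7.trans (hAδ.trans (le_of_eq ?_)))) h8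
          ring

theorem approx (f : Tor → ℂ) (hf : Measurable f) (δ : ℝ) (hδ : 0 < δ) :
    ∃ g : C(Tor, ℂ), volume.real {t : Tor | δ < ‖f t - g t‖} ≤ δ := by
  let F : ℕ → Tor → ℂ := fun n => {t | ‖f t‖ ≤ n}.indicator f
  have hms : ∀ n : ℕ, MeasurableSet {t | ‖f t‖ ≤ n} := fun n => measurableSet_le hf.norm measurable_const
  have hFm : ∀ n, Measurable (F n) := fun n => hf.indicator (hms n)
  have hlim : TendstoInMeasure volume F atTop f := by
    apply tendstoInMeasure_of_tendsto_ae (fun n => (hFm n).aestronglyMeasurable)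
    refine Eventually.of_forall fun t => ?_
    apply tendsto_const_nhds.congr'
    obtain ⟨n0, hn0⟩ := exists_nat_ge ‖f t‖
    filter_upwards [eventually_ge_atTop n0] with n hn
    have : t ∈ {t | ‖f t‖ ≤ n} := hn0.trans (by exact_mod_cast hn)
    exact (Set.indicator_of_mem this f).symm
  rw [tendstoInMeasure_iff_measureReal_norm] at hlim
  obtain ⟨n, hn⟩ := ((hlim (δ / 2) (half_pos hδ)).eventually (ge_mem_nhds (half_pos hδ))).exists
  have hFi : Integrable (F n) volume := by
    apply Integrable.of_bound (hFm n).aestronglyMeasurable (C := n)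
    refine Eventually.of_forall fun t => ?_
    by_cases h : t ∈ {t | ‖f t‖ ≤ n}
    · simp only [F]; rw [Set.indicator_of_mem h]; exact h
    · simp only [F]; rw [Set.indicator_of_notMem h]; simp
  obtain ⟨g, -, hg, hgc, -⟩ := hFi.exists_hasCompactSupport_integral_sub_le
    (ε := (δ / 2) * (δ / 2)) (by positivity)
  refine ⟨⟨g, hgc⟩, ?_⟩
  have h1 := mul_meas_ge_le_integral_of_nonneg (μ := (volume : Measure Tor))
    (f := fun t : Tor => ‖F n t - g t‖)
    (Eventually.of_forall fun t => by simp only [Pi.zero_apply]; positivity)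
    ((hFi.sub (cont_int hgc)).norm) (δ / 2)
  have h2 := le_of_mul_le_mul_left (h1.trans hg) (half_pos hδ)
  have hsub : {t : Tor | δ < ‖f t - g t‖} ⊆
      {t : Tor | δ / 2 ≤ ‖F n t - f t‖} ∪ {t : Tor | δ / 2 ≤ ‖F n t - g t‖} := by
    intro t ht
    simp only [Set.mem_ofPred_eq, Set.mem_union] at ht ⊢
    by_contra! hcon
    have : f t - g t = (F n t - g t) - (F n t - f t) := by ring
    rw [this] at ht
    linarith [norm_sub_le (F n t - g t) (F n t - f t)]
  calc _ ≤ _ := measureReal_mono hsub (measure_ne_top _ _)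
    _ ≤ _ := measureReal_union_le _ _
    _ ≤ δ / 2 + δ / 2 := add_le_add hn h2
    _ = δ := by ring

theorem rec_tendsto (x : ℕ → ℝ) (hx : ∀ j, 0 ≤ x j)
    (h : ∀ᶠ j in atTop, x (j + 1) ≤ 3 / 4 * x j + 3 * (1 / 2) ^ j) : Tendsto x atTop (𝓝 0) := by
  obtain ⟨J, hJ⟩ := eventually_atTop.1 h
  rw [← tendsto_add_atTop_iff_nat J]
  have hb : ∀ m, x (m + J) + 12 * (1 / 2) ^ (m + J) ≤ (3 / 4) ^ m * (x J + 12 * (1 / 2) ^ J) := by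
    intro m
    induction m with
    | zero => simp
    | succ m ih =>
      have := hJ (m + J) (by omega)
      rw [show m + 1 + J = m + J + 1 by ring, pow_succ (1 / 2 : ℝ), pow_succ (3 / 4 : ℝ)]
      linarith
  have hlim : Tendsto (fun m : ℕ => (3 / 4 : ℝ) ^ m * (x J + 12 * (1 / 2) ^ J)) atTop (𝓝 0) := by
    simpa using (tendsto_pow_atTop_nhds_zero_of_lt_one (by norm_num : (0:ℝ) ≤ 3 / 4)
      (by norm_num)).mul_const (x J + 12 * (1 / 2) ^ J)
  refine squeeze_zero (fun m => hx _) (fun m => ?_) hlim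
  have : (0 : ℝ) < (1 / 2) ^ (m + J) := by positivity
  linarith [hb m]

theorem summ (N : ℕ → ℕ) (hN : StrictMono N) (c : ℕ → ℂ)
    (h1 : ∀ j, ∀ k ∈ Finset.Ioc (N j) (N (j + 1)), ‖c k‖ ≤ 1)
    (h2 : ∀ j, ∑ k ∈ Finset.Ioc (N j) (N (j + 1)), ‖c k‖ ^ (2 + (1 / 2 : ℝ) ^ j) ≤ (1 / 2) ^ j)
    (ε : ℝ) (hε : 0 < ε) : Summable (fun k : ℕ => ‖c k‖ ^ (2 + ε)) := by
  obtain ⟨J, hJ⟩ := exists_pow_lt_of_lt_one hε (by norm_num : (1 / 2 : ℝ) < 1)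
  have hblock : ∀ i, ∑ k ∈ Finset.Ioc (N (J + i)) (N (J + i + 1)), ‖c k‖ ^ (2 + ε) ≤ (1 / 2) ^ i := by
    intro i
    have hle : (1 / 2 : ℝ) ^ (J + i) ≤ (1 / 2) ^ i :=
      pow_le_pow_of_le_one (by norm_num) (by norm_num) (by omega)
    have hle2 : (1 / 2 : ℝ) ^ (J + i) ≤ (1 / 2) ^ J :=
      pow_le_pow_of_le_one (by norm_num) (by norm_num) (by omega)
    refine le_trans (Finset.sum_le_sum fun k hk => ?_) ((h2 (J + i)).trans hle)
    exact Real.rpow_le_rpow_of_exponent_ge_of_imp (norm_nonneg _) (h1 _ k hk) (by linarith)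
      (fun _ h => by
        have : (0 : ℝ) < (1 / 2) ^ (J + i) := by positivity
        linarith)
  have hcum : ∀ m, ∑ k ∈ Finset.range (N (J + m) + 1), ‖c k‖ ^ (2 + ε) ≤
      ∑ k ∈ Finset.range (N J + 1), ‖c k‖ ^ (2 + ε) + ∑ i ∈ Finset.range m, (1 / 2 : ℝ) ^ i := by
    intro m
    induction m with
    | zero => simp
    | succ m ih =>
      have h3 : N (J + m) < N (J + (m + 1)) := hN (by omega)
      have h4 : Finset.range (N (J + (m + 1)) + 1) =
          Finset.range (N (J + m) + 1) ∪ Finset.Ioc (N (J + m)) (N (J + m + 1)) := by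
        ext k
        simp only [Finset.mem_range, Finset.mem_union, Finset.mem_Ioc, ← add_assoc] at *
        omega
      have h5 : Disjoint (Finset.range (N (J + m) + 1))
          (Finset.Ioc (N (J + m)) (N (J + m + 1))) := by
        rw [Finset.disjoint_left]
        intro k hk hk'
        simp only [Finset.mem_range, Finset.mem_Ioc] at *
        omega
      rw [h4, Finset.sum_union h5, Finset.sum_range_succ (fun i => (1 / 2 : ℝ) ^ i)]
      linarith [hblock m]
  apply summable_of_sum_range_le
    (c := ∑ k ∈ Finset.range (N J + 1), ‖c k‖ ^ (2 + ε) + 2) (fun k => by positivity)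
  intro n
  have hn : n ≤ N (J + n) + 1 := by
    have := hN.le_apply (x := J + n); omega
  calc _ ≤ ∑ k ∈ Finset.range (N (J + n) + 1), ‖c k‖ ^ (2 + ε) :=
        Finset.sum_le_sum_of_subset_of_nonneg (Finset.range_subset_range.2 hn)
          fun _ _ _ => by positivity
    _ ≤ _ := hcum n
    _ ≤ _ := by gcongr; exact sum_geometric_two_le n

end AM

/-- Every measurable `f : 𝕋 → ℂ` has a representation `f = ∑_{k>0} c_k e^{ikt}`
converging in measure, with coefficients `(c_k) ∈ ℓ^{2+ε}` for every `ε > 0`. -/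
theorem analytic_menshov_in_measure_small_coefficients
    (f : AddCircle (2 * π) → ℂ) (hf : Measurable f) :
    ∃ c : ℕ → ℂ,
      (∀ ε : ℝ, 0 < ε → Summable (fun k : ℕ => ‖c k‖ ^ (2 + ε))) ∧
      TendstoInMeasure volume (fun N => analyticPartialSum c N) atTop f := by
  have hδ : ∀ j : ℕ, (0 : ℝ) < (1 / 2) ^ j := fun j => by positivity
  choose fa hfa using fun j : ℕ => AM.approx f hf ((1 / 2) ^ j) (hδ j)
  obtain ⟨s, hs0, hs⟩ := AM.exists_seq (α := C(AM.Tor, ℂ) × ℕ × (ℕ → ℂ)) (fun _ => True)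
    (fun j s s' => s.2.1 < s'.2.1 ∧ (∀ k ∈ Finset.Ioc s.2.1 s'.2.1, ‖s'.2.2 k‖ ≤ 1) ∧
      ∑ k ∈ Finset.Ioc s.2.1 s'.2.1, ‖s'.2.2 k‖ ^ (2 + (1 / 2 : ℝ) ^ j) ≤ (1 / 2) ^ j ∧
      volume.real {t : AM.Tor | 3 / 4 * ‖s.1 t‖ + (1 / 2) ^ j <
        ‖s.1 t - ∑ k ∈ Finset.Ioc s.2.1 s'.2.1, s'.2.2 k * fourier (k : ℤ) t‖} ≤ (1 / 2) ^ j ∧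
      (∀ m, s.2.1 ≤ m → m ≤ s'.2.1 → ∀ K : ℝ, 1 ≤ K →
        volume.real {t : AM.Tor | K * ‖s.1 t‖ + (1 / 2) ^ j <
        ‖s.1 t - ∑ k ∈ Finset.Ioc s.2.1 m, s'.2.2 k * fourier (k : ℤ) t‖} ≤
          10 / log (2 * K) + (1 / 2) ^ j) ∧
      ∀ t, s'.1 t = s.1 t - ∑ k ∈ Finset.Ioc s.2.1 s'.2.1, s'.2.2 k * fourier (k : ℤ) t +
        (fa (j + 1) t - fa j t)) (fa 0, 0, 0) trivial (by
      rintro j ⟨g, N, c⟩ -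
      obtain ⟨N1, d, h1, h2, h3, h4, h5⟩ := AM.stage g ((1 / 2) ^ j) (hδ j) N
      refine ⟨(⟨fun t => g t - ∑ k ∈ Finset.Ioc N N1, d k * fourier (k : ℤ) t +
        (fa (j + 1) t - fa j t), by fun_prop⟩, N1, d), trivial, h1, h2, h3, h4, h5, fun t => rfl⟩)
  have hN : StrictMono fun l => (s l).2.1 := strictMono_nat_of_lt_succ fun l => (hs l).2.1
  obtain ⟨c, -, hc⟩ := AM.glue _ hN (fun l => (s (l + 1)).2.2)
  obtain ⟨N, hNdef⟩ : ∃ N : ℕ → ℕ, ∀ l, N l = (s l).2.1 := ⟨_, fun _ => rfl⟩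
  obtain ⟨g, hgdef⟩ : ∃ g : ℕ → C(AM.Tor, ℂ), ∀ l, g l = (s l).1 := ⟨_, fun _ => rfl⟩
  simp only [← hNdef, ← hgdef] at hs hN hc
  have hN0 : N 0 = 0 := by rw [hNdef, hs0]
  have hg0 : g 0 = fa 0 := by rw [hgdef, hs0]
  clear hs0 hNdef hgdef
  have hNle : ∀ l, N l ≤ N (l + 1) := fun l => (hN (Nat.lt_succ_self l)).le
  have hcs : ∀ l m, m ≤ N (l + 1) → ∀ t : AM.Tor,
      ∑ k ∈ Finset.Ioc (N l) m, (s (l + 1)).2.2 k * fourier (k : ℤ) t =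
      ∑ k ∈ Finset.Ioc (N l) m, c k * fourier (k : ℤ) t := by
    intro l m hm t
    refine Finset.sum_congr rfl fun k hk => ?_
    rw [hc l k (Finset.Ioc_subset_Ioc_right hm hk)]
  have hb1 : ∀ l, ∀ k ∈ Finset.Ioc (N l) (N (l + 1)), ‖c k‖ ≤ 1 := fun l k hk => by
    rw [hc l k hk]; exact (hs l).2.2.1 k hk
  have hb2 : ∀ l, ∑ k ∈ Finset.Ioc (N l) (N (l + 1)), ‖c k‖ ^ (2 + (1 / 2 : ℝ) ^ l) ≤
      (1 / 2) ^ l := fun l => by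
    rw [Finset.sum_congr rfl fun k hk => by rw [hc l k hk]]; exact (hs l).2.2.2.1
  have hb3 : ∀ l, volume.real {t : AM.Tor | 3 / 4 * ‖g l t‖ + (1 / 2) ^ l <
        ‖g l t - ∑ k ∈ Finset.Ioc (N l) (N (l + 1)), c k * fourier (k : ℤ) t‖} ≤ (1 / 2) ^ l :=
    fun l => by
      have := (hs l).2.2.2.2.1
      simp only [hcs l _ le_rfl] at this
      exact this
  have hb4 : ∀ l m, N l ≤ m → m ≤ N (l + 1) → ∀ K : ℝ, 1 ≤ K →
        volume.real {t : AM.Tor | K * ‖g l t‖ + (1 / 2) ^ l <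
        ‖g l t - ∑ k ∈ Finset.Ioc (N l) m, c k * fourier (k : ℤ) t‖} ≤
          10 / log (2 * K) + (1 / 2) ^ l := fun l m h1 h2 K hK => by
      have := (hs l).2.2.2.2.2.1 m h1 h2 K hK
      simp only [hcs l _ h2] at this
      exact this
  have hb5 : ∀ l t, g (l + 1) t = g l t -
      ∑ k ∈ Finset.Ioc (N l) (N (l + 1)), c k * fourier (k : ℤ) t + (fa (l + 1) t - fa l t) :=
    fun l t => by
      rw [← hcs l _ le_rfl]
      exact (hs l).2.2.2.2.2.2 t
  clear hs hcs hc s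
  refine ⟨c, AM.summ N hN c hb1 hb2, ?_⟩
  -- partial sums
  have hS : ∀ m t, analyticPartialSum c m t = ∑ k ∈ Finset.Ioc 0 m, c k * fourier (k : ℤ) t :=
    fun m t => rfl
  have hsplit : ∀ l m t, N l ≤ m → analyticPartialSum c m t =
      analyticPartialSum c (N l) t + ∑ k ∈ Finset.Ioc (N l) m, c k * fourier (k : ℤ) t := by
    intro l m t h
    rw [hS, hS]
    exact AM.sum_Ioc_split _ (Nat.zero_le _) h
  have hg : ∀ l t, g l t = fa l t - analyticPartialSum c (N l) t := by
    intro l t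
    induction l with
    | zero => rw [hg0, hN0, hS]; simp
    | succ l ih => rw [hb5, ih, hsplit l (N (l + 1)) t (hNle l)]; ring
  have hgr : ∀ l t, ‖f t - fa l t‖ ≤ (1 / 2) ^ l →
      ‖g l t‖ ≤ ‖analyticPartialSum c (N l) t - f t‖ + (1 / 2) ^ l := by
    intro l t h
    have : g l t = -(analyticPartialSum c (N l) t - f t) - (f t - fa l t) := by rw [hg]; ring
    rw [this]
    refine (norm_sub_le _ _).trans ?_
    rw [norm_neg]
    linarith
  have hdec : ∀ l m t, N l ≤ m → ‖f t - fa l t‖ ≤ (1 / 2) ^ l →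
      ‖analyticPartialSum c m t - f t‖ ≤ (1 / 2) ^ l +
        ‖g l t - ∑ k ∈ Finset.Ioc (N l) m, c k * fourier (k : ℤ) t‖ := by
    intro l m t hm h
    have : analyticPartialSum c m t - f t = -((f t - fa l t) +
      (g l t - ∑ k ∈ Finset.Ioc (N l) m, c k * fourier (k : ℤ) t)) := by
      rw [hg, hsplit l m t hm]; ring
    rw [this, norm_neg]
    exact (norm_add_le _ _).trans (by linarith)
  have hcont : ∀ m, Continuous fun t => analyticPartialSum c m t := by
    intro m
    unfold analyticPartialSum
    fun_prop
  -- a.e. convergence along the subsequence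
  have hae : ∀ᵐ t ∂(volume : Measure AM.Tor),
      Tendsto (fun l => analyticPartialSum c (N l) t) atTop (𝓝 (f t)) := by
    have hBC := ae_eventually_notMem (μ := (volume : Measure AM.Tor))
      (s := fun l => {t : AM.Tor | (1 / 2) ^ l < ‖f t - fa l t‖} ∪
        {t : AM.Tor | 3 / 4 * ‖g l t‖ + (1 / 2) ^ l <
        ‖g l t - ∑ k ∈ Finset.Ioc (N l) (N (l + 1)), c k * fourier (k : ℤ) t‖}) (by
      have hle : ∀ l, volume ({t : AM.Tor | (1 / 2) ^ l < ‖f t - fa l t‖} ∪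
        {t : AM.Tor | 3 / 4 * ‖g l t‖ + (1 / 2) ^ l <
        ‖g l t - ∑ k ∈ Finset.Ioc (N l) (N (l + 1)), c k * fourier (k : ℤ) t‖}) ≤
          ENNReal.ofReal (2 * (1 / 2) ^ l) := by
        intro l
        rw [← ofReal_measureReal]
        apply ENNReal.ofReal_le_ofReal
        refine (measureReal_union_le _ _).trans ?_
        linarith [hfa l, hb3 l]
      refine ne_top_of_le_ne_top ?_ (ENNReal.tsum_le_tsum hle)
      have hsum : Summable fun l : ℕ => 2 * (1 / 2 : ℝ) ^ l := summable_geometric_two.mul_left 2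
      exact hsum.tsum_ofReal_ne_top)
    filter_upwards [hBC] with t ht
    rw [tendsto_iff_norm_sub_tendsto_zero]
    apply AM.rec_tendsto _ (fun j => norm_nonneg _)
    filter_upwards [ht] with l hl
    simp only [Set.mem_union, Set.mem_ofPred_eq, not_or, not_lt] at hl
    have h1 := hgr l t hl.1
    have h2 := hdec l (N (l + 1)) t (hNle l) hl.1
    have h3 := hδ l
    linarith [hl.2]
  have hmeas := tendstoInMeasure_of_tendsto_ae
    (fun l => (hcont (N l)).aestronglyMeasurable) hae
  rw [tendstoInMeasure_iff_measureReal_norm] at hmeas ⊢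
  intro ε hε
  rw [Metric.tendsto_atTop]
  intro ε' hε'
  obtain ⟨K, hK1, hK⟩ : ∃ K : ℝ, 1 ≤ K ∧ 10 / log (2 * K) ≤ ε' / 4 := by
    have : Tendsto (fun R : ℝ => 10 / log (2 * R)) atTop (𝓝 0) :=
      (tendsto_log_atTop.comp (tendsto_id.const_mul_atTop (by norm_num : (0:ℝ) < 2))).const_div_atTop 10
    obtain ⟨R, h1, h2⟩ := ((eventually_ge_atTop 1).and
      (this.eventually (ge_mem_nhds (show 0 < ε' / 4 by positivity)))).exists
    exact ⟨R, h1, h2⟩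
  have hpow : Tendsto (fun j : ℕ => (1 / 2 : ℝ) ^ j) atTop (𝓝 0) :=
    tendsto_pow_atTop_nhds_zero_of_lt_one (by norm_num) (by norm_num)
  have e1 := (hmeas (ε / (2 * K)) (by positivity)).eventually
    (ge_mem_nhds (show 0 < ε' / 4 by positivity))
  have e2 : ∀ᶠ j : ℕ in atTop, (K + 2) * (1 / 2 : ℝ) ^ j < ε / 2 := by
    have := hpow.const_mul (K + 2)
    rw [mul_zero] at this
    exact this.eventually (gt_mem_nhds (half_pos hε))
  have e3 := hpow.eventually (gt_mem_nhds (show 0 < ε' / 8 by positivity))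
  obtain ⟨J, hJ⟩ := eventually_atTop.1 (e1.and (e2.and e3))
  refine ⟨N J, fun m hm => ?_⟩
  obtain ⟨i, -, hi1, hi2⟩ := AM.exists_block (fun i => N (J + i)) (m + 1) m (by omega) hm
    (by have := hN.le_apply (x := J + (m + 1)); omega)
  obtain ⟨h1, h2, h3⟩ := hJ (J + i) (by omega)
  have hsub : {t : AM.Tor | ε ≤ ‖analyticPartialSum c m t - f t‖} ⊆
      ({t : AM.Tor | ε / (2 * K) ≤ ‖analyticPartialSum c (N (J + i)) t - f t‖} ∪
        {t : AM.Tor | (1 / 2) ^ (J + i) < ‖f t - fa (J + i) t‖}) ∪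
        {t : AM.Tor | K * ‖g (J + i) t‖ + (1 / 2) ^ (J + i) <
          ‖g (J + i) t - ∑ k ∈ Finset.Ioc (N (J + i)) m, c k * fourier (k : ℤ) t‖} := by
    intro t ht
    by_contra hcon
    simp only [Set.mem_union, Set.mem_ofPred_eq, not_or, not_lt, not_le] at hcon ht
    obtain ⟨⟨k1, k2⟩, k3⟩ := hcon
    have k4 := hgr _ t k2
    have k5 := hdec _ m t hi1 k2
    rw [lt_div_iff₀ (by positivity)] at k1
    have k6 : K * ‖g (J + i) t‖ ≤
      K * (‖analyticPartialSum c (N (J + i)) t - f t‖ + (1 / 2) ^ (J + i)) := by gcongr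
    linarith
  rw [Real.dist_eq, sub_zero, abs_of_nonneg measureReal_nonneg]
  calc _ ≤ _ := measureReal_mono hsub (measure_ne_top _ _)
    _ ≤ _ := measureReal_union_le _ _
    _ ≤ _ := add_le_add_left (measureReal_union_le _ _) _
    _ < ε' := by linarith [hfa (J + i), hb4 _ m hi1 hi2 K hK1]
end
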